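/- If pseudorandom unitaries exist, then there exists a quantum channel Sim_t such that for all efficiently samplable mixed states σ there exists a family of efficiently samplable purifications {|φ_k⟩} such that: (1) Sim_t(σ^{⊗t}) is computationally indistinguishable from E_k[|φ_k⟩⟨φ_k|^{⊗t}], i.e., t copies of a random sample |φ_k⟩ can be efficiently approximated using t i.i.d. copies of σ; and (2) σ is computationally indistinguishable from E_k[Tr_B(|φ_k⟩⟨φ_k|_{AB})], i.e., {|φ_k⟩} is a purification of σ. -/

import Mathlib

set_option linter.unusedVariables false

/- ================================================================
   A concrete model of quantum computation on qubit registers.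

   States of an `n`-qubit register are density matrices indexed by
   bit strings of length `n`.  (Non-uniform) quantum polynomial time
   is modelled by families of quantum circuits built from arbitrary
   two-qubit channels, wire permutations, ancilla creation and
   discarding, with polynomially many gates.
   ================================================================ -/

open scoped ComplexOrder Matrix

noncomputable section

/-- Bit strings of length `n`. -/
abbrev BString (n : ℕ) := Fin n → Bool

/-- (Not necessarily normalized) operators on an `n`-qubit register. -/
abbrev QOp (n : ℕ) := Matrix (BString n) (BString n) ℂ

/-- The empty bit string. -/
def bnil : BString 0 := fun i => i.elim0

/-- Splitting a register into two consecutive parts. -/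
def bsplit (a b : ℕ) : BString (a + b) ≃ BString a × BString b :=
  (Equiv.arrowCongr finSumFinEquiv.symm (Equiv.refl Bool)).trans
    (Equiv.sumArrowEquivProdArrow _ _ _)

/-- Concatenation of bit strings. -/
def bappend {a b : ℕ} (s : BString a) (t : BString b) : BString (a + b) :=
  (bsplit a b).symm (s, t)

/-- Recasting the length of a bit string. -/
def bcast {a b : ℕ} (h : a = b) : BString a ≃ BString b :=
  Equiv.arrowCongr (finCongr h) (Equiv.refl Bool)

/-- The all-zero bit string. -/
def bzero (n : ℕ) : BString n := fun _ => false

/-- Viewing a bit string of length `a * w` as `a` blocks of length `w`. -/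
def bflat {a w : ℕ} (f : Fin a → BString w) : BString (a * w) :=
  fun j => f (finProdFinEquiv.symm j).1 (finProdFinEquiv.symm j).2

/-- Recasting the width of a register. -/
def castOp {a b : ℕ} (h : a = b) (M : QOp a) : QOp b :=
  Matrix.reindex (bcast h) (bcast h) M

/-- Tensor product of operators on consecutive registers. -/
def tensorOp {a b : ℕ} (M : QOp a) (N : QOp b) : QOp (a + b) :=
  Matrix.reindex (bsplit a b).symm (bsplit a b).symm
    (Matrix.of fun p q => M p.1 q.1 * N p.2 q.2)

/-- Extension `Φ ⊗ id` of a linear map to `m` further wires on the right. -/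
def extendR {a b : ℕ} (Φ : QOp a → QOp b) (m : ℕ) (M : QOp (a + m)) : QOp (b + m) :=
  Matrix.reindex (bsplit b m).symm (bsplit b m).symm
    (Matrix.of fun p q =>
      Φ (Matrix.of fun x y => Matrix.reindex (bsplit a m) (bsplit a m) M (x, p.2) (y, q.2))
        p.1 q.1)

/-- Extension `id ⊗ Φ` of a linear map to `m` further wires on the left. -/
def extendL {a b : ℕ} (m : ℕ) (Φ : QOp a → QOp b) (M : QOp (m + a)) : QOp (m + b) :=
  Matrix.reindex (bsplit m b).symm (bsplit m b).symm
    (Matrix.of fun p q =>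
      Φ (Matrix.of fun x y => Matrix.reindex (bsplit m a) (bsplit m a) M (p.1, x) (q.1, y))
        p.2 q.2)

/-- Tensor product `Φ ⊗ Ψ` of two (linear) maps. -/
def tensorMap {a b c d : ℕ} (Φ : QOp a → QOp b) (Ψ : QOp c → QOp d)
    (M : QOp (a + c)) : QOp (b + d) :=
  extendL b Ψ (extendR Φ c M)

/-- The channel permuting the wires of a register according to `π`. -/
def permOp {n : ℕ} (π : Equiv.Perm (Fin n)) (M : QOp n) : QOp n :=
  Matrix.reindex (Equiv.arrowCongr π (Equiv.refl Bool)) (Equiv.arrowCongr π (Equiv.refl Bool)) M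

/-- The classical basis state `|s⟩⟨s|`. -/
def basisOp {n : ℕ} (s : BString n) : QOp n :=
  Matrix.of fun x y => if x = s ∧ y = s then 1 else 0

/-- The (trivial) state of an empty register. -/
def unitOp : QOp 0 := Matrix.of fun _ _ => 1

/-- The maximally mixed state on `n` qubits. -/
def maxMixed (n : ℕ) : QOp n :=
  Matrix.of fun x y => if x = y then ((2 ^ n : ℂ))⁻¹ else 0

/-- Appending a fresh ancilla qubit in state `|0⟩`. -/
def addAncilla {n : ℕ} (M : QOp n) : QOp (n + 1) :=
  tensorOp M (basisOp (bzero 1))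

/-- Tracing out the last qubit of a register. -/
def traceLast {n : ℕ} (M : QOp (n + 1)) : QOp n :=
  Matrix.of fun x y => ∑ u : BString 1,
    Matrix.reindex (bsplit n 1) (bsplit n 1) M (x, u) (y, u)

/-- The channel that measures its (classical) input register and prepares `f s`. -/
def clChannel {a b : ℕ} (f : BString a → QOp b) (M : QOp a) : QOp b :=
  ∑ s : BString a, M s s • f s

/-- The channel that measures its first register, obtaining a classical string `s`, and
applies the channel `f s` to the rest. -/
def clControlled {a b c : ℕ} (f : BString a → QOp b → QOp c) (M : QOp (a + b)) : QOp c :=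
  ∑ s : BString a,
    f s (Matrix.of fun x y => Matrix.reindex (bsplit a b) (bsplit a b) M (s, x) (s, y))

/-- The (subnormalized) state of the second register after the first register is
measured with outcome `s`. -/
def clSlice {a c : ℕ} (M : QOp (a + c)) (s : BString a) : QOp c :=
  Matrix.of fun x y => Matrix.reindex (bsplit a c) (bsplit a c) M (s, x) (s, y)

/-- The classical state corresponding to a probability distribution on key pairs. -/
def pmfOp {a b : ℕ} (p : PMF (BString a × BString b)) : QOp (a + b) :=
  Matrix.of fun x y => if x = y then ((p (bsplit a b x)).toReal : ℂ) else 0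

/-- `t`-fold tensor power of a state. -/
def itTensor {n : ℕ} : (t : ℕ) → QOp n → QOp (t * n)
  | 0, _ => castOp (zero_mul n).symm unitOp
  | (t + 1), ρ => castOp (by ring) (tensorOp ρ (itTensor t ρ))

/-- Tensor product of a family of `t` maps. -/
def itTensorMap {a b : ℕ} : (t : ℕ) → (Fin t → (QOp a → QOp b)) → QOp (t * a) → QOp (t * b)
  | 0, _ => fun M => castOp (by simp) M
  | (t + 1), Φ => fun M =>
      castOp (by ring)
        (tensorMap (Φ 0) (itTensorMap t (fun i => Φ i.succ)) (castOp (by ring) M))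

/-- The probability of observing outcome `s` when measuring all wires of `ρ`
in the computational basis. -/
def diagProb {n : ℕ} (ρ : QOp n) (s : BString n) : ℝ := (ρ s s).re

/-- The pure state `|v⟩⟨v|`. -/
def vecState {n : ℕ} (v : BString n → ℂ) : QOp n :=
  Matrix.of fun x y => v x * star (v y)

/-- Conjugation by a matrix (the channel of a unitary). -/
def conjOp {n : ℕ} (V : Matrix (BString n) (BString n) ℂ) (ρ : QOp n) : QOp n :=
  V * ρ * Vᴴ

/-- Positive maps. -/
def IsPosMap {a b : ℕ} (Φ : QOp a → QOp b) : Prop :=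
  ∀ ρ, ρ.PosSemidef → (Φ ρ).PosSemidef

/-- Quantum channels: linear, completely positive, trace-preserving maps. -/
structure IsChannel {a b : ℕ} (Φ : QOp a → QOp b) : Prop where
  linear : IsLinearMap ℂ Φ
  cp : ∀ m, IsPosMap (extendR Φ m)
  tp : ∀ ρ, (Φ ρ).trace = ρ.trace

/-- Density matrices. -/
def IsDensity {n : ℕ} (ρ : QOp n) : Prop := ρ.PosSemidef ∧ ρ.trace = 1

/-- `Gates Φ k`: `Φ` is implemented by a quantum circuit with at most `k` elementary
operations (arbitrary two-qubit channels, wire permutations, `|0⟩`-ancilla creation,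
and discarding of wires). -/
inductive Gates : ∀ {a b : ℕ}, (QOp a → QOp b) → ℕ → Prop
  | id (a : ℕ) : Gates (id : QOp a → QOp a) 0
  | comp {a b c : ℕ} {Φ : QOp a → QOp b} {Ψ : QOp b → QOp c} {k l : ℕ} :
      Gates Φ k → Gates Ψ l → Gates (Ψ ∘ Φ) (k + l)
  | perm {n : ℕ} (π : Equiv.Perm (Fin n)) : Gates (permOp π) 1
  | gate {m : ℕ} (Φ : QOp 2 → QOp 2) : IsChannel Φ → Gates (extendR Φ m) 1
  | ancilla (n : ℕ) : Gates (addAncilla (n := n)) 1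
  | discard (n : ℕ) : Gates (traceLast (n := n)) 1

/-- A family of maps indexed by the security parameter is (non-uniform) quantum
polynomial time if it is implemented by circuits of polynomially many gates. -/
def PolyGates (a b : ℕ → ℕ) (Φ : ∀ l, QOp (a l) → QOp (b l)) : Prop :=
  ∃ p : Polynomial ℕ, ∀ l, ∃ k ≤ p.eval l, Gates (Φ l) k

/-- Oracle circuits: `OGates oi oo F k` means that the functional `F`, mapping an
oracle channel (from `oi` wires to `oo` wires) to a map, is implemented by a circuit
with at most `k` elementary operations and oracle calls. -/
inductive OGates (oi oo : ℕ) : ∀ {a b : ℕ}, ((QOp oi → QOp oo) → QOp a → QOp b) → ℕ → Prop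
  | plain {a b : ℕ} {Φ : QOp a → QOp b} {k : ℕ} :
      Gates Φ k → OGates oi oo (fun _ => Φ) k
  | call (m : ℕ) : OGates oi oo (fun O => extendR O m) 1
  | comp {a b c : ℕ} {F : (QOp oi → QOp oo) → QOp a → QOp b}
      {G : (QOp oi → QOp oo) → QOp b → QOp c} {k l : ℕ} :
      OGates oi oo F k → OGates oi oo G l → OGates oi oo (fun O => (G O) ∘ (F O)) (k + l)

/-- Polynomial-time oracle algorithms. -/
def PolyOGates (oi oo a b : ℕ → ℕ)
    (F : ∀ l, (QOp (oi l) → QOp (oo l)) → QOp (a l) → QOp (b l)) : Prop :=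
  ∃ p : Polynomial ℕ, ∀ l, ∃ k ≤ p.eval l, OGates (oi l) (oo l) (F l) k

/-- Negligible functions. -/
def Negligible (f : ℕ → ℝ) : Prop :=
  ∀ c : ℕ, ∃ N, ∀ n ≥ N, |f n| ≤ 1 / (n : ℝ) ^ c

end

noncomputable section

/-- Tracing out the second of two consecutive registers. -/
def ptraceR {a b : ℕ} (M : QOp (a + b)) : QOp a :=
  Matrix.of fun x y => ∑ u : BString b,
    Matrix.reindex (bsplit a b) (bsplit a b) M (x, u) (y, u)

end

/- ================================================================
   Haar random unitaries and pseudorandom unitaries (PRUs).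
   ================================================================ -/

noncomputable section

instance matrixMeasurableSpace {n : ℕ} :
    MeasurableSpace (Matrix (BString n) (BString n) ℂ) := borel _

/-- The unitary group on an `n`-qubit register. -/
abbrev UnitaryOn (n : ℕ) := Matrix.unitaryGroup (BString n) ℂ

/-- A Haar (i.e. left-invariant) probability measure on the unitary group. -/
structure IsHaarUnitary {n : ℕ} (μ : MeasureTheory.Measure (UnitaryOn n)) : Prop where
  prob : MeasureTheory.IsProbabilityMeasure μ
  invariant : ∀ V : UnitaryOn n, MeasureTheory.MeasurePreserving (fun U => V * U) μ μ

/-- A pseudorandom unitary family: keyed efficient unitaries on `ℓ(λ)` qubits that no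
polynomial-time oracle algorithm can distinguish from Haar random unitaries. -/
structure PRU where
  ℓ : ℕ → ℕ
  U : ∀ l, BString l → Matrix (BString (ℓ l)) (BString (ℓ l)) ℂ
  unitary : ∀ l k, U l k ∈ Matrix.unitaryGroup (BString (ℓ l)) ℂ
  eff : ∃ p : Polynomial ℕ, ∀ l, ∃ k ≤ p.eval l,
    Gates (clControlled (fun key => conjOp (U l key))) k
  secure : ∀ A : ∀ l, (QOp (ℓ l) → QOp (ℓ l)) → QOp 0 → QOp 1,
    PolyOGates ℓ ℓ (fun _ => 0) (fun _ => 1) A →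
    ∀ μ : ∀ l, MeasureTheory.Measure (UnitaryOn (ℓ l)), (∀ l, IsHaarUnitary (μ l)) →
    ∃ ε, Negligible ε ∧ ∀ l,
      |(∫ V, diagProb (A l (conjOp (V : Matrix _ _ ℂ)) unitOp) (fun _ => true) ∂(μ l)) -
        ((2 : ℝ) ^ l)⁻¹ *
          ∑ k : BString l, diagProb (A l (conjOp (U l k)) unitOp) (fun _ => true)| ≤ ε l

/-- Computational indistinguishability of two families of states. -/
def CompIndist (d : ℕ → ℕ) (ρ σ : ∀ l, QOp (d l)) : Prop :=
  ∀ A : ∀ l, QOp (d l) → QOp 1, PolyGates d (fun _ => 1) A →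
    ∃ ε, Negligible ε ∧ ∀ l,
      |diagProb (A l (ρ l)) (fun _ => true) - diagProb (A l (σ l)) (fun _ => true)| ≤ ε l

end


section
set_option linter.unusedSectionVars false
open scoped ComplexOrder Matrix
/-! ### Local operators on labelled wires -/
namespace PS
noncomputable section

open Classical in
/-- Splitting bit strings along an injection of wires. -/
def sp {ι W : Type} (f : ι ↪ W) :
    (W → Bool) ≃ (ι → Bool) × ({w : W // w ∉ Set.range f} → Bool) where
  toFun x := (fun i => x (f i), fun w => x w.1)
  invFun p := fun w => if h : w ∈ Set.range f then p.1 h.choose else p.2 ⟨w, h⟩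
  left_inv x := by
    funext w
    by_cases h : w ∈ Set.range f
    · simp only [h, dif_pos]
      exact congrArg x h.choose_spec
    · simp [h]
  right_inv p := by
    ext i
    · have h : f i ∈ Set.range f := ⟨i, rfl⟩
      simp only [h, dif_pos]
      exact congrArg p.1 (f.injective h.choose_spec)
    · simp only [i.2, dif_neg, not_false_eq_true]

/-- Matrices on bit strings over a wire set `W`. -/
abbrev Mx (W : Type) := Matrix (W → Bool) (W → Bool) ℂ

section
variable {ι W : Type} [Fintype ι] [DecidableEq ι] [Fintype W] [DecidableEq W]

open Classical in
/-- The operator `U` acting on the wires in the range of `f`. -/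
def emb (f : ι ↪ W) (U : Mx ι) : Mx W :=
  Matrix.of fun x y => if (∀ w, w ∉ Set.range f → x w = y w) then
    U (fun i => x (f i)) (fun i => y (f i)) else 0

open Classical in
theorem emb_eq (f : ι ↪ W) (U : Mx ι) :
    emb f U = (Matrix.kroneckerMap (· * ·) U
      (1 : Matrix ({w : W // w ∉ Set.range f} → Bool) _ ℂ)).submatrix (sp f) (sp f) := by
  ext x y
  simp only [emb, Matrix.of_apply, Matrix.submatrix_apply, Matrix.kroneckerMap_apply, sp,
    Equiv.coe_fn_mk, Matrix.one_apply, funext_iff, Subtype.forall, mul_ite, mul_one, mul_zero]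

theorem emb_mul (f : ι ↪ W) (U V : Mx ι) : emb f (U * V) = emb f U * emb f V := by
  classical
  rw [emb_eq, emb_eq, emb_eq, Matrix.submatrix_mul_equiv, ← Matrix.mul_kronecker_mul, one_mul]

theorem emb_one (f : ι ↪ W) : emb f (1 : Mx ι) = 1 := by
  classical
  rw [emb_eq, Matrix.kroneckerMap_one_one _ (by simp) (by simp) (by simp),
    Matrix.submatrix_one_equiv]

theorem emb_conjTranspose (f : ι ↪ W) (U : Mx ι) : emb f Uᴴ = (emb f U)ᴴ := by
  ext x y
  simp only [emb, Matrix.of_apply, Matrix.conjTranspose_apply]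
  simp only [eq_comm]
  split_ifs <;> simp

theorem emb_inj (f : ι ↪ W) {U V : Mx ι} (h : emb f U = emb f V) : U = V := by
  ext u v
  have := congrFun (congrFun h ((sp f).symm (u, fun _ => false))) ((sp f).symm (v, fun _ => false))
  have h1 : ∀ u : ι → Bool, (fun i => (sp f).symm (u, fun _ => false) (f i)) = u := fun u =>
    congrArg Prod.fst ((sp f).apply_symm_apply (u, fun _ => false))
  have h2 : ∀ (u : ι → Bool) w, w ∉ Set.range f → (sp f).symm (u, fun _ => false) w = false :=
    fun u w hw => congrFun (congrArg Prod.snd ((sp f).apply_symm_apply (u, fun _ => false))) ⟨w, hw⟩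
  simp only [emb, Matrix.of_apply] at this
  rw [if_pos (fun w hw => by rw [h2 u w hw, h2 v w hw]),
    if_pos (fun w hw => by rw [h2 u w hw, h2 v w hw]), h1, h1] at this
  exact this

theorem emb_unitary (f : ι ↪ W) {U : Mx ι} :
    emb f U ∈ Matrix.unitaryGroup (W → Bool) ℂ ↔ U ∈ Matrix.unitaryGroup (ι → Bool) ℂ := by
  rw [Matrix.mem_unitaryGroup_iff, Matrix.mem_unitaryGroup_iff, Matrix.star_eq_conjTranspose,
    Matrix.star_eq_conjTranspose, ← emb_conjTranspose, ← emb_mul]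
  constructor
  · intro h
    exact emb_inj f (h.trans (emb_one f).symm)
  · intro h
    rw [h, emb_one]

theorem emb_emb {κ : Type} [Fintype κ] [DecidableEq κ] (g : κ ↪ ι) (f : ι ↪ W) (U : Mx κ) :
    emb f (emb g U) = emb (g.trans f) U := by
  ext x y
  simp only [emb, Matrix.of_apply, Function.Embedding.trans_apply]
  by_cases h1 : ∀ w, w ∉ Set.range f → x w = y w
  · by_cases h2 : ∀ i, i ∉ Set.range g → x (f i) = y (f i)
    · rw [if_pos h1, if_pos h2, if_pos]
      intro w hw
      by_cases hf : w ∈ Set.range f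
      · obtain ⟨i, rfl⟩ := hf
        apply h2
        rintro ⟨k, rfl⟩
        exact hw ⟨k, rfl⟩
      · exact h1 w hf
    · rw [if_pos h1, if_neg h2, if_neg]
      intro h
      apply h2
      intro i hi
      apply h
      rintro ⟨k, hk⟩
      exact hi ⟨k, f.injective hk⟩
  · rw [if_neg h1, if_neg]
    intro h
    apply h1
    intro w hw
    apply h
    rintro ⟨k, rfl⟩
    exact hw ⟨g k, rfl⟩

/-- Unitary circuits made of two-wire unitaries. -/
inductive UC : Mx W → ℕ → Prop
  | one : UC 1 0
  | mul {A B : Mx W} {a b : ℕ} : UC A a → UC B b → UC (A * B) (a + b)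
  | gate (f : Fin 2 ↪ W) (U : Mx (Fin 2)) : U ∈ Matrix.unitaryGroup (Fin 2 → Bool) ℂ →
      UC (emb f U) 1
  | mono {A : Mx W} {a b : ℕ} : UC A a → a ≤ b → UC A b

theorem UC.unitary {V : Mx W} {c : ℕ} (h : UC V c) : V ∈ Matrix.unitaryGroup (W → Bool) ℂ := by
  induction h with
  | one => exact one_mem _
  | mul _ _ h1 h2 => exact mul_mem h1 h2
  | gate f U hU => exact (emb_unitary f).2 hU
  | mono _ _ h => exact h

theorem UC.emb {V : Mx ι} {c : ℕ} (h : UC V c) (f : ι ↪ W) : UC (PS.emb f V) c := by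
  induction h with
  | one => rw [emb_one]; exact UC.one
  | mul _ _ h1 h2 => rw [emb_mul]; exact UC.mul h1 h2
  | gate g U hU => rw [emb_emb]; exact UC.gate _ _ hU
  | mono _ h h1 => exact UC.mono h1 h

theorem UC.inv {V : Mx W} {c : ℕ} (h : UC V c) : UC Vᴴ c := by
  induction h with
  | one => rw [Matrix.conjTranspose_one]; exact UC.one
  | mul _ _ h1 h2 => rw [Matrix.conjTranspose_mul, add_comm]; exact UC.mul h2 h1
  | gate g U hU => rw [← emb_conjTranspose]; exact UC.gate _ _ (Unitary.star_mem hU)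
  | mono _ h h1 => exact UC.mono h1 h

/-- `V` acts only on the wires in `S`. -/
structure IsLocal (S : Finset W) (V : Mx W) : Prop where
  off : ∀ x y, V x y ≠ 0 → ∀ w, w ∉ S → x w = y w
  dep : ∀ x y x' y', (∀ w, w ∈ S → x w = x' w) → (∀ w, w ∈ S → y w = y' w) →
    (∀ w, w ∉ S → x w = y w) → (∀ w, w ∉ S → x' w = y' w) → V x y = V x' y'

theorem IsLocal.exists_emb {S : Finset W} {V : Mx W} (h : IsLocal S V) (f : ι ↪ W)
    (hf : ∀ w, w ∈ Set.range f ↔ w ∈ S) : ∃ U : Mx ι, V = PS.emb f U := by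
  refine ⟨Matrix.of fun u v => V ((sp f).symm (u, fun _ => false)) ((sp f).symm (v, fun _ => false)), ?_⟩
  have h1 : ∀ (u : ι → Bool) i, (sp f).symm (u, fun _ => false) (f i) = u i := fun u i =>
    congrFun (congrArg Prod.fst ((sp f).apply_symm_apply (u, fun _ => false))) i
  have h2 : ∀ (u : ι → Bool) w, w ∉ Set.range f → (sp f).symm (u, fun _ => false) w = false :=
    fun u w hw => congrFun (congrArg Prod.snd ((sp f).apply_symm_apply (u, fun _ => false))) ⟨w, hw⟩
  ext x y
  simp only [PS.emb, Matrix.of_apply]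
  split_ifs with hxy
  · apply h.dep
    · intro w hw
      obtain ⟨i, rfl⟩ := (hf w).2 hw
      rw [h1]
    · intro w hw
      obtain ⟨i, rfl⟩ := (hf w).2 hw
      rw [h1]
    · intro w hw
      exact hxy w (fun h => hw ((hf w).1 h))
    · intro w hw
      rw [h2 _ w (fun h => hw ((hf w).1 h)), h2 _ w (fun h => hw ((hf w).1 h))]
  · by_contra hne
    exact hxy (fun w hw => h.off x y hne w (fun h => hw ((hf w).2 h)))

theorem IsLocal.UC_two {S : Finset W} {V : Mx W} (h : IsLocal S V) (hS : S.card = 2)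
    (hV : V ∈ Matrix.unitaryGroup (W → Bool) ℂ) : UC V 1 := by
  let e : Fin 2 ≃ S := (finCongr hS.symm).trans S.equivFin.symm
  let f : Fin 2 ↪ W := e.toEmbedding.trans (Function.Embedding.subtype _)
  obtain ⟨U, rfl⟩ := h.exists_emb f (by
    intro w
    constructor
    · rintro ⟨i, rfl⟩
      exact (e i).2
    · intro hw
      exact ⟨e.symm ⟨w, hw⟩, by simp [f]⟩)
  exact UC.gate _ _ ((emb_unitary f).1 hV)

/-! Permutation matrices and diagonal matrices -/

/-- The permutation matrix sending `e_y` to `e_{g y}`. -/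
def pm (g : Equiv.Perm (W → Bool)) : Mx W := Matrix.of fun x y => if x = g y then 1 else 0

theorem pm_mulVec (g : Equiv.Perm (W → Bool)) (v : (W → Bool) → ℂ) (x : W → Bool) :
    (pm g *ᵥ v) x = v (g.symm x) := by
  simp only [Matrix.mulVec, dotProduct, pm, Matrix.of_apply, ite_mul, one_mul, zero_mul]
  rw [Finset.sum_eq_single (g.symm x)]
  · simp
  · intro y _ hy
    rw [if_neg]
    rintro rfl
    simp at hy
  · simp

theorem pm_mul_apply (g : Equiv.Perm (W → Bool)) (M : Mx W) (x y : W → Bool) :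
    (pm g * M) x y = M (g.symm x) y := pm_mulVec g (fun z => M z y) x

theorem pm_conjTranspose (g : Equiv.Perm (W → Bool)) : (pm g)ᴴ = pm g.symm := by
  ext x y
  simp only [pm, Matrix.conjTranspose_apply, Matrix.of_apply]
  by_cases h : y = g x
  · subst h; simp
  · rw [if_neg h, if_neg]
    · simp
    · rintro rfl; simp at h

theorem pm_mul (g h : Equiv.Perm (W → Bool)) : pm g * pm h = pm (g * h) := by
  ext x y
  rw [pm_mul_apply]
  change (if g.symm x = h y then (1 : ℂ) else 0) = if x = g (h y) then 1 else 0
  by_cases e : x = g (h y)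
  · rw [if_pos e, if_pos (by rw [e, Equiv.symm_apply_apply])]
  · rw [if_neg e, if_neg (fun h' => e (by rw [← h', Equiv.apply_symm_apply]))]

theorem pm_one : pm (1 : Equiv.Perm (W → Bool)) = 1 := by
  ext x y
  change (if x = y then (1 : ℂ) else 0) = _
  rw [Matrix.one_apply]

theorem pm_unitary (g : Equiv.Perm (W → Bool)) : pm g ∈ Matrix.unitaryGroup (W → Bool) ℂ := by
  rw [Matrix.mem_unitaryGroup_iff, Matrix.star_eq_conjTranspose, pm_conjTranspose, pm_mul]
  rw [show g * g.symm = 1 from mul_inv_cancel g, pm_one]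

theorem pm_local {S : Finset W} {g : Equiv.Perm (W → Bool)}
    (h1 : ∀ x w, w ∉ S → g x w = x w)
    (h2 : ∀ x y, (∀ w, w ∈ S → x w = y w) → ∀ w, w ∈ S → g x w = g y w) : IsLocal S (pm g) where
  off x y h w hw := by
    simp only [pm, Matrix.of_apply, ne_eq, ite_eq_right_iff, one_ne_zero, imp_false, not_not] at h
    rw [h, h1 _ _ hw]
  dep x y x' y' hx hy h h' := by
    simp only [pm, Matrix.of_apply]
    congr 1
    apply propext
    constructor
    · rintro rfl
      funext w
      by_cases hw : w ∈ S
      · rw [← hx w hw, h2 y y' hy w hw]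
      · rw [h' w hw, h1 _ _ hw]
    · rintro rfl
      funext w
      by_cases hw : w ∈ S
      · rw [hx w hw, h2 y y' hy w hw]
      · rw [h w hw, h1 _ _ hw]

theorem diag_unitary {α : Type} [Fintype α] [DecidableEq α] {d : α → ℂ} (hd : ∀ x, ‖d x‖ = 1) :
    Matrix.diagonal d ∈ Matrix.unitaryGroup α ℂ := by
  rw [Matrix.mem_unitaryGroup_iff, Matrix.star_eq_conjTranspose, Matrix.diagonal_conjTranspose,
    Matrix.diagonal_mul_diagonal, ← Matrix.diagonal_one]
  congr 1
  funext x
  rw [Pi.star_apply, Complex.star_def, Complex.mul_conj, Complex.normSq_eq_norm_sq, hd]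
  simp

theorem diag_local {S : Finset W} {d : (W → Bool) → ℂ}
    (h : ∀ x y, (∀ w, w ∈ S → x w = y w) → d x = d y) : IsLocal S (Matrix.diagonal d) where
  off x y hxy w hw := by
    by_contra hne
    exact hxy (Matrix.diagonal_apply_ne _ (fun e => hne (congrFun e w)))
  dep x y x' y' hx hy h1 h2 := by
    have : x = y ↔ x' = y' := by
      constructor
      · rintro rfl
        funext w
        by_cases hw : w ∈ S
        · rw [← hx w hw, ← hy w hw]
        · exact h2 w hw
      · rintro rfl
        funext w
        by_cases hw : w ∈ S
        · rw [hx w hw, hy w hw]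
        · exact h1 w hw
    by_cases e : x = y
    · have e' := this.1 e
      subst e; subst e'
      rw [Matrix.diagonal_apply_eq, Matrix.diagonal_apply_eq]
      exact h _ _ hx
    · rw [Matrix.diagonal_apply_ne _ e, Matrix.diagonal_apply_ne _ (fun h => e (this.2 h))]

theorem UC_diag_prod {α : Type} (s : Finset α) (d : α → (W → Bool) → ℂ) (c : ℕ)
    (h : ∀ a ∈ s, UC (Matrix.diagonal (d a)) c) :
    UC (Matrix.diagonal (fun x => ∏ a ∈ s, d a x)) (s.card * c) := by
  classical
  induction s using Finset.induction_on with
  | empty => simpa using (UC.one : UC (1 : Mx W) 0)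
  | insert a s ha ih =>
    have h1 := UC.mul (h a (Finset.mem_insert_self _ _))
      (ih (fun b hb => h b (Finset.mem_insert_of_mem hb)))
    rw [Matrix.diagonal_mul_diagonal] at h1
    simp only [Finset.prod_insert ha, Finset.card_insert_of_notMem ha]
    exact UC.mono h1 (by rw [add_mul, one_mul, add_comm])

end
end
end PS
end

section
set_option linter.unusedSectionVars false
open scoped ComplexOrder Matrix
/-! ### Universality of two-wire gates on a constant number of wires -/
namespace PS
noncomputable section
variable {ι : Type} [Fintype ι] [DecidableEq ι]

/-- CNOT on bit strings. -/
def cnotE (i j : ι) (h : i ≠ j) : Equiv.Perm (ι → Bool) where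
  toFun x := Function.update x j (xor (x j) (x i))
  invFun x := Function.update x j (xor (x j) (x i))
  left_inv x := by
    funext w
    by_cases hw : w = j
    · subst hw; simp [h]
    · simp [hw]
  right_inv x := by
    funext w
    by_cases hw : w = j
    · subst hw; simp [h]
    · simp [hw]

theorem cnot_UC (i j : ι) (h : i ≠ j) : UC (pm (cnotE i j h)) 1 := by
  apply IsLocal.UC_two (S := {i, j}) _ (Finset.card_pair h) (pm_unitary _)
  apply pm_local
  · intro x w hw
    have : w ≠ j := by rintro rfl; simp at hw
    simp [cnotE, this]
  · intro x y hxy w hw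
    have h1 := hxy i (by simp)
    have h2 := hxy j (by simp)
    by_cases hwj : w = j
    · subst hwj; simp [cnotE, h1, h2]
    · simp [cnotE, hwj, hxy w hw]

/-- sign of a bit -/
def sgn (b : Bool) : ℝ := if b then -1 else 1

theorem sgn_xor (a b : Bool) : sgn (xor a b) = sgn a * sgn b := by
  cases a <;> cases b <;> simp [sgn]

/-- Parity characters. -/
def chi (T : Finset ι) (x : ι → Bool) : ℝ := ∏ i ∈ T, sgn (x i)

/-- Fourier inversion on the cube. -/
theorem fourier (θ : (ι → Bool) → ℝ) :
    ∃ α : Finset ι → ℝ, ∀ x, θ x = ∑ T : Finset ι, α T * chi T x := by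
  refine ⟨fun T => ((2 : ℝ) ^ Fintype.card ι)⁻¹ * ∑ p, θ p * chi T p, fun x => ?_⟩
  have key : ∀ p : ι → Bool, ∑ T : Finset ι, chi T p * chi T x
      = if p = x then (2 : ℝ) ^ Fintype.card ι else 0 := by
    intro p
    have h1 : ∏ i : ι, (1 + sgn (p i) * sgn (x i)) = ∑ T : Finset ι, chi T p * chi T x := by
      rw [Finset.prod_one_add]
      rw [Finset.powerset_univ]
      exact Finset.sum_congr rfl (fun T _ => by rw [chi, chi, ← Finset.prod_mul_distrib])
    rw [← h1]
    split_ifs with h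
    · subst h
      have : ∀ i, 1 + sgn (p i) * sgn (p i) = 2 := by
        intro i; cases p i <;> simp [sgn] <;> norm_num
      simp [this]
    · obtain ⟨i, hi⟩ := Function.ne_iff.1 h
      apply Finset.prod_eq_zero (Finset.mem_univ i)
      revert hi
      cases p i <;> cases x i <;> simp [sgn]
  calc θ x = ((2 : ℝ) ^ Fintype.card ι)⁻¹ * ∑ p, θ p * (if p = x then (2 : ℝ) ^ Fintype.card ι else 0) := by
        simp only [mul_ite, mul_zero, Finset.sum_ite_eq', Finset.mem_univ, if_true]
        field_simp
    _ = ((2 : ℝ) ^ Fintype.card ι)⁻¹ * ∑ p, ∑ T : Finset ι, θ p * chi T p * chi T x := by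
        congr 1
        refine Finset.sum_congr rfl (fun p _ => ?_)
        rw [← key p, Finset.mul_sum]
        exact Finset.sum_congr rfl (fun T _ => by ring)
    _ = _ := by
        rw [Finset.sum_comm, Finset.mul_sum]
        refine Finset.sum_congr rfl (fun T _ => ?_)
        rw [← Finset.sum_mul, mul_assoc]

theorem exists_pair (h2 : 2 ≤ Fintype.card ι) (j : ι) : ∃ i, i ≠ j := by
  have : Nontrivial ι := Fintype.one_lt_card_iff_nontrivial.1 h2
  exact exists_ne j

theorem norm_expI (r : ℝ) : ‖Complex.exp (r * Complex.I)‖ = 1 := Complex.norm_exp_ofReal_mul_I r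

theorem parity_UC (h2 : 2 ≤ Fintype.card ι) (α : ℝ) (T : Finset ι) :
    UC (Matrix.diagonal (fun x : ι → Bool => Complex.exp (((α * chi T x : ℝ) : ℂ) * Complex.I)))
      (2 * T.card + 1) := by
  induction T using Finset.induction_on with
  | empty =>
    have : Nontrivial ι := Fintype.one_lt_card_iff_nontrivial.1 h2
    obtain ⟨i, j, hij⟩ := exists_pair_ne ι
    apply UC.mono (IsLocal.UC_two (S := {i, j}) _ (Finset.card_pair hij)
      (diag_unitary (fun x => norm_expI _))) (by simp)
    apply diag_local
    intro x y _
    simp [chi]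
  | insert i T hi ih =>
    rcases T.eq_empty_or_nonempty with rfl | ⟨j, hj⟩
    · obtain ⟨j, hij⟩ := exists_pair h2 i
      apply UC.mono (IsLocal.UC_two (S := {j, i}) _ (Finset.card_pair hij)
        (diag_unitary (fun x => norm_expI _))) (by simp)
      apply diag_local
      intro x y h
      simp [chi, h i (by simp)]
    · have hij : i ≠ j := fun h => hi (h ▸ hj)
      have h1 := UC.mul (UC.mul (cnot_UC i j hij) ih) (cnot_UC i j hij)
      refine UC.mono (?_ : UC _ (1 + (2 * T.card + 1) + 1)) (by rw [Finset.card_insert_of_notMem hi]; omega)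
      convert h1 using 1
      ext x y
      rw [mul_assoc, pm_mul_apply, Matrix.diagonal_mul]
      have hs : (cnotE i j hij).symm x = cnotE i j hij x := rfl
      rw [hs]
      have hc : chi (insert i T) x = chi T (cnotE i j hij x) := by
        rw [chi, chi, Finset.prod_insert hi, ← Finset.mul_prod_erase T _ hj,
          ← Finset.mul_prod_erase T _ hj]
        have e1 : (cnotE i j hij x) j = xor (x j) (x i) := by simp [cnotE]
        have e2 : ∏ k ∈ T.erase j, sgn (cnotE i j hij x k) = ∏ k ∈ T.erase j, sgn (x k) := by
          refine Finset.prod_congr rfl (fun k hk => ?_)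
          have : k ≠ j := (Finset.mem_erase.1 hk).1
          simp [cnotE, this]
        rw [e1, e2, sgn_xor]
        ring
      by_cases hxy : x = y
      · subst hxy
        have : pm (cnotE i j hij) (cnotE i j hij x) x = 1 := by simp [pm]
        rw [this, mul_one, Matrix.diagonal_apply_eq, hc]
      · have : pm (cnotE i j hij) (cnotE i j hij x) y = 0 := by simp [pm, hxy]
        rw [this, mul_zero, Matrix.diagonal_apply_ne _ hxy]

/-- Cost of a diagonal gate. -/
def dcost (c : ℕ) : ℕ := 2 ^ c * (2 * c + 1)

theorem diag_UC (h2 : 2 ≤ Fintype.card ι) {d : (ι → Bool) → ℂ} (hd : ∀ x, ‖d x‖ = 1) :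
    UC (Matrix.diagonal d) (dcost (Fintype.card ι)) := by
  obtain ⟨α, hα⟩ := fourier (fun x => Complex.arg (d x))
  have h := UC_diag_prod (Finset.univ : Finset (Finset ι))
    (fun T x => Complex.exp (((α T * chi T x : ℝ) : ℂ) * Complex.I)) (2 * Fintype.card ι + 1)
    (fun T _ => UC.mono (parity_UC h2 (α T) T) (by have := T.card_le_univ; omega))
  rw [Finset.card_univ, Fintype.card_finset] at h
  unfold dcost
  convert h using 2
  funext x
  rw [← Complex.exp_sum, ← Finset.sum_mul, ← Complex.ofReal_sum, ← hα x]
  have := Complex.norm_mul_exp_arg_mul_I (d x)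
  rw [hd] at this
  simpa using this.symm

/-- A one-wire operator. -/
def oneQ (j : ι) (F : Matrix Bool Bool ℂ) : Mx ι :=
  Matrix.of fun x y => if y = Function.update x j (y j) then F (x j) (y j) else 0

theorem oneQ_mulVec (j : ι) (F : Matrix Bool Bool ℂ) (v : (ι → Bool) → ℂ) (x : ι → Bool) :
    (oneQ j F *ᵥ v) x = F (x j) false * v (Function.update x j false)
      + F (x j) true * v (Function.update x j true) := by
  have hne : Function.update x j false ≠ Function.update x j true := fun h => by
    simpa using congrFun h j
  rw [Matrix.mulVec, dotProduct,
    ← Finset.sum_subset (Finset.subset_univ {Function.update x j false, Function.update x j true}),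
    Finset.sum_pair hne]
  · simp [oneQ]
  · intro y _ hy
    simp only [Finset.mem_insert, Finset.mem_singleton, not_or] at hy
    simp only [oneQ, Matrix.of_apply]
    rw [if_neg, zero_mul]
    intro h
    cases hb : y j
    · rw [hb] at h; exact hy.1 h
    · rw [hb] at h; exact hy.2 h

theorem oneQ_mul (j : ι) (F G : Matrix Bool Bool ℂ) : oneQ j F * oneQ j G = oneQ j (F * G) := by
  ext x y
  have := oneQ_mulVec j F (fun z => oneQ j G z y) x
  change (oneQ j F * oneQ j G) x y = _ at this
  rw [this]
  simp only [oneQ, Matrix.of_apply, Function.update_idem, Function.update_self]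
  split_ifs with h
  · simp [Matrix.mul_apply]; ring
  · simp

theorem oneQ_one (j : ι) : oneQ j 1 = (1 : Mx ι) := by
  ext x y
  by_cases h : x = y
  · subst h; simp [oneQ]
  · rw [Matrix.one_apply_ne h]
    simp only [oneQ, Matrix.of_apply]
    split_ifs with h1
    · rw [Matrix.one_apply_ne]
      intro h2
      apply h
      rw [h1, ← h2]; simp
    · rfl

theorem oneQ_conjTranspose (j : ι) (F : Matrix Bool Bool ℂ) : (oneQ j F)ᴴ = oneQ j Fᴴ := by
  ext x y
  simp only [oneQ, Matrix.of_apply, Matrix.conjTranspose_apply]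
  have : (x = Function.update y j (x j)) ↔ (y = Function.update x j (y j)) := by
    constructor <;> intro h <;> rw [h] <;> simp
  simp only [this]
  split_ifs <;> simp

theorem oneQ_UC (h2 : 2 ≤ Fintype.card ι) (j : ι) {F : Matrix Bool Bool ℂ}
    (hF : F ∈ Matrix.unitaryGroup Bool ℂ) : UC (oneQ j F) 1 := by
  obtain ⟨i, hij⟩ := exists_pair h2 j
  apply IsLocal.UC_two (S := {i, j}) _ (Finset.card_pair hij)
  · rw [Matrix.mem_unitaryGroup_iff, Matrix.star_eq_conjTranspose] at *
    rw [oneQ_conjTranspose, oneQ_mul, hF, oneQ_one]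
  · have key : ∀ x y : ι → Bool, (∀ w, w ∉ ({i, j} : Finset ι) → x w = y w) →
      ((y = Function.update x j (y j)) ↔ x i = y i) := by
      intro x y h
      constructor
      · intro e; rw [e]; simp [hij]
      · intro e
        funext w
        by_cases hw : w = j
        · subst hw; simp
        · by_cases hwi : w = i
          · subst hwi; simp [hw, e]
          · simp [hw, h w (by simp [hw, hwi])]
    constructor
    · intro x y h w hw
      simp only [oneQ, Matrix.of_apply, ne_eq, ite_eq_right_iff, Classical.not_imp] at h
      have : w ≠ j := by rintro rfl; simp at hw
      rw [h.1]; simp [this]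
    · intro x y x' y' hx hy h h'
      simp only [oneQ, Matrix.of_apply, key x y h, key x' y' h']
      rw [hx i (by simp), hy i (by simp), hx j (by simp), hy j (by simp)]

/-- The matrix of eigenvectors of the plane rotations. -/
def rotF : Matrix Bool Bool ℂ := Matrix.of fun a b =>
  ((Real.sqrt 2 : ℝ) : ℂ)⁻¹ * (if a then (if b then -Complex.I else Complex.I) else 1)

theorem sqrt2_sq : (((Real.sqrt 2 : ℝ) : ℂ)⁻¹) * (((Real.sqrt 2 : ℝ) : ℂ)⁻¹) = 1 / 2 := by
  rw [← mul_inv, ← Complex.ofReal_mul, Real.mul_self_sqrt (by norm_num)]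
  norm_num

theorem rotF_unitary : rotF ∈ Matrix.unitaryGroup Bool ℂ := by
  rw [Matrix.mem_unitaryGroup_iff, Matrix.star_eq_conjTranspose]
  have h := sqrt2_sq
  ext a b
  simp only [Matrix.mul_apply, Fintype.sum_bool, Matrix.conjTranspose_apply, rotF, Matrix.of_apply,
    star_mul', star_inv₀, Complex.star_def, Complex.conj_ofReal]
  have h2 := Complex.I_mul_I
  generalize ((Real.sqrt 2 : ℝ) : ℂ)⁻¹ = s at h
  cases a <;> cases b <;> simp <;>
    first
    | linear_combination (2 : ℂ) * h
    | linear_combination (2 : ℂ) * h - (2 : ℂ) * s * s * h2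


theorem e0_def : (Pi.single (fun _ => false) 1 : (ι → Bool) → ℂ)
    = fun x => if x = (fun _ => false) then 1 else 0 := by
  funext x
  simp [Pi.single_apply]

end
end PS
end

section
set_option linter.unusedSectionVars false
open scoped ComplexOrder Matrix
namespace PS
noncomputable section
variable {ι : Type} [Fintype ι] [DecidableEq ι]

theorem unitary_norm {α : Type} [Fintype α] [DecidableEq α] {U : Matrix α α ℂ}
    (hU : U ∈ Matrix.unitaryGroup α ℂ) (v : α → ℂ) :
    ∑ x, ‖(U *ᵥ v) x‖ ^ 2 = ∑ x, ‖v x‖ ^ 2 := by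
  have h : ∀ w : α → ℂ, ((∑ x, ‖w x‖ ^ 2 : ℝ) : ℂ) = star w ⬝ᵥ w := by
    intro w
    rw [dotProduct, Complex.ofReal_sum]
    refine Finset.sum_congr rfl (fun x _ => ?_)
    rw [Pi.star_apply, Complex.star_def, mul_comm, Complex.mul_conj, Complex.normSq_eq_norm_sq]
  apply Complex.ofReal_injective
  rw [h, h, Matrix.star_mulVec, ← Matrix.dotProduct_mulVec, Matrix.mulVec_mulVec]
  rw [Matrix.mem_unitaryGroup_iff', Matrix.star_eq_conjTranspose] at hU
  rw [hU, Matrix.one_mulVec]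

/-- The basis vector of the all-zero string. -/
def e0 : (ι → Bool) → ℂ := Pi.single (fun _ => false) 1

/-- Phase removing function. -/
def unphase (z : ℂ) : ℂ := if z = 0 then 1 else star z / (‖z‖ : ℂ)

theorem norm_unphase (z : ℂ) : ‖unphase z‖ = 1 := by
  unfold unphase
  split_ifs with h
  · simp
  · rw [norm_div, norm_star, Complex.norm_real, norm_norm, div_self (norm_ne_zero_iff.2 h)]

theorem unphase_mul (z : ℂ) : unphase z * z = (‖z‖ : ℂ) := by
  unfold unphase
  split_ifs with h
  · simp [h]
  · have hz : ((‖z‖ : ℝ) : ℂ) ≠ 0 := Complex.ofReal_ne_zero.2 (norm_ne_zero_iff.2 h)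
    rw [div_mul_eq_mul_div, div_eq_iff hz, Complex.star_def, Complex.conj_mul']
    ring

/-- Cost of one disentangling step. -/
def pcost (c : ℕ) : ℕ := 2 * dcost c + 2

theorem prep_step (h2 : 2 ≤ Fintype.card ι) (j : ι) (v : (ι → Bool) → ℂ) :
    ∃ P, UC P (pcost (Fintype.card ι)) ∧ ∀ x, (P *ᵥ v) x = if x j then 0 else
      ((‖((‖v (Function.update x j false)‖ : ℂ) + (‖v (Function.update x j true)‖ : ℂ) * Complex.I)‖ : ℝ) : ℂ) := by
  let z : (ι → Bool) → ℂ := fun x =>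
    (‖v (Function.update x j false)‖ : ℂ) + (‖v (Function.update x j true)‖ : ℂ) * Complex.I
  let d : (ι → Bool) → ℂ := fun x =>
    Complex.exp (((if x j then -Complex.arg (z x) else Complex.arg (z x) : ℝ) : ℂ) * Complex.I)
  refine ⟨oneQ j rotF * (Matrix.diagonal d * (oneQ j rotFᴴ * Matrix.diagonal (fun x => unphase (v x)))),
    UC.mono (UC.mul (oneQ_UC h2 j rotF_unitary) (UC.mul (diag_UC h2 (fun x => norm_expI _))
      (UC.mul (oneQ_UC h2 j (Unitary.star_mem rotF_unitary)) (diag_UC h2 (fun x => norm_unphase _)))))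
      (by unfold pcost; omega), fun x => ?_⟩
  have hz : ∀ x, (‖z x‖ : ℂ) * Complex.exp (Complex.arg (z x) * Complex.I) = z x :=
    fun x => Complex.norm_mul_exp_arg_mul_I (z x)
  have hzc : ∀ x, (‖z x‖ : ℂ) * Complex.exp (-(Complex.arg (z x)) * Complex.I) =
      (‖v (Function.update x j false)‖ : ℂ) - (‖v (Function.update x j true)‖ : ℂ) * Complex.I := by
    intro x
    have := congrArg (starRingEnd ℂ) (hz x)
    rw [map_mul, Complex.conj_ofReal, ← Complex.exp_conj, map_mul, Complex.conj_ofReal,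
      Complex.conj_I] at this
    rw [neg_mul, ← mul_neg, this]
    simp only [z, map_add, map_mul, Complex.conj_ofReal, Complex.conj_I]
    ring
  have hE : ∀ x, Complex.exp (Complex.arg (z x) * Complex.I) *
      Complex.exp (-(Complex.arg (z x)) * Complex.I) = 1 := by
    intro x
    rw [← Complex.exp_add]; simp
  rw [← Matrix.mulVec_mulVec, ← Matrix.mulVec_mulVec, ← Matrix.mulVec_mulVec]
  have hA : ∀ x, (Matrix.diagonal (fun x => unphase (v x)) *ᵥ v) x = (‖v x‖ : ℂ) := by
    intro x
    rw [Matrix.mulVec_diagonal, unphase_mul]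
  have hB : ∀ x, (Matrix.diagonal d *ᵥ (oneQ j rotFᴴ *ᵥ
      (Matrix.diagonal (fun x => unphase (v x)) *ᵥ v))) x =
      ((Real.sqrt 2 : ℝ) : ℂ)⁻¹ * (‖z x‖ : ℂ) := by
    intro x
    rw [Matrix.mulVec_diagonal, oneQ_mulVec, hA, hA]
    simp only [d, Matrix.conjTranspose_apply, rotF, Matrix.of_apply, star_mul', star_inv₀,
      Complex.star_def, Complex.conj_ofReal]
    cases hx : x j
    · simp
      linear_combination (-((Real.sqrt 2 : ℝ) : ℂ)⁻¹ * Complex.exp (Complex.arg (z x) * Complex.I)) * hzc x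
        + ((Real.sqrt 2 : ℝ) : ℂ)⁻¹ * (‖z x‖ : ℂ) * hE x
    · simp
      have h3 := hz x
      have h4 := hE x
      rw [neg_mul] at h4
      linear_combination (-((Real.sqrt 2 : ℝ) : ℂ)⁻¹ * Complex.exp (-(Complex.arg (z x) * Complex.I))) * h3
        + ((Real.sqrt 2 : ℝ) : ℂ)⁻¹ * (‖z x‖ : ℂ) * h4
  rw [oneQ_mulVec, hB, hB]
  have hzu : ∀ b, z (Function.update x j b) = z x := by intro b; simp [z]
  rw [hzu, hzu]
  have hs := sqrt2_sq
  change _ = if x j = true then (0 : ℂ) else (‖z x‖ : ℂ)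
  simp only [rotF, Matrix.of_apply]
  cases hx : x j
  · simp
    linear_combination (2 * (‖z x‖ : ℂ)) * hs
  · simp

theorem prep_aux (h2 : 2 ≤ Fintype.card ι) (S : Finset ι) : ∀ v : (ι → Bool) → ℂ,
    (∀ x, v x ≠ 0 → ∀ w, w ∉ S → x w = false) → ∑ x, ‖v x‖ ^ 2 = 1 →
    ∃ P, UC P (S.card * pcost (Fintype.card ι) + dcost (Fintype.card ι)) ∧ P *ᵥ v = e0 := by
  induction S using Finset.induction_on with
  | empty =>
    intro v hv h1
    have hv0 : ∀ x, x ≠ (fun _ => false) → v x = 0 := by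
      intro x hx
      by_contra hne
      exact hx (funext fun w => hv x hne w (by simp))
    have hn : ‖v (fun _ => false)‖ = 1 := by
      rw [Finset.sum_eq_single (fun _ => false)] at h1
      · have := norm_nonneg (v fun _ => false)
        nlinarith
      · intro b _ hb
        rw [hv0 b hb]; simp
      · simp
    refine ⟨Matrix.diagonal (fun x => unphase (v x)), UC.mono (diag_UC h2 (fun x => norm_unphase _))
      (by omega), ?_⟩
    funext x
    rw [Matrix.mulVec_diagonal, unphase_mul]
    by_cases hx : x = fun _ => false
    · subst hx; rw [hn]; simp [e0]
    · rw [hv0 x hx]; simp [e0, hx]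
  | insert j S hj ih =>
    intro v hv h1
    obtain ⟨P, hP, hPv⟩ := prep_step h2 j v
    obtain ⟨Q, hQ, hQv⟩ := ih (P *ᵥ v) (by
      intro x hx w hw
      rw [hPv] at hx
      cases hxj : x j with
      | true => simp [hxj] at hx
      | false =>
      by_cases hwj : w = j
      · rw [hwj, hxj]
      have hw' : w ∉ insert j S := by simp [hwj, hw]
      have : v (Function.update x j false) ≠ 0 ∨ v (Function.update x j true) ≠ 0 := by
        by_contra hcon
        push Not at hcon
        apply hx
        simp [hcon.1, hcon.2]
      rcases this with h | h
      · have := hv _ h w hw'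
        simpa [hwj] using this
      · have := hv _ h w hw'
        simpa [hwj] using this) (by rw [unitary_norm hP.unitary, h1])
    refine ⟨Q * P, UC.mono (UC.mul hQ hP) ?_, by rw [← Matrix.mulVec_mulVec, hQv]⟩
    rw [Finset.card_insert_of_notMem hj]
    ring_nf; omega

/-- Cost of preparing an arbitrary state. -/
def prepcost (c : ℕ) : ℕ := c * pcost c + dcost c

theorem prep (h2 : 2 ≤ Fintype.card ι) (v : (ι → Bool) → ℂ) (hv : ∑ x, ‖v x‖ ^ 2 = 1) :
    ∃ P, UC P (prepcost (Fintype.card ι)) ∧ P *ᵥ v = e0 :=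
  prep_aux h2 Finset.univ v (fun _ _ w hw => absurd (Finset.mem_univ w) hw) hv

/-- Cost of a reflection. -/
def rcost (c : ℕ) : ℕ := 2 * prepcost c + dcost c

theorem reflect_UC (h2 : 2 ≤ Fintype.card ι) (u : (ι → Bool) → ℂ) (hu : ∑ x, ‖u x‖ ^ 2 = 1)
    (ω : ℂ) (hω : ‖ω‖ = 1) :
    UC ((1 : Mx ι) - Matrix.of fun x y => (1 - ω) * (u x * star (u y))) (rcost (Fintype.card ι)) := by
  obtain ⟨P, hP, hPu⟩ := prep h2 u hu
  have hPU := hP.unitary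
  rw [Matrix.mem_unitaryGroup_iff', Matrix.star_eq_conjTranspose] at hPU
  have hu' : u = Pᴴ *ᵥ e0 := by
    rw [← hPu, Matrix.mulVec_mulVec, hPU, Matrix.one_mulVec]
  have hux : ∀ x, u x = star (P (fun _ => false) x) := by
    intro x
    conv_lhs => rw [hu']
    simp [e0]
  have h := UC.mul hP.inv (UC.mul (diag_UC h2 (d := fun x => if x = (fun _ => false) then ω else 1)
    (by intro x; split_ifs <;> simp [hω])) hP)
  refine UC.mono (a := prepcost (Fintype.card ι) + (dcost (Fintype.card ι) + prepcost (Fintype.card ι)))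
    ?_ (by unfold rcost; omega)
  convert h using 1
  have hd : (Matrix.diagonal (fun x : ι → Bool => if x = (fun _ => false) then ω else 1))
      = 1 - Matrix.diagonal (fun x : ι → Bool => if x = (fun _ => false) then (1 - ω) else 0) := by
    rw [← Matrix.diagonal_one, Matrix.diagonal_sub]
    congr 1
    funext x
    split_ifs <;> simp
  rw [hd, sub_mul, one_mul, mul_sub, hPU]
  congr 1
  ext x y
  rw [Matrix.mul_apply, Finset.sum_eq_single (fun _ => false)]
  · rw [Matrix.diagonal_mul, Matrix.conjTranspose_apply, if_pos rfl, Matrix.of_apply, hux, hux, star_star]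
    ring
  · intro b _ hb
    rw [Matrix.diagonal_mul, if_neg hb]; simp
  · simp

end
end PS
end

section
set_option linter.unusedSectionVars false
open scoped ComplexOrder Matrix
namespace PS
noncomputable section
variable {ι : Type} [Fintype ι] [DecidableEq ι]

theorem householder (h2 : 2 ≤ Fintype.card ι) (a : (ι → Bool) → ℂ) (ha : ∑ y, ‖a y‖ ^ 2 = 1)
    (x : ι → Bool) (hne : a ≠ Pi.single x 1) :
    ∃ R, UC R (rcost (Fintype.card ι)) ∧ R *ᵥ a = Pi.single x 1 ∧
      ∀ y, y ≠ x → a y = 0 → R *ᵥ (Pi.single y 1) = Pi.single y 1 := by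
  let b : (ι → Bool) → ℂ := Pi.single x 1
  have hsplit : ∀ f : (ι → Bool) → ℝ, ∑ y, f y = f x + ∑ y ∈ Finset.univ.erase x, f y := fun f =>
    (Finset.add_sum_erase _ _ (Finset.mem_univ x)).symm
  have hb : ∀ y ∈ Finset.univ.erase x, b y = 0 := by
    intro y hy
    simp [b, (Finset.mem_erase.1 hy).1]
  have hbx : b x = 1 := by simp [b]
  let N : ℝ := ∑ y, ‖a y - b y‖ ^ 2
  have hN : N = 2 - 2 * (a x).re := by
    have h1 : N = ‖a x - 1‖ ^ 2 + ∑ y ∈ Finset.univ.erase x, ‖a y‖ ^ 2 := by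
      simp only [N]
      rw [hsplit, hbx]
      congr 1
      exact Finset.sum_congr rfl (fun y hy => by rw [hb y hy, sub_zero])
    have h3 := hsplit (fun y => ‖a y‖ ^ 2)
    rw [ha] at h3
    rw [h1, ← Complex.normSq_eq_norm_sq, Complex.normSq_apply]
    have h4 : ‖a x‖ ^ 2 = (a x).re * (a x).re + (a x).im * (a x).im := by
      rw [← Complex.normSq_eq_norm_sq, Complex.normSq_apply]
    simp only [Complex.sub_re, Complex.sub_im, Complex.one_re, Complex.one_im]
    nlinarith
  have hax : 1 - a x ≠ 0 := by
    intro h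
    apply hne
    have hx1 : a x = 1 := (sub_eq_zero.1 h).symm
    have hN0 : N = 0 := by rw [hN, hx1]; simp
    funext y
    have := (Finset.sum_eq_zero_iff_of_nonneg (fun y _ => by positivity)).1 hN0 y (Finset.mem_univ y)
    have h5 : a y - b y = 0 := by simpa using this
    exact sub_eq_zero.1 h5
  have hNpos : N ≠ 0 := by
    intro h0
    apply hne
    funext y
    have := (Finset.sum_eq_zero_iff_of_nonneg (fun y _ => by positivity)).1 h0 y (Finset.mem_univ y)
    have h5 : a y - b y = 0 := by simpa using this
    exact sub_eq_zero.1 h5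
  have hN0 : 0 ≤ N := Finset.sum_nonneg (fun y _ => by positivity)
  let s : ℝ := Real.sqrt N
  have hs : s * s = N := Real.mul_self_sqrt hN0
  have hs0 : s ≠ 0 := by intro h; rw [h] at hs; simp at hs; exact hNpos hs.symm
  have hsC : (s : ℂ) ≠ 0 := Complex.ofReal_ne_zero.2 hs0
  let ω : ℂ := 1 - N / (1 - a x)
  have hNc : (N : ℂ) = (1 - a x) + star (1 - a x) := by
    rw [hN]
    apply Complex.ext <;> simp
    ring
  have hω : ‖ω‖ = 1 := by
    have : ω = - (star (1 - a x) / (1 - a x)) := by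
      simp only [ω]
      rw [hNc]
      field_simp
      ring
    rw [this, norm_neg, norm_div, norm_star, div_self (norm_ne_zero_iff.2 hax)]
  let u : (ι → Bool) → ℂ := fun y => (a y - b y) / s
  have hu : ∑ y, ‖u y‖ ^ 2 = 1 := by
    simp only [u, norm_div, div_pow, Complex.norm_real]
    rw [← Finset.sum_div]
    change N / _ = 1
    rw [Real.norm_eq_abs, sq_abs, pow_two, hs, div_self hNpos]
  refine ⟨_, reflect_UC h2 u hu ω hω, ?_, ?_⟩
  · have hin : ∑ y, star (u y) * a y = (1 - a x) / s := by
      have e1 : ∀ y, star (u y) * a y = (((‖a y‖ ^ 2 : ℝ) : ℂ) - star (b y) * a y) / s := by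
        intro y
        simp only [u, star_div₀, star_sub, Complex.star_def, Complex.conj_ofReal]
        rw [Complex.ofReal_pow, ← Complex.conj_mul']
        ring
      simp only [e1]
      rw [← Finset.sum_div, Finset.sum_sub_distrib, ← Complex.ofReal_sum, ha]
      congr 2
      rw [Finset.sum_eq_single x]
      · simp [hbx]
      · intro y _ hy; rw [hb y (by simp [hy])]; simp
      · simp
    rw [Matrix.sub_mulVec, Matrix.one_mulVec]
    funext y
    have e2 : ((Matrix.of fun x y => (1 - ω) * (u x * star (u y))) *ᵥ a) y
        = (1 - ω) * u y * ∑ y, star (u y) * a y := by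
      simp only [Matrix.mulVec, dotProduct, Matrix.of_apply]
      rw [Finset.mul_sum]
      exact Finset.sum_congr rfl (fun z _ => by ring)
    rw [Pi.sub_apply, e2, hin]
    change _ = b y
    simp only [u, ω]
    have hsN : (s : ℂ) * s = N := by rw [← Complex.ofReal_mul, hs]
    have : (1 - (1 - (N : ℂ) / (1 - a x))) * ((a y - b y) / s) * ((1 - a x) / s) = a y - b y := by
      rw [← hsN]
      field_simp
      ring
    rw [this]; ring
  · intro y hy hay
    rw [Matrix.sub_mulVec, Matrix.one_mulVec]
    have : u y = 0 := by simp [u, hay, b, hy]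
    funext z
    simp [this]

/-- Cost of an arbitrary unitary. -/
def ucost (c : ℕ) : ℕ := 2 ^ c * rcost c

theorem univ_aux (h2 : 2 ≤ Fintype.card ι) (n : ℕ) : ∀ U : Mx ι,
    U ∈ Matrix.unitaryGroup (ι → Bool) ℂ →
    (Finset.univ.filter (fun x => U *ᵥ (Pi.single x 1) ≠ Pi.single x 1)).card ≤ n →
    UC U (n * rcost (Fintype.card ι)) := by
  induction n with
  | zero =>
    intro U hU h
    have h0 := Finset.card_eq_zero.1 (Nat.le_zero.1 h)
    have : U = 1 := by
      ext x y
      have hy : U *ᵥ (Pi.single y 1) = Pi.single y 1 := by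
        by_contra hne
        have : y ∈ Finset.univ.filter (fun x => U *ᵥ (Pi.single x 1) ≠ Pi.single x 1) := by
          simp only [Finset.mem_filter, Finset.mem_univ, true_and]; exact hne
        rw [h0] at this
        simp at this
      have := congrFun hy x
      rw [Matrix.mulVec_single_one] at this
      rw [Matrix.one_apply, ← Pi.single_apply]
      exact this
    rw [this]
    exact UC.mono UC.one (Nat.zero_le _)
  | succ n ih =>
    intro U hU h
    by_cases hall : ∀ x, U *ᵥ (Pi.single x 1) = Pi.single x 1
    · apply UC.mono (ih U hU (by simp [hall]))
      exact Nat.mul_le_mul_right _ (Nat.le_succ n)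
    · push Not at hall
      obtain ⟨x, hx⟩ := hall
      obtain ⟨R, hR, hRa, hRy⟩ := householder h2 (U *ᵥ Pi.single x 1) (by
        rw [unitary_norm hU, Finset.sum_eq_single x]
        · simp
        · intro b _ hb; simp [hb]
        · simp) x hx
      have hfix : ∀ y, U *ᵥ (Pi.single y 1) = Pi.single y 1 → y ≠ x →
          (R * U) *ᵥ (Pi.single y 1) = Pi.single y 1 := by
        intro y hy hyx
        rw [← Matrix.mulVec_mulVec, hy]
        apply hRy y hyx
        have h1 : Uᴴ *ᵥ (Pi.single y 1) = Pi.single y 1 := by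
          have hU' := hU
          rw [Matrix.mem_unitaryGroup_iff', Matrix.star_eq_conjTranspose] at hU'
          conv_lhs => rw [← hy]
          rw [Matrix.mulVec_mulVec, hU', Matrix.one_mulVec]
        have h3 := congrFun h1 x
        rw [Matrix.mulVec_single_one] at h3
        rw [Matrix.mulVec_single_one]
        have h4 : star (U y x) = 0 := by
          have : (Pi.single y (1 : ℂ) : (ι → Bool) → ℂ) x = 0 := Pi.single_eq_of_ne (Ne.symm hyx) _
          rw [this] at h3
          exact h3
        exact star_eq_zero.1 h4
      have hc := ih (R * U) (mul_mem hR.unitary hU) (by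
        have hss : Finset.univ.filter (fun y => (R * U) *ᵥ (Pi.single y 1) ≠ Pi.single y 1) ⊂
            Finset.univ.filter (fun y => U *ᵥ (Pi.single y 1) ≠ Pi.single y 1) := by
          rw [Finset.ssubset_iff_of_subset]
          · refine ⟨x, by simpa using hx, ?_⟩
            simp only [Finset.mem_filter, Finset.mem_univ, true_and, not_not]
            rw [← Matrix.mulVec_mulVec, hRa]
          · intro y hy
            simp only [Finset.mem_filter, Finset.mem_univ, true_and] at hy ⊢
            intro hU1
            by_cases hyx : y = x
            · subst hyx; exact hx hU1
            · exact hy (hfix y hU1 hyx)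
        have := Finset.card_lt_card hss
        omega)
      have h1 := UC.mul hR.inv hc
      have hRU := hR.unitary
      rw [Matrix.mem_unitaryGroup_iff', Matrix.star_eq_conjTranspose] at hRU
      rw [← mul_assoc, hRU, one_mul] at h1
      exact UC.mono h1 (by rw [add_mul, one_mul, add_comm])

theorem univ_UC (h2 : 2 ≤ Fintype.card ι) {U : Mx ι} (hU : U ∈ Matrix.unitaryGroup (ι → Bool) ℂ) :
    UC U (ucost (Fintype.card ι)) := by
  apply univ_aux h2 _ U hU
  refine (Finset.card_le_univ _).trans ?_
  simp

theorem ucost_mono {a b : ℕ} (h : a ≤ b) : ucost a ≤ ucost b := by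
  have h1 : 2 ^ a ≤ 2 ^ b := Nat.pow_le_pow_right (by norm_num) h
  have hd : dcost a ≤ dcost b := by unfold dcost; gcongr
  have hp : pcost a ≤ pcost b := by unfold pcost; omega
  have hpp : prepcost a ≤ prepcost b := by unfold prepcost; gcongr
  have hr : rcost a ≤ rcost b := by unfold rcost; omega
  unfold ucost
  gcongr

/-- The uniform cost of all local operations used below. -/
def KC : ℕ := ucost 6

theorem IsLocal.UC {S : Finset ι} {V : Mx ι} (h : IsLocal S V) (h2 : 2 ≤ S.card)
    (h6 : S.card ≤ 6) (hV : V ∈ Matrix.unitaryGroup (ι → Bool) ℂ) : UC V KC := by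
  let f : S ↪ ι := Function.Embedding.subtype _
  obtain ⟨U, rfl⟩ := h.exists_emb f (by
    intro w
    constructor
    · rintro ⟨i, rfl⟩
      exact i.2
    · intro hw
      exact ⟨⟨w, hw⟩, rfl⟩)
  have := (univ_UC (by simpa using h2) ((emb_unitary f).1 hV)).emb f
  exact UC.mono this (ucost_mono (by simpa using h6))

end
end PS
end

section
set_option linter.unusedSectionVars false
open scoped ComplexOrder Matrix
/-! ### Kraus form and Stinespring dilation -/
namespace PS
noncomputable section

theorem bsplit_bappend {a b : ℕ} (s : BString a) (t : BString b) :
    bsplit a b (bappend s t) = (s, t) := (bsplit a b).apply_symm_apply _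

theorem bappend_bsplit {a b : ℕ} (x : BString (a + b)) :
    bappend (bsplit a b x).1 (bsplit a b x).2 = x := (bsplit a b).symm_apply_apply _

theorem bappend_castAdd {a b : ℕ} (s : BString a) (t : BString b) (i : Fin a) :
    bappend s t (Fin.castAdd b i) = s i := by
  simp [bappend, bsplit, Equiv.sumArrowEquivProdArrow]

theorem bappend_natAdd {a b : ℕ} (s : BString a) (t : BString b) (i : Fin b) :
    bappend s t (Fin.natAdd a i) = t i := by
  simp [bappend, bsplit, Equiv.sumArrowEquivProdArrow]

theorem bsplit_fst {a b : ℕ} (x : BString (a + b)) (i : Fin a) :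
    (bsplit a b x).1 i = x (Fin.castAdd b i) := by
  conv_rhs => rw [← bappend_bsplit x, bappend_castAdd]

theorem bsplit_snd {a b : ℕ} (x : BString (a + b)) (i : Fin b) :
    (bsplit a b x).2 i = x (Fin.natAdd a i) := by
  conv_rhs => rw [← bappend_bsplit x, bappend_natAdd]

theorem extendR_apply {a b : ℕ} (Φ : QOp a → QOp b) (m : ℕ) (M : QOp (a + m))
    (x y : BString b) (u v : BString m) :
    extendR Φ m M (bappend x u) (bappend y v) =
      Φ (Matrix.of fun p q => M (bappend p u) (bappend q v)) x y := by
  simp only [extendR, Matrix.reindex_apply, Matrix.submatrix_apply, Equiv.symm_symm,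
    bsplit_bappend, Matrix.of_apply]
  rfl

theorem tensorOp_apply {a b : ℕ} (M : QOp a) (N : QOp b)
    (x y : BString a) (u v : BString b) :
    tensorOp M N (bappend x u) (bappend y v) = M x y * N u v := by
  simp only [tensorOp, Matrix.reindex_apply, Matrix.submatrix_apply, Equiv.symm_symm,
    bsplit_bappend, Matrix.of_apply]

theorem vecState_psd {n : ℕ} (v : BString n → ℂ) : (vecState v).PosSemidef := by
  have := Matrix.posSemidef_vecMulVec_self_star v
  exact this

theorem exists_sq {α : Type} [Fintype α] [DecidableEq α] {M : Matrix α α ℂ} (h : M.PosSemidef) :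
    ∃ B : Matrix α α ℂ, M = Bᴴ * B := by
  open scoped MatrixOrder in
  obtain ⟨B, hB⟩ := (CStarAlgebra.nonneg_iff_eq_star_mul_self).1 h.nonneg
  exact ⟨B, hB⟩

/-- Kraus operators for a two-qubit channel. -/
theorem kraus_two {a b : ℕ} {Φ : QOp a → QOp b} (h : IsChannel Φ) :
    ∃ K : BString (b + a) → Matrix (BString b) (BString a) ℂ,
      (∀ ρ i j, Φ ρ i j = ∑ u, ∑ p, ∑ q, K u i p * ρ p q * star (K u j q)) ∧
      (∀ p q, ∑ i, ∑ u, K u i p * star (K u i q) = if p = q then 1 else 0) := by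
  let v : BString (a + a) → ℂ := fun x => if (bsplit a a x).1 = (bsplit a a x).2 then 1 else 0
  have hC := h.cp a _ (vecState_psd v)
  have hE : ∀ i p j q, extendR Φ a (vecState v) (bappend i p) (bappend j q) =
      Φ (Matrix.single p q 1) i j := by
    intro i p j q
    rw [extendR_apply]
    congr 1
    congr 1
    ext x y
    simp only [Matrix.of_apply, vecState, v, bsplit_bappend, Matrix.single_apply]
    by_cases h1 : x = p <;> by_cases h2 : y = q <;> simp [h1, h2, eq_comm]
    · intro h; exact absurd h.symm h2
    · intro h; exact absurd h.symm h1
    · intro h; exact absurd h.symm h1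
  obtain ⟨B, hB⟩ := exists_sq hC
  have hE' : ∀ i p j q, Φ (Matrix.single p q 1) i j =
      ∑ u, star (B u (bappend i p)) * B u (bappend j q) := by
    intro i p j q
    rw [← hE, hB, Matrix.mul_apply]
    rfl
  refine ⟨fun u i p => star (B u (bappend i p)), ?_, ?_⟩
  · intro ρ i j
    have h1 : ρ = ∑ p, ∑ q, ρ p q • Matrix.single p q (1 : ℂ) := by
      conv_lhs => rw [Matrix.matrix_eq_sum_single ρ]
      simp [Matrix.smul_single]
    let L : QOp a →ₗ[ℂ] QOp b := h.linear.mk' Φ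
    have h2 : Φ ρ = ∑ p, ∑ q, ρ p q • Φ (Matrix.single p q (1 : ℂ)) := by
      conv_lhs => rw [h1]
      change L _ = ∑ p, ∑ q, ρ p q • L _
      simp only [map_sum, map_smul]
    rw [h2]
    simp only [Matrix.sum_apply, Matrix.smul_apply, hE', smul_eq_mul, Finset.mul_sum, star_star]
    rw [Finset.sum_comm' (t' := Finset.univ) (s' := fun _ => Finset.univ) (by simp)]
    conv_rhs => rw [Finset.sum_comm]
    rw [Finset.sum_comm]
    refine Finset.sum_congr rfl fun p _ => ?_
    rw [Finset.sum_comm]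
    refine Finset.sum_congr rfl fun u _ => Finset.sum_congr rfl fun q _ => ?_
    ring
  · intro p q
    have := h.tp (Matrix.single p q 1)
    rw [Matrix.trace] at this
    simp only [Matrix.diag_apply, hE'] at this
    simp only [star_star]
    rw [this]
    by_cases hpq : p = q
    · subst hpq; simp
    · rw [Matrix.trace_single_eq_of_ne _ _ _ hpq, if_neg hpq]

/-- Stinespring dilation of a two-qubit channel. -/
theorem stinespring {Φ : QOp 2 → QOp 2} (h : IsChannel Φ) :
    ∃ U : Mx (Fin 2 ⊕ Fin 4), U ∈ Matrix.unitaryGroup _ ℂ ∧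
      ∀ ρ i j, Φ ρ i j = ∑ u : Fin 4 → Bool, ∑ p, ∑ q, U (Sum.elim i u) (Sum.elim p fun _ => false) * ρ p q *
        star (U (Sum.elim j u) (Sum.elim q fun _ => false)) := by
  obtain ⟨K, hK, hK2⟩ := kraus_two h
  let α := (Fin 2 ⊕ Fin 4) → Bool
  let v : α → EuclideanSpace ℂ α := fun y => WithLp.toLp 2 fun x => K (x ∘ Sum.inr) (x ∘ Sum.inl) (y ∘ Sum.inl)
  let s : Set α := {y | y ∘ Sum.inr = fun _ => false}
  have hv : Orthonormal ℂ (s.domRestrict v) := by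
    rw [orthonormal_iff_ite]
    rintro ⟨y, hy⟩ ⟨z, hz⟩
    simp only [Set.domRestrict_apply, v, EuclideanSpace.inner_eq_star_dotProduct, dotProduct]
    have h1 := hK2 (z ∘ Sum.inl) (y ∘ Sum.inl)
    have h2 : (z ∘ Sum.inl = y ∘ Sum.inl) ↔ (⟨y, hy⟩ : s) = ⟨z, hz⟩ := by
      rw [Subtype.mk.injEq]
      constructor
      · intro h
        funext i
        rcases i with i | i
        · exact (congrFun h i).symm
        · exact (congrFun hy i).trans (congrFun hz i).symm
      · rintro rfl; rfl
    rw [← (Equiv.sumArrowEquivProdArrow (Fin 2) (Fin 4) Bool).symm.sum_comp, Fintype.sum_prod_type]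
    simp only [h2] at h1
    refine Eq.trans ?_ h1
    rfl
  obtain ⟨b, hb⟩ := hv.exists_orthonormalBasis_extension_of_card_eq (by simp [α]) (v := v)
  refine ⟨Matrix.of fun x y => b y x, ?_, ?_⟩
  · rw [Matrix.mem_unitaryGroup_iff']
    ext x y
    have := orthonormal_iff_ite.1 b.orthonormal x y
    rw [EuclideanSpace.inner_eq_star_dotProduct] at this
    rw [Matrix.one_apply, ← this, Matrix.mul_apply]
    simp only [dotProduct]
    refine Finset.sum_congr rfl fun z _ => mul_comm _ _
  · intro ρ i j
    rw [hK]
    have : ∀ i u p, b (Sum.elim p fun _ => false) (Sum.elim i u) = K u i p := by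
      intro i u p
      rw [hb _ (by simp [s])]
      simp [v]
    simp only [Matrix.of_apply, this]

/-- Maps with a Kraus decomposition. -/
def Kr {a b : ℕ} (Φ : QOp a → QOp b) : Prop :=
  ∃ (ι : Type) (_ : Fintype ι) (K : ι → Matrix (BString b) (BString a) ℂ),
    (∀ ρ, Φ ρ = ∑ i, K i * ρ * (K i)ᴴ) ∧ ∑ i, (K i)ᴴ * K i = 1

theorem Kr.comp {a b c : ℕ} {Φ : QOp a → QOp b} {Ψ : QOp b → QOp c} (h1 : Kr Φ) (h2 : Kr Ψ) :
    Kr (Ψ ∘ Φ) := by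
  obtain ⟨ι, _, K, hK, hK1⟩ := h1
  obtain ⟨κ, _, L, hL, hL1⟩ := h2
  refine ⟨κ × ι, inferInstance, fun p => L p.1 * K p.2, ?_, ?_⟩
  · intro ρ
    rw [Function.comp_apply, hL, hK, Fintype.sum_prod_type]
    refine Finset.sum_congr rfl fun i _ => ?_
    rw [Matrix.mul_sum, Matrix.sum_mul]
    refine Finset.sum_congr rfl fun j _ => ?_
    rw [Matrix.conjTranspose_mul]
    simp only [Matrix.mul_assoc]
  · rw [Fintype.sum_prod_type, Finset.sum_comm, ← hK1]
    refine Finset.sum_congr rfl fun j _ => ?_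
    simp only [Matrix.conjTranspose_mul]
    calc ∑ x, (K j)ᴴ * (L x)ᴴ * (L x * K j) = (K j)ᴴ * (∑ x, (L x)ᴴ * L x) * K j := by
          rw [Matrix.mul_sum, Matrix.sum_mul]
          simp only [Matrix.mul_assoc]
      _ = _ := by rw [hL1, Matrix.mul_one]

theorem Kr.linear {a b : ℕ} {Φ : QOp a → QOp b} (h : Kr Φ) : IsLinearMap ℂ Φ := by
  obtain ⟨ι, _, K, hK, hK1⟩ := h
  constructor
  · intro x y
    simp only [hK, Matrix.mul_add, Matrix.add_mul, Finset.sum_add_distrib]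
  · intro c x
    simp only [hK, Matrix.mul_smul, Matrix.smul_mul, Finset.smul_sum]

theorem Kr.pos {a b : ℕ} {Φ : QOp a → QOp b} (h : Kr Φ) : IsPosMap Φ := by
  obtain ⟨ι, _, K, hK, hK1⟩ := h
  intro ρ hρ
  rw [hK]
  exact Matrix.posSemidef_sum _ fun i _ => hρ.mul_mul_conjTranspose_same (K i)

theorem Kr.tp {a b : ℕ} {Φ : QOp a → QOp b} (h : Kr Φ) (ρ : QOp a) : (Φ ρ).trace = ρ.trace := by
  obtain ⟨ι, _, K, hK, hK1⟩ := h
  rw [hK, Matrix.trace_sum]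
  have : ∀ i, (K i * ρ * (K i)ᴴ).trace = ((K i)ᴴ * K i * ρ).trace := fun i => by
    rw [Matrix.trace_mul_comm, Matrix.mul_assoc]
  simp only [this]
  rw [← Matrix.trace_sum, ← Matrix.sum_mul, hK1, Matrix.one_mul]

theorem sum_bappend {a b : ℕ} {M : Type} [AddCommMonoid M] (f : BString (a + b) → M) :
    ∑ x, f x = ∑ s : BString a, ∑ t : BString b, f (bappend s t) := by
  rw [← (bsplit a b).symm.sum_comp, Fintype.sum_prod_type]
  rfl

theorem bappend_inj {a b : ℕ} {s s' : BString a} {t t' : BString b} :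
    bappend s t = bappend s' t' ↔ s = s' ∧ t = t' := by
  rw [bappend, bappend, (bsplit a b).symm.injective.eq_iff, Prod.mk.injEq]

theorem exists_bappend {a b : ℕ} (x : BString (a + b)) : ∃ s t, x = bappend (a := a) (b := b) s t :=
  ⟨_, _, (bappend_bsplit x).symm⟩

theorem Kr.extendR {a b : ℕ} {Φ : QOp a → QOp b} (h : Kr Φ) (m : ℕ) : Kr (extendR Φ m) := by
  obtain ⟨ι, _, K, hK, hK1⟩ := h
  let L : ι → Matrix (BString (b + m)) (BString (a + m)) ℂ := fun i => Matrix.of fun x y =>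
    K i (bsplit b m x).1 (bsplit a m y).1 * if (bsplit b m x).2 = (bsplit a m y).2 then 1 else 0
  have hL : ∀ i x u y v, L i (bappend x u) (bappend y v) = K i x y * if u = v then 1 else 0 := by
    intro i x u y v
    simp only [L, Matrix.of_apply, bsplit_bappend]
  have hL' : ∀ i x u y v, star (L i (bappend x u) (bappend y v)) =
      star (K i x y) * if u = v then 1 else 0 := by
    intro i x u y v
    rw [hL, star_mul']
    split_ifs <;> simp
  refine ⟨ι, inferInstance, L, ?_, ?_⟩
  · intro ρ
    ext X Y
    obtain ⟨x, u, rfl⟩ := exists_bappend X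
    obtain ⟨y, v, rfl⟩ := exists_bappend Y
    rw [extendR_apply, hK, Matrix.sum_apply, Matrix.sum_apply]
    refine Finset.sum_congr rfl fun i _ => ?_
    simp only [Matrix.mul_apply, sum_bappend, hL', Matrix.conjTranspose_apply, Matrix.of_apply]
    simp only [hL]
    simp
  · ext X Y
    obtain ⟨x, u, rfl⟩ := exists_bappend X
    obtain ⟨y, v, rfl⟩ := exists_bappend Y
    have := congrFun (congrFun hK1 x) y
    rw [Matrix.sum_apply] at this ⊢
    simp only [Matrix.mul_apply, sum_bappend, hL', Matrix.conjTranspose_apply,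
      Matrix.one_apply, bappend_inj] at this ⊢
    simp only [hL]
    by_cases huv : u = v
    · simpa [huv] using this
    · simp [huv, Ne.symm huv]

theorem Kr.isChannel {a b : ℕ} {Φ : QOp a → QOp b} (h : Kr Φ) : IsChannel Φ where
  linear := h.linear
  cp m := (h.extendR m).pos
  tp := h.tp

theorem Kr.of_bij {a b : ℕ} {Φ : QOp a → QOp b} {ι : Type} [Fintype ι]
    (f : ι → BString b → BString a)
    (hf : Function.Bijective (fun p : ι × BString b => f p.1 p.2))
    (h : ∀ ρ x y, Φ ρ x y = ∑ i, ρ (f i x) (f i y)) : Kr Φ := by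
  refine ⟨ι, inferInstance, fun i => Matrix.of fun x p => if p = f i x then 1 else 0, ?_, ?_⟩
  · intro ρ
    ext x y
    rw [h, Matrix.sum_apply]
    refine Finset.sum_congr rfl fun i _ => ?_
    simp [Matrix.mul_apply]
  · ext p q
    simp only [Matrix.sum_apply, Matrix.mul_apply, Matrix.conjTranspose_apply, Matrix.of_apply]
    obtain ⟨⟨i, x⟩, rfl⟩ := hf.2 p
    rw [← Fintype.sum_prod_type (f := fun z : ι × BString b =>
      star (if f i x = f z.1 z.2 then (1 : ℂ) else 0) * if q = f z.1 z.2 then 1 else 0)]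
    rw [Finset.sum_eq_single (i, x)]
    · simp [Matrix.one_apply, eq_comm]
    · intro z _ hz
      rw [if_neg (fun e => hz (hf.1 e).symm)]
      simp
    · simp

theorem Kr.of_isChannel {a b : ℕ} {Φ : QOp a → QOp b} (h : IsChannel Φ) : Kr Φ := by
  obtain ⟨K, hK, hK2⟩ := kraus_two h
  refine ⟨_, inferInstance, K, ?_, ?_⟩
  · intro ρ
    ext i j
    rw [hK, Matrix.sum_apply]
    refine Finset.sum_congr rfl fun u _ => ?_
    simp only [Matrix.mul_apply, Matrix.conjTranspose_apply, Finset.sum_mul]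
    rw [Finset.sum_comm]
  · ext p q
    have := hK2 q p
    simp only [Matrix.sum_apply, Matrix.mul_apply, Matrix.conjTranspose_apply, Matrix.one_apply]
    rw [Finset.sum_comm]
    simp only [eq_comm (a := p) (b := q), ← this]
    refine Finset.sum_congr rfl fun i _ => Finset.sum_congr rfl fun u _ => mul_comm _ _

theorem Kr.ancilla {n : ℕ} : Kr (addAncilla (n := n)) := by
  refine ⟨Unit, inferInstance, fun _ => Matrix.of fun X p => if X = bappend p (bzero 1) then 1 else 0, ?_, ?_⟩
  · intro ρ
    ext X Y
    obtain ⟨x, u, rfl⟩ := exists_bappend X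
    obtain ⟨y, v, rfl⟩ := exists_bappend Y
    rw [addAncilla, tensorOp_apply]
    simp only [Finset.univ_unique, Finset.sum_singleton, Matrix.mul_apply, Matrix.of_apply,
      Matrix.conjTranspose_apply, bappend_inj, basisOp]
    by_cases hu : u = bzero 1 <;> by_cases hv : v = bzero 1 <;> simp [hu, hv]
  · ext p q
    simp only [Finset.univ_unique, Finset.sum_singleton, Matrix.mul_apply, Matrix.of_apply,
      Matrix.conjTranspose_apply, Matrix.one_apply]
    rw [Finset.sum_eq_single (bappend p (bzero 1))]
    · simp [bappend_inj]
    · intro z _ hz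
      simp [hz]
    · simp

theorem permOp_apply {n : ℕ} (π : Equiv.Perm (Fin n)) (M : QOp n) (x y : BString n) :
    permOp π M x y = M (x ∘ π) (y ∘ π) := rfl

theorem traceLast_apply {n : ℕ} (M : QOp (n + 1)) (x y : BString n) :
    traceLast M x y = ∑ u : BString 1, M (bappend x u) (bappend y u) := rfl

theorem Gates.kr {a b : ℕ} {Φ : QOp a → QOp b} {k : ℕ} (h : Gates Φ k) : Kr Φ := by
  induction h with
  | id a =>
    exact Kr.of_bij (ι := Unit) (fun _ x => x)
      ⟨fun p q h => Prod.ext rfl h, fun x => ⟨((), x), rfl⟩⟩ (by simp)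
  | comp _ _ h1 h2 => exact h1.comp h2
  | perm π =>
    refine Kr.of_bij (ι := Unit) (fun _ x => x ∘ π) ⟨fun p q h => Prod.ext rfl ?_, fun x => ⟨((), x ∘ π.symm), ?_⟩⟩ ?_
    · exact (Function.Surjective.injective_comp_right π.surjective) h
    · funext i; simp
    · simp [permOp_apply]
  | gate Φ h => exact (Kr.of_isChannel h).extendR _
  | ancilla n => exact Kr.ancilla
  | discard n =>
    refine Kr.of_bij (ι := BString 1) (fun u x => bappend x u) ⟨fun p q h => ?_, fun x => ?_⟩ ?_
    · have := bappend_inj.1 h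
      exact Prod.ext this.2 this.1
    · obtain ⟨s, t, rfl⟩ := exists_bappend x
      exact ⟨(t, s), rfl⟩
    · exact traceLast_apply

theorem Gates.isChannel {a b : ℕ} {Φ : QOp a → QOp b} {k : ℕ} (h : Gates Φ k) : IsChannel Φ :=
  (Gates.kr h).isChannel

end
end PS
end

section
set_option linter.unusedSectionVars false
open scoped ComplexOrder Matrix
/-! ### Purification of samplable states; circuits from local unitaries -/
namespace PS
noncomputable section

section
variable {ι W : Type} [Fintype ι] [DecidableEq ι] [Fintype W] [DecidableEq W]

theorem emb_equiv_apply (e : ι ≃ W) (V : Mx ι) (x y : W → Bool) :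
    emb e.toEmbedding V x y = V (fun i => x (e i)) (fun i => y (e i)) := by
  simp only [emb, Matrix.of_apply]
  rw [if_pos]
  · rfl
  · intro w hw
    exact absurd ⟨e.symm w, by simp⟩ hw

theorem emb_mulVec (f : ι ↪ W) (U : Mx ι) (v : (W → Bool) → ℂ) (x : W → Bool) :
    (emb f U *ᵥ v) x = ∑ p : ι → Bool, U (fun i => x (f i)) p * v ((sp f).symm (p, (sp f x).2)) := by
  classical
  simp only [Matrix.mulVec, dotProduct]
  rw [← (sp f).symm.sum_comp, Fintype.sum_prod_type]
  refine Finset.sum_congr rfl fun p _ => ?_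
  rw [Finset.sum_eq_single (sp f x).2]
  · rw [emb_eq]
    simp only [Matrix.submatrix_apply, Equiv.apply_symm_apply, Matrix.kroneckerMap_apply,
      Matrix.one_apply, if_true, mul_one]
    rfl
  · intro q _ hq
    rw [emb_eq]
    simp only [Matrix.submatrix_apply, Equiv.apply_symm_apply, Matrix.kroneckerMap_apply,
      Matrix.one_apply, if_neg (Ne.symm hq), mul_zero, zero_mul]
  · simp

theorem sp_symm_range (f : ι ↪ W) (p) (i : ι) : (sp f).symm p (f i) = p.1 i :=
    congrFun (congrArg Prod.fst ((sp f).apply_symm_apply p)) i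

theorem sp_symm_off (f : ι ↪ W) (p : (ι → Bool)) (x : W → Bool) (w : W) (hw : w ∉ Set.range f) :
    (sp f).symm (p, (sp f x).2) w = x w :=
    congrFun (congrArg Prod.snd ((sp f).apply_symm_apply (p, (sp f x).2))) ⟨w, hw⟩

end

/-- `ρ` has a purification prepared by a unitary circuit with `c` gates and at most `e`
environment wires. -/
def Pur {a : ℕ} (ρ : QOp a) (c e : ℕ) : Prop :=
  ∃ (F : Type) (_ : Fintype F) (_ : DecidableEq F) (V : Mx (Fin a ⊕ F)), Fintype.card F ≤ e ∧
    UC V c ∧ ∀ x y, ρ x y = ∑ u : F → Bool, V (Sum.elim x u) (fun _ => false) *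
      star (V (Sum.elim y u) (fun _ => false))

theorem Pur.unit : Pur unitOp 0 0 := by
  refine ⟨Empty, inferInstance, inferInstance, 1, by simp, UC.one, ?_⟩
  intro x y
  have : ∀ z : Fin 0 ⊕ Empty → Bool, z = fun _ => false := fun z => by
    funext i; rcases i with i | i
    · exact i.elim0
    · exact i.elim
  have h1 : ∀ z z', (1 : Mx (Fin 0 ⊕ Empty)) z z' = 1 := fun z z' => by
    rw [this z, this z', Matrix.one_apply_eq]
  simp [unitOp, h1]

theorem Pur.perm {a : ℕ} {ρ : QOp a} {c e : ℕ} (h : Pur ρ c e) (π : Equiv.Perm (Fin a)) :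
    Pur (permOp π ρ) c e := by
  obtain ⟨F, _, _, V, hF, hV, h⟩ := h
  refine ⟨F, inferInstance, inferInstance, emb (Equiv.sumCongr π (Equiv.refl F)).toEmbedding V, hF,
    hV.emb _, ?_⟩
  intro x y
  rw [permOp_apply, h]
  refine Finset.sum_congr rfl fun u _ => ?_
  simp only [emb_equiv_apply]
  have : ∀ x : BString a, (fun i => (Sum.elim x u : Fin a ⊕ F → Bool) ((Equiv.sumCongr π (Equiv.refl F)) i)) =
      Sum.elim (x ∘ π) u := by
    intro x; funext i; rcases i with i | i <;> rfl
  rw [this, this]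

theorem Pur.ancilla {a : ℕ} {ρ : QOp a} {c e : ℕ} (h : Pur ρ c e) :
    Pur (addAncilla ρ) c e := by
  obtain ⟨F, _, _, V, hF, hV, h⟩ := h
  let g : Fin a ⊕ F ↪ Fin (a + 1) ⊕ F :=
    ⟨Sum.map (Fin.castAdd 1) id, Sum.map_injective.2 ⟨Fin.castAdd_injective _ _, Function.injective_id⟩⟩
  refine ⟨F, inferInstance, inferInstance, emb g V, hF, hV.emb _, ?_⟩
  have key : ∀ (x : BString a) (b : BString 1) (u : F → Bool),
      emb g V (Sum.elim (bappend x b) u) (fun _ => false) =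
        if b = bzero 1 then V (Sum.elim x u) (fun _ => false) else 0 := by
    intro x b u
    simp only [emb, Matrix.of_apply]
    have h1 : (fun i => (Sum.elim (bappend x b) u : Fin (a + 1) ⊕ F → Bool) (g i)) = Sum.elim x u := by
      funext i; rcases i with i | i
      · exact bappend_castAdd x b i
      · rfl
    rw [h1]
    by_cases hb : b = bzero 1
    · rw [if_pos hb, if_pos]
      intro w hw
      rcases w with w | w
      · induction w using Fin.addCases with
        | left i => exact absurd ⟨Sum.inl i, rfl⟩ hw
        | right i =>
          simp only [Sum.elim_inl]
          rw [bappend_natAdd, hb]; rfl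
      · exact absurd ⟨Sum.inr w, rfl⟩ hw
    · rw [if_neg hb, if_neg]
      intro hh
      apply hb
      funext i
      have := hh (Sum.inl (Fin.natAdd a i)) (by
        rintro ⟨z, hz⟩
        rcases z with z | z
        · have := congrArg Fin.val (Sum.inl.inj hz)
          simp at this
          omega
        · exact absurd hz (by simp [g]))
      simp only [Sum.elim_inl] at this
      rw [bappend_natAdd] at this
      exact this
  intro X Y
  obtain ⟨x, u, rfl⟩ := exists_bappend X
  obtain ⟨y, v, rfl⟩ := exists_bappend Y
  simp only [key]
  rw [addAncilla, tensorOp_apply, h]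
  simp only [basisOp, Matrix.of_apply]
  by_cases hu : u = bzero 1 <;> by_cases hv : v = bzero 1 <;> simp [hu, hv]

theorem Pur.discard {a : ℕ} {ρ : QOp (a + 1)} {c e : ℕ} (h : Pur ρ c e) :
    Pur (traceLast ρ) c (e + 1) := by
  obtain ⟨F, _, _, V, hF, hV, h⟩ := h
  let g : Fin (a + 1) ⊕ F ≃ Fin a ⊕ (Fin 1 ⊕ F) :=
    (Equiv.sumCongr finSumFinEquiv.symm (Equiv.refl F)).trans (Equiv.sumAssoc _ _ _)
  refine ⟨Fin 1 ⊕ F, inferInstance, inferInstance, emb g.toEmbedding V, ?_, hV.emb _, ?_⟩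
  · simp; omega
  have key : ∀ (x : BString a) (b : BString 1) (u : F → Bool),
      (fun i => (Sum.elim x (Sum.elim b u) : Fin a ⊕ (Fin 1 ⊕ F) → Bool) (g i)) =
        Sum.elim (bappend x b) u := by
    intro x b u
    funext i
    rcases i with i | i
    · induction i using Fin.addCases with
      | left i => simp only [Sum.elim_inl]; rw [bappend_castAdd]; simp [g]
      | right i => simp only [Sum.elim_inl]; rw [bappend_natAdd]; simp [g]
    · simp [g]
  intro x y
  rw [traceLast_apply]
  rw [← (Equiv.sumArrowEquivProdArrow (Fin 1) F Bool).symm.sum_comp, Fintype.sum_prod_type]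
  refine Finset.sum_congr rfl fun b _ => ?_
  rw [h]
  refine Finset.sum_congr rfl fun u _ => ?_
  rw [emb_equiv_apply, emb_equiv_apply]
  change _ = V (fun i => (Sum.elim x (Sum.elim b u) : Fin a ⊕ (Fin 1 ⊕ F) → Bool) (g i)) _ *
    star (V (fun i => (Sum.elim y (Sum.elim b u) : Fin a ⊕ (Fin 1 ⊕ F) → Bool) (g i)) _)
  rw [key, key]

theorem Pur.gate {m : ℕ} {ρ : QOp (2 + m)} {c e : ℕ} (h : Pur ρ c e) {Φ : QOp 2 → QOp 2}
    (hΦ : IsChannel Φ) : Pur (extendR Φ m ρ) (KC + c) (e + 4) := by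
  obtain ⟨F, _, _, V, hF, hV, h⟩ := h
  obtain ⟨U, hU, hΦU⟩ := stinespring hΦ
  let g : Fin (2 + m) ⊕ F ↪ Fin (2 + m) ⊕ (F ⊕ Fin 4) :=
    ⟨Sum.map id Sum.inl, Sum.map_injective.2 ⟨Function.injective_id, Sum.inl_injective⟩⟩
  let f : Fin 2 ⊕ Fin 4 ↪ Fin (2 + m) ⊕ (F ⊕ Fin 4) :=
    ⟨Sum.map (Fin.castAdd m) Sum.inr, Sum.map_injective.2 ⟨Fin.castAdd_injective _ _, Sum.inr_injective⟩⟩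
  have hUC : UC U KC := by
    have := univ_UC (by simp) hU
    simpa [KC] using this
  refine ⟨F ⊕ Fin 4, inferInstance, inferInstance, emb f U * emb g V, by simp; omega,
    UC.mul (hUC.emb f) (hV.emb g), ?_⟩
  have hg : ∀ (z : Fin (2 + m) → Bool) (w : F → Bool) (u : Fin 4 → Bool),
      emb g V (Sum.elim z (Sum.elim w u)) (fun _ => false) =
        if u = (fun _ => false) then V (Sum.elim z w) (fun _ => false) else 0 := by
    intro z w u
    simp only [emb, Matrix.of_apply]
    have h1 : (fun i => (Sum.elim z (Sum.elim w u) : Fin (2 + m) ⊕ (F ⊕ Fin 4) → Bool) (g i)) = Sum.elim z w := by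
      funext i; rcases i with i | i <;> rfl
    rw [h1]
    by_cases hb : u = fun _ => false
    · rw [if_pos hb, if_pos]
      intro k hk
      rcases k with k | k | k
      · exact absurd ⟨Sum.inl k, rfl⟩ hk
      · exact absurd ⟨Sum.inr k, rfl⟩ hk
      · simp [hb]
    · rw [if_neg hb, if_neg]
      intro hh
      apply hb
      funext i
      have := hh (Sum.inr (Sum.inr i)) (by
        rintro ⟨z, hz⟩
        rcases z with z | z <;> simp [g] at hz)
      simpa using this
  have key : ∀ (x : BString 2) (r : BString m) (w : F → Bool) (u : Fin 4 → Bool),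
      (emb f U * emb g V) (Sum.elim (bappend x r) (Sum.elim w u)) (fun _ => false) =
        ∑ p, U (Sum.elim x u) (Sum.elim p fun _ => false) *
          V (Sum.elim (bappend p r) w) (fun _ => false) := by
    intro x r w u
    have h1 := emb_mulVec f U (fun z => emb g V z (fun _ => false))
      (Sum.elim (bappend x r) (Sum.elim w u))
    refine Eq.trans h1 ?_
    have h2 : (fun i => (Sum.elim (bappend x r) (Sum.elim w u) : Fin (2 + m) ⊕ (F ⊕ Fin 4) → Bool) (f i))
        = Sum.elim x u := by
      funext i; rcases i with i | i
      · exact bappend_castAdd x r i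
      · rfl
    rw [h2]
    have h3 : ∀ (p : Fin 2 → Bool) (q : Fin 4 → Bool),
        (sp f).symm (Sum.elim p q, (sp f (Sum.elim (bappend x r) (Sum.elim w u))).2) =
        Sum.elim (bappend p r) (Sum.elim w q) := by
      intro p q
      funext k
      rcases k with k | k | k
      · induction k using Fin.addCases with
        | left i =>
          have := sp_symm_range f (Sum.elim p q, (sp f (Sum.elim (bappend x r) (Sum.elim w u))).2) (Sum.inl i)
          refine Eq.trans this ?_
          simp only [Sum.elim_inl]; rw [bappend_castAdd]
        | right i =>
          rw [sp_symm_off]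
          · simp only [Sum.elim_inl]; rw [bappend_natAdd, bappend_natAdd]
          · rintro ⟨z, hz⟩
            rcases z with z | z
            · have := congrArg Fin.val (Sum.inl.inj hz)
              simp at this
              omega
            · exact absurd hz (by simp [f])
      · rw [sp_symm_off]
        · simp
        · rintro ⟨z, hz⟩
          rcases z with z | z <;> simp [f] at hz
      · exact sp_symm_range f (Sum.elim p q, (sp f (Sum.elim (bappend x r) (Sum.elim w u))).2) (Sum.inr k)
    rw [← (Equiv.sumArrowEquivProdArrow (Fin 2) (Fin 4) Bool).symm.sum_comp, Fintype.sum_prod_type]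
    refine Finset.sum_congr rfl fun p _ => ?_
    rw [Finset.sum_eq_single (fun _ => false)]
    · change U _ (Sum.elim p _) * emb g V ((sp f).symm (Sum.elim p _, _)) _ = _
      rw [h3, hg, if_pos rfl]
    · intro q _ hq
      change U _ (Sum.elim p _) * emb g V ((sp f).symm (Sum.elim p _, _)) _ = _
      rw [h3, hg, if_neg hq, mul_zero]
    · simp
  intro X Y
  obtain ⟨x, r, rfl⟩ := exists_bappend X
  obtain ⟨y, s, rfl⟩ := exists_bappend Y
  rw [extendR_apply, hΦU]
  rw [← (Equiv.sumArrowEquivProdArrow F (Fin 4) Bool).symm.sum_comp, Fintype.sum_prod_type]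
  conv_rhs => rw [Finset.sum_comm]
  refine Finset.sum_congr rfl fun u _ => ?_
  simp only [Matrix.of_apply, h]
  change _ = ∑ w : F → Bool, (emb f U * emb g V) (Sum.elim (bappend x r) (Sum.elim w u)) _ *
    star ((emb f U * emb g V) (Sum.elim (bappend y s) (Sum.elim w u)) _)
  simp only [key, star_sum, Finset.sum_mul_sum, star_mul', Finset.mul_sum, Finset.sum_mul]
  conv_lhs => rw [Finset.sum_comm]
  conv_rhs => rw [Finset.sum_comm]
  refine Finset.sum_congr rfl fun p _ => ?_
  conv_rhs => rw [Finset.sum_comm]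
  refine Finset.sum_congr rfl fun q _ => Finset.sum_congr rfl fun w _ => ?_
  ring

theorem Gates.pur {a b : ℕ} {Φ : QOp a → QOp b} {k : ℕ} (h : Gates Φ k) : ∀ {ρ : QOp a} {c e : ℕ},
    Pur ρ c e → Pur (Φ ρ) (KC * k + c) (e + 4 * k) := by
  have mono : ∀ {a : ℕ} {ρ : QOp a} {c e c' e' : ℕ}, Pur ρ c e → c ≤ c' → e ≤ e' → Pur ρ c' e' := by
    rintro a ρ c e c' e' ⟨F, i1, i2, V, hF, hV, h⟩ hc he
    exact ⟨F, i1, i2, V, hF.trans he, hV.mono hc, h⟩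
  induction h with
  | id a => intro ρ c e h; exact mono h (by omega) (by omega)
  | comp _ _ h1 h2 =>
    intro ρ c e h
    exact mono (h2 (h1 h)) (by ring_nf; omega) (by ring_nf; omega)
  | perm π => intro ρ c e h; exact mono (h.perm π) (by omega) (by omega)
  | gate Φ hΦ => intro ρ c e h; exact mono (h.gate hΦ) (by omega) (by omega)
  | ancilla n => intro ρ c e h; exact mono h.ancilla (by omega) (by omega)
  | discard n => intro ρ c e h; exact mono h.discard (by omega) (by omega)

theorem Gates.width {a b : ℕ} {Φ : QOp a → QOp b} {k : ℕ} (h : Gates Φ k) : b ≤ a + k := by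
  induction h <;> omega

end
end PS
end

section
set_option linter.unusedSectionVars false
open scoped ComplexOrder Matrix
/-! ### Circuits from local unitaries -/
namespace PS
noncomputable section

/-- `Φ` is implemented by a circuit with at most `k` gates. -/
def GB {a b : ℕ} (Φ : QOp a → QOp b) (k : ℕ) : Prop := ∃ k' ≤ k, Gates Φ k'

theorem GB.comp {a b c : ℕ} {Φ : QOp a → QOp b} {Ψ : QOp b → QOp c} {k l : ℕ}
    (h1 : GB Φ k) (h2 : GB Ψ l) : GB (Ψ ∘ Φ) (k + l) := by
  obtain ⟨k', hk, h1⟩ := h1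
  obtain ⟨l', hl, h2⟩ := h2
  exact ⟨k' + l', by omega, Gates.comp h1 h2⟩

theorem GB.mono {a b : ℕ} {Φ : QOp a → QOp b} {k l : ℕ} (h : GB Φ k) (hl : k ≤ l) : GB Φ l := by
  obtain ⟨k', hk, h⟩ := h
  exact ⟨k', by omega, h⟩

theorem GB.id (a : ℕ) : GB (id : QOp a → QOp a) 0 := ⟨0, le_rfl, Gates.id a⟩

/-- Moving wires along a bijection. -/
def rewire {a b : ℕ} (e : Fin a ≃ Fin b) (M : QOp a) : QOp b :=
  Matrix.of fun x y => M (x ∘ e) (y ∘ e)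

theorem GB.rewire {a b : ℕ} (e : Fin a ≃ Fin b) : GB (rewire e) 1 := by
  have h : a = b := by simpa using Fintype.card_congr e
  subst h
  exact ⟨1, le_rfl, Gates.perm e⟩

theorem conjOp_isChannel {n : ℕ} {U : QOp n} (hU : U ∈ Matrix.unitaryGroup (BString n) ℂ) :
    IsChannel (conjOp U) := by
  apply Kr.isChannel
  refine ⟨Unit, inferInstance, fun _ => U, fun ρ => by simp [conjOp], ?_⟩
  simpa [Matrix.star_eq_conjTranspose] using Matrix.mem_unitaryGroup_iff'.1 hU

theorem exists_wire_equiv {N : ℕ} (f : Fin 2 ↪ Fin N) :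
    ∃ (m : ℕ) (e : Fin (2 + m) ≃ Fin N), ∀ i, e (Fin.castAdd m i) = f i := by
  classical
  have hc : Fintype.card {w : Fin N // w ∉ Set.range f} = N - 2 := by
    rw [Fintype.card_subtype_compl, Fintype.card_fin]
    congr 1
    rw [Fintype.card_congr (Equiv.ofInjective f f.injective).symm, Fintype.card_fin]
  let e1 : Fin 2 ≃ {w : Fin N // w ∈ Set.range f} := Equiv.ofInjective f f.injective
  let e2 : Fin (N - 2) ≃ {w : Fin N // w ∉ Set.range f} := (finCongr hc.symm).trans (Fintype.equivFin _).symm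
  refine ⟨N - 2, finSumFinEquiv.symm.trans ((Equiv.sumCongr e1 e2).trans (Equiv.sumCompl _)), ?_⟩
  intro i
  simp [e1]

theorem conj_emb_castAdd {m : ℕ} (U : QOp 2) (M : QOp (2 + m)) :
    extendR (conjOp U) m M = conjOp (emb (Fin.castAddEmb m) U) M := by
  have hE : ∀ x u y v, emb (Fin.castAddEmb m) U (bappend x u) (bappend y v) =
      U x y * if u = v then 1 else 0 := by
    intro x u y v
    simp only [emb, Matrix.of_apply]
    have h1 : ∀ (x : BString 2) (u : BString m), (fun i => bappend x u (Fin.castAddEmb m i)) = x :=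
      fun x u => funext fun i => bappend_castAdd x u i
    rw [h1, h1]
    by_cases huv : u = v
    · rw [if_pos huv, if_pos, mul_one]
      intro w hw
      induction w using Fin.addCases with
      | left i => exact absurd ⟨i, rfl⟩ hw
      | right i => rw [bappend_natAdd, bappend_natAdd, huv]
    · rw [if_neg huv, if_neg, mul_zero]
      intro hh
      apply huv
      funext i
      have := hh (Fin.natAdd 2 i) (by
        rintro ⟨z, hz⟩
        have := congrArg Fin.val hz
        simp at this
        omega)
      rwa [bappend_natAdd, bappend_natAdd] at this
  have hE' : ∀ x u y v, star (emb (Fin.castAddEmb m) U (bappend x u) (bappend y v)) =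
      star (U x y) * if u = v then 1 else 0 := by
    intro x u y v
    rw [hE, star_mul']
    split_ifs <;> simp
  ext X Y
  obtain ⟨x, u, rfl⟩ := exists_bappend X
  obtain ⟨y, v, rfl⟩ := exists_bappend Y
  rw [extendR_apply]
  simp only [conjOp, Matrix.mul_apply, sum_bappend, Matrix.conjTranspose_apply, Matrix.of_apply, hE']
  simp only [hE]
  simp

theorem rewire_conj {a b : ℕ} (e : Fin a ≃ Fin b) (V M : QOp a) :
    rewire e (conjOp V M) = conjOp (emb e.toEmbedding V) (rewire e M) := by
  ext x y
  simp only [rewire, Matrix.of_apply, conjOp, Matrix.mul_apply, Matrix.conjTranspose_apply,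
    emb_equiv_apply, Finset.sum_mul]
  rw [← (Equiv.arrowCongr e (Equiv.refl Bool)).sum_comp]
  refine Finset.sum_congr rfl fun p _ => ?_
  rw [← (Equiv.arrowCongr e (Equiv.refl Bool)).sum_comp]
  refine Finset.sum_congr rfl fun q _ => ?_
  have h : ∀ p : Fin a → Bool, (fun i => (Equiv.arrowCongr e (Equiv.refl Bool)) p (e i)) = p := by
    intro p; funext i; simp
  have h' : ∀ p : Fin a → Bool, ((Equiv.arrowCongr e (Equiv.refl Bool)) p ∘ e) = p := h
  simp only [h, h']
  rfl

theorem UC.gates {N : ℕ} {V : Mx (Fin N)} {c : ℕ} (h : UC V c) : GB (conjOp V) (3 * c) := by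
  induction h with
  | one =>
    have : (conjOp (1 : QOp N)) = (_root_.id : QOp N → QOp N) := by
      funext M; simp [conjOp]
    rw [this]; exact GB.id N
  | @mul A B a b _ _ h1 h2 =>
    have : conjOp (A * B) = conjOp A ∘ conjOp B := by
      funext M; simp only [conjOp, Function.comp_apply, Matrix.conjTranspose_mul, Matrix.mul_assoc]
    rw [this]
    exact (h2.comp h1).mono (by omega)
  | gate f U hU =>
    obtain ⟨m, e, he⟩ := exists_wire_equiv f
    have hf : f = (Fin.castAddEmb m).trans e.toEmbedding := by
      ext i; rw [← he]; rfl
    have : conjOp (PS.emb f U) = rewire e ∘ extendR (conjOp U) m ∘ rewire e.symm := by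
      funext M
      simp only [Function.comp_apply]
      rw [conj_emb_castAdd, rewire_conj, emb_emb, ← hf]
      congr 1
      ext x y
      simp only [rewire, Matrix.of_apply]
      congr 1 <;> (funext i; simp)
    rw [this]
    exact (((GB.rewire e.symm).comp ⟨1, le_rfl, Gates.gate _ (conjOp_isChannel hU)⟩).comp (GB.rewire e)).mono
      (by omega)
  | mono _ h1 h2 => exact h2.mono (by omega)

/-- Appending `c` fresh zero wires. -/
def addZ {a : ℕ} (c : ℕ) (M : QOp a) : QOp (a + c) := tensorOp M (basisOp (bzero c))

theorem bappend_zero {a : ℕ} (x : BString a) (u : BString 0) : (bappend x u : BString a) = x := by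
  funext i
  exact bappend_castAdd x u i

theorem bappend_assoc1 {a c : ℕ} (x : BString a) (u : BString c) (b : BString 1) :
    (bappend x (bappend u b : BString (c + 1)) : BString (a + (c + 1))) =
      (bappend (bappend x u : BString (a + c)) b : BString (a + c + 1)) := by
  funext i
  induction i using Fin.addCases with
  | left i =>
    rw [bappend_castAdd]
    have : (Fin.castAdd (c + 1) i : Fin (a + c + 1)) = Fin.castAdd 1 (Fin.castAdd c i) := rfl
    rw [this, bappend_castAdd, bappend_castAdd]
  | right i =>
    rw [bappend_natAdd]
    induction i using Fin.addCases with
    | left i =>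
      have : (Fin.natAdd a (Fin.castAdd 1 i) : Fin (a + c + 1)) = Fin.castAdd 1 (Fin.natAdd a i) := rfl
      rw [this, bappend_castAdd, bappend_castAdd, bappend_natAdd]
    | right i =>
      have : (Fin.natAdd a (Fin.natAdd c i) : Fin (a + c + 1)) = Fin.natAdd (a + c) i := by
        ext; simp [Nat.add_assoc]
      rw [this, bappend_natAdd, bappend_natAdd]

theorem addZ_gates {a : ℕ} (c : ℕ) : GB (addZ c : QOp a → QOp (a + c)) c := by
  induction c with
  | zero =>
    have : (addZ 0 : QOp a → QOp a) = _root_.id := by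
      funext M
      ext x y
      have := tensorOp_apply M (basisOp (bzero 0)) x y (bzero 0) (bzero 0)
      rw [bappend_zero, bappend_zero] at this
      refine Eq.trans this ?_
      simp [basisOp]
    exact this ▸ GB.id a
  | succ c ih =>
    have : (addZ (c + 1) : QOp a → QOp (a + c + 1)) = addAncilla ∘ addZ c := by
      funext M
      ext X Y
      obtain ⟨X', b, rfl⟩ := exists_bappend (a := a + c) (b := 1) X
      obtain ⟨Y', b', rfl⟩ := exists_bappend (a := a + c) (b := 1) Y
      obtain ⟨x, u, rfl⟩ := exists_bappend X'
      obtain ⟨y, v, rfl⟩ := exists_bappend Y'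
      have h1 : addAncilla (addZ c M) (bappend (bappend x u) b) (bappend (bappend y v) b') =
         (M x y * basisOp (bzero c) u v) * basisOp (bzero 1) b b' := by
        rw [addAncilla, tensorOp_apply, addZ, tensorOp_apply]
      have h2 : (addZ (c + 1) M) (bappend x (bappend u b)) (bappend y (bappend v b')) = M x y * basisOp (bzero (c + 1)) (bappend u b) (bappend v b') := by
        rw [addZ, tensorOp_apply]
      rw [bappend_assoc1, bappend_assoc1] at h2
      refine h2.trans (Eq.trans ?_ h1.symm)
      have h3 : bzero (c + 1) = bappend (bzero c) (bzero 1) := by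
        funext i
        induction i using Fin.addCases with
        | left i => rw [bappend_castAdd]; rfl
        | right i => rw [bappend_natAdd]; rfl
      rw [h3, mul_assoc]
      congr 1
      simp only [basisOp, Matrix.of_apply, bappend_inj]
      by_cases h1 : u = bzero c <;> by_cases h2 : v = bzero c <;> simp [h1, h2]
    rw [this]
    exact ih.comp ⟨1, le_rfl, Gates.ancilla _⟩

theorem ptraceR_apply {a b : ℕ} (M : QOp (a + b)) (x y : BString a) :
    ptraceR M x y = ∑ u : BString b, M (bappend x u) (bappend y u) := rfl

theorem ptraceR_gates {a : ℕ} (c : ℕ) : GB (ptraceR : QOp (a + c) → QOp a) c := by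
  induction c with
  | zero =>
    have : (ptraceR : QOp (a + 0) → QOp a) = _root_.id := by
      funext M
      ext x y
      rw [ptraceR_apply]
      rw [Fintype.sum_unique]
      have h := bappend_zero (a := a)
      exact congrArg₂ M (h x _) (h y _)
    rw [this]; exact GB.id a
  | succ c ih =>
    have : (ptraceR : QOp (a + (c + 1)) → QOp a) = (ptraceR : QOp (a + c) → QOp a) ∘ traceLast := by
      funext M
      ext x y
      rw [Function.comp_apply, ptraceR_apply (b := c)]
      simp only [traceLast_apply]
      refine (ptraceR_apply (b := c + 1) M x y).trans ?_
      rw [sum_bappend]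
      refine Finset.sum_congr rfl fun u _ => Finset.sum_congr rfl fun b _ => ?_
      rw [bappend_assoc1, bappend_assoc1]
    rw [this]
    have h1 : GB (traceLast (n := a + c)) 1 := ⟨1, le_rfl, Gates.discard _⟩
    exact (GB.comp h1 ih).mono (by omega)

section
variable {W C F : Type} [Fintype W] [DecidableEq W] [Fintype C] [DecidableEq C]
  [Fintype F] [DecidableEq F]

/-- The channel obtained from a unitary with fresh wires `C` and discarded wires `F`. -/
def dil {a b : ℕ} (V : Mx W) (g1 : Fin a ⊕ C ≃ W) (g2 : Fin b ⊕ F ≃ W) (ρ : QOp a) : QOp b :=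
  Matrix.of fun x y => ∑ u : F → Bool, ∑ p, ∑ q,
    V (Sum.elim x u ∘ g2.symm) (Sum.elim p (fun _ => false) ∘ g1.symm) * ρ p q *
      star (V (Sum.elim y u ∘ g2.symm) (Sum.elim q (fun _ => false) ∘ g1.symm))

theorem dil_gates {a b : ℕ} {V : Mx W} {c : ℕ} (hV : UC V c) (g1 : Fin a ⊕ C ≃ W) (g2 : Fin b ⊕ F ≃ W) :
    GB (dil V g1 g2) (3 * c + Fintype.card C + Fintype.card F + 1) := by
  let nC := Fintype.card C
  let nF := Fintype.card F
  let e1 : W ≃ Fin (a + nC) :=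
    g1.symm.trans ((Equiv.sumCongr (Equiv.refl _) (Fintype.equivFin C)).trans finSumFinEquiv)
  let e2 : W ≃ Fin (b + nF) :=
    g2.symm.trans ((Equiv.sumCongr (Equiv.refl _) (Fintype.equivFin F)).trans finSumFinEquiv)
  let e : Fin (a + nC) ≃ Fin (b + nF) := e1.symm.trans e2
  have key : dil V g1 g2 = ptraceR ∘ rewire e ∘ conjOp (emb e1.toEmbedding V) ∘ addZ nC := by
    funext ρ
    ext x y
    simp only [Function.comp_apply]
    rw [ptraceR_apply, ← (Equiv.arrowCongr (Fintype.equivFin F) (Equiv.refl Bool)).sum_comp]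
    simp only [dil, Matrix.of_apply]
    refine Finset.sum_congr rfl fun u _ => ?_
    simp only [rewire, Matrix.of_apply, conjOp, Matrix.mul_apply, Matrix.conjTranspose_apply,
      emb_equiv_apply]
    have h2 : ∀ x : BString b, (fun i => (bappend x ((Equiv.arrowCongr (Fintype.equivFin F) (Equiv.refl Bool)) u) ∘ e) (e1 i)) =
        Sum.elim x u ∘ g2.symm := by
      intro x
      funext w
      obtain ⟨w, rfl⟩ := g2.surjective w
      simp only [Function.comp_apply, e, Equiv.trans_apply, Equiv.symm_apply_apply, e2]
      rcases w with w | w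
      · exact bappend_castAdd _ _ _
      · refine (bappend_natAdd _ _ _).trans ?_
        simp
    have h1 : ∀ p : BString a, (fun i => (bappend p (bzero nC)) (e1 i)) =
        Sum.elim p (fun _ => false) ∘ g1.symm := by
      intro x
      funext w
      obtain ⟨w, rfl⟩ := g1.surjective w
      simp only [Function.comp_apply, Equiv.trans_apply, Equiv.symm_apply_apply, e1]
      rcases w with w | w
      · exact bappend_castAdd _ _ _
      · exact (bappend_natAdd _ _ _)
    simp only [h2, sum_bappend, addZ, tensorOp_apply]
    have h3 : ∀ (G : BString nC → ℂ) , (∀ v, v ≠ bzero nC → G v = 0) → ∑ v, G v = G (bzero nC) := by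
      intro G hG
      rw [Finset.sum_eq_single (bzero nC) (fun v _ hv => hG v hv) (by simp)]
    rw [Finset.sum_comm]
    refine Finset.sum_congr rfl fun q _ => ?_
    rw [h3]
    · rw [h1, Finset.sum_mul]
      refine Finset.sum_congr rfl fun p _ => ?_
      rw [h3]
      · rw [h1]; simp [basisOp]
      · intro v hv
        simp [basisOp, hv]
    · intro v hv
      simp [basisOp, hv]
  rw [key]
  have := (((addZ_gates (a := a) nC).comp ((hV.emb e1.toEmbedding).gates)).comp (GB.rewire e)).comp (ptraceR_gates nF)
  exact this.mono (by omega)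

end

end
end PS
end

section
set_option linter.unusedSectionVars false
open scoped ComplexOrder Matrix
/-! ### Classical reversible gates and uniform superpositions -/
namespace PS
noncomputable section

/-- bits as elements of the field with two elements -/
def bz (b : Bool) : ZMod 2 := if b then 1 else 0
/-- the converse of `bz` -/
def zb (z : ZMod 2) : Bool := decide (z = 1)

theorem zb_bz (b : Bool) : zb (bz b) = b := by cases b <;> simp [zb, bz]
theorem bz_zb (z : ZMod 2) : bz (zb z) = z := by
  revert z; decide
theorem z_add_self (z : ZMod 2) : z + z = 0 := by revert z; decide
theorem bz_inj {a b : Bool} (h : bz a = bz b) : a = b := by rw [← zb_bz a, h, zb_bz]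

/-- bits and `ZMod 2` -/
def bzE : Bool ≃ ZMod 2 := ⟨bz, zb, zb_bz, bz_zb⟩

section
variable {W : Type} [Fintype W] [DecidableEq W]

/-- Adding `f x` to `x`, where `f` changes only the wires in `T` and depends only on the others. -/
def xorP (T : Set W) (f : (W → Bool) → W → ZMod 2) (h1 : ∀ x w, w ∉ T → f x w = 0)
    (h2 : ∀ x y, (∀ w, w ∉ T → x w = y w) → f x = f y) : Equiv.Perm (W → Bool) where
  toFun x w := zb (bz (x w) + f x w)
  invFun x w := zb (bz (x w) + f x w)
  left_inv x := by
    funext w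
    have : f (fun w => zb (bz (x w) + f x w)) = f x := h2 _ _ fun w hw => by
      rw [h1 x w hw, add_zero, zb_bz]
    simp only [this, bz_zb, add_assoc, z_add_self, add_zero, zb_bz]
  right_inv x := by
    funext w
    have : f (fun w => zb (bz (x w) + f x w)) = f x := h2 _ _ fun w hw => by
      rw [h1 x w hw, add_zero, zb_bz]
    simp only [this, bz_zb, add_assoc, z_add_self, add_zero, zb_bz]

theorem xorP_apply (T : Set W) (f : (W → Bool) → W → ZMod 2) (h1) (h2) (x) (w) :
    xorP T f h1 h2 x w = zb (bz (x w) + f x w) := rfl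

theorem xorP_symm (T : Set W) (f : (W → Bool) → W → ZMod 2) (h1) (h2) :
    (xorP T f h1 h2).symm = xorP T f h1 h2 := rfl

/-- One gate: the wire `t` is changed, depending on the wires in `S`. -/
theorem xorP_single_UC (T : Set W) (f : (W → Bool) → W → ZMod 2) (h1) (h2) (t : W) (S : Finset W)
    (ht : ∀ x w, w ≠ t → f x w = 0) (htS : t ∉ S)
    (hS : ∀ x y, (∀ w ∈ S, x w = y w) → f x t = f y t) (hS1 : 1 ≤ S.card) (hS5 : S.card ≤ 5) :
    UC (pm (xorP T f h1 h2)) KC := by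
  refine IsLocal.UC (S := insert t S) (pm_local ?_ ?_) ?_ ?_ (pm_unitary _)
  · intro x w hw
    rw [xorP_apply, ht x w (by rintro rfl; simp at hw), add_zero, zb_bz]
  · intro x y h w hw
    rw [xorP_apply, xorP_apply, h w hw]
    by_cases hwt : w = t
    · subst hwt
      rw [hS x y (fun w hw => h w (Finset.mem_insert_of_mem hw))]
    · rw [ht x w hwt, ht y w hwt]
  · rw [Finset.card_insert_of_notMem htS]; omega
  · rw [Finset.card_insert_of_notMem htS]; omega

theorem xorP_sum_UC {α : Type} (s : Finset α) (T : Set W) (f : α → (W → Bool) → W → ZMod 2)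
    (h1 : ∀ a x w, w ∉ T → f a x w = 0)
    (h2 : ∀ a x y, (∀ w, w ∉ T → x w = y w) → f a x = f a y) (c : ℕ)
    (hf : ∀ a ∈ s, UC (pm (xorP T (f a) (h1 a) (h2 a))) c) (g : (W → Bool) → W → ZMod 2) (hg1) (hg2)
    (hg : ∀ x w, g x w = ∑ a ∈ s, f a x w) :
    UC (pm (xorP T g hg1 hg2)) (s.card * c) := by
  classical
  induction s using Finset.induction_on generalizing g with
  | empty =>
    have : xorP T g hg1 hg2 = 1 := by
      ext x w
      simp [xorP_apply, hg, zb_bz]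
    rw [this, pm_one]
    simpa using (UC.one : UC (1 : Mx W) 0)
  | insert a s ha ih =>
    have hm : xorP T g hg1 hg2 = xorP T (f a) (h1 a) (h2 a) *
        xorP T (fun x w => ∑ a ∈ s, f a x w)
          (fun x w hw => Finset.sum_eq_zero fun a _ => h1 a x w hw)
          (fun x y h => funext fun w => Finset.sum_congr rfl fun a _ => congrFun (h2 a x y h) w) := by
      ext x w
      rw [Equiv.Perm.mul_apply, xorP_apply, xorP_apply, h2 a _ x]
      · rw [hg, Finset.sum_insert ha]
        simp only [xorP_apply, bz_zb]
        congr 1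
        ring_nf
      · intro w hw
        rw [xorP_apply, Finset.sum_eq_zero fun a _ => h1 a x w hw, add_zero, zb_bz]
    rw [hm, ← pm_mul]
    have h3 := UC.mul (hf a (Finset.mem_insert_self _ _))
      (ih (fun b hb => hf b (Finset.mem_insert_of_mem hb)) (fun x w => ∑ a ∈ s, f a x w) 
          (fun x w hw => Finset.sum_eq_zero fun a _ => h1 a x w hw)
          (fun x y h => funext fun w => Finset.sum_congr rfl fun a _ => congrFun (h2 a x y h) w) (fun _ _ => rfl))
    refine UC.mono h3 ?_
    rw [Finset.card_insert_of_notMem ha]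
    ring_nf; omega

/-- Controlled swap. -/
def cswap (c u v : W) (hu : c ≠ u) (hv : c ≠ v) : Equiv.Perm (W → Bool) where
  toFun x := if x c then x ∘ Equiv.swap u v else x
  invFun x := if x c then x ∘ Equiv.swap u v else x
  left_inv x := by
    by_cases h : x c = true
    · have : (x ∘ Equiv.swap u v) c = true := by
        simp [Equiv.swap_apply_of_ne_of_ne hu hv, h]
      simp only [h, if_true, this]
      funext w; simp
    · simp [h]
  right_inv x := by
    by_cases h : x c = true
    · have : (x ∘ Equiv.swap u v) c = true := by
        simp [Equiv.swap_apply_of_ne_of_ne hu hv, h]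
      simp only [h, if_true, this]
      funext w; simp
    · simp [h]

theorem cswap_apply (c u v : W) (hu : c ≠ u) (hv : c ≠ v) (x : W → Bool) :
    cswap c u v hu hv x = if x c then x ∘ Equiv.swap u v else x := rfl

theorem cswap_UC (c u v : W) (hu : c ≠ u) (hv : c ≠ v) : UC (pm (cswap c u v hu hv)) KC := by
  refine IsLocal.UC (S := {c, u, v}) (pm_local ?_ ?_) ?_ ?_ (pm_unitary _)
  · intro x w hw
    simp only [Finset.mem_insert, Finset.mem_singleton, not_or] at hw
    rw [cswap_apply]
    split_ifs
    · simp [Equiv.swap_apply_of_ne_of_ne hw.2.1 hw.2.2]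
    · rfl
  · intro x y h w hw
    have hc := h c (by simp)
    have h1 := h u (by simp)
    have h2 := h v (by simp)
    rw [cswap_apply, cswap_apply, hc]
    split_ifs
    · simp only [Function.comp_apply]
      by_cases e1 : w = u
      · subst e1; simpa using h2
      · by_cases e2 : w = v
        · subst e2; simpa using h1
        · rw [Equiv.swap_apply_of_ne_of_ne e1 e2]; exact h w hw
    · exact h w hw
  · rw [Finset.card_insert_of_notMem (by simp [hu, hv])]
    have : 1 ≤ ({u, v} : Finset W).card := Finset.card_pos.2 ⟨u, by simp⟩
    omega
  · exact (Finset.card_le_three).trans (by norm_num)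

/-- amplitude of a uniform superposition of `k` qubits -/
def amp (k : ℕ) : ℂ := (((Real.sqrt 2 : ℝ) : ℂ)⁻¹) ^ k

theorem amp_sq (k : ℕ) : amp k * star (amp k) = ((2 : ℂ) ^ k)⁻¹ := by
  have : star (amp k) = amp k := by
    simp [amp]
  rw [this, amp, ← mul_pow, sqrt2_sq, one_div, inv_pow]

/-- The Hadamard-like rotation. -/
def hadF : Matrix Bool Bool ℂ := Matrix.of fun a b =>
  ((Real.sqrt 2 : ℝ) : ℂ)⁻¹ * (if a && b then -1 else 1)

theorem hadF_unitary : hadF ∈ Matrix.unitaryGroup Bool ℂ := by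
  rw [Matrix.mem_unitaryGroup_iff, Matrix.star_eq_conjTranspose]
  have h := sqrt2_sq
  ext a b
  simp only [Matrix.mul_apply, Fintype.sum_bool, Matrix.conjTranspose_apply, hadF, Matrix.of_apply,
    star_mul', star_inv₀, Complex.star_def, Complex.conj_ofReal]
  generalize ((Real.sqrt 2 : ℝ) : ℂ)⁻¹ = s at h
  cases a <;> cases b <;> simp <;>
    linear_combination (2 : ℂ) * h

theorem plus_UC (h2 : 2 ≤ Fintype.card W) (T : Finset W) :
    ∃ H : Mx W, UC H T.card ∧ ∀ x y, (∀ w ∈ T, y w = false) →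
      H x y = if (∀ w, w ∉ T → x w = y w) then amp T.card else 0 := by
  induction T using Finset.induction_on with
  | empty =>
    refine ⟨1, UC.one, ?_⟩
    intro x y _
    rw [Matrix.one_apply]
    simp [amp, funext_iff]
  | insert j T hj ih =>
    obtain ⟨H, hH, h⟩ := ih
    refine ⟨oneQ j hadF * H, ?_, ?_⟩
    · rw [Finset.card_insert_of_notMem hj, add_comm]
      exact UC.mul (oneQ_UC h2 j hadF_unitary) hH
    · intro x y hy
      have h1 := oneQ_mulVec j hadF (fun z => H z y) x
      refine Eq.trans h1 ?_
      have hyT : ∀ w ∈ T, y w = false := fun w hw => hy w (Finset.mem_insert_of_mem hw)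
      rw [h _ _ hyT, h _ _ hyT]
      have e2 : ¬ (∀ w, w ∉ T → Function.update x j true w = y w) := by
        intro hh
        have := hh j hj
        rw [hy j (Finset.mem_insert_self _ _)] at this
        simp at this
      rw [if_neg e2, mul_zero, add_zero]
      have e1 : (∀ w, w ∉ T → Function.update x j false w = y w) ↔
          (∀ w, w ∉ insert j T → x w = y w) := by
        constructor
        · intro hh w hw
          simp only [Finset.mem_insert, not_or] at hw
          have := hh w hw.2
          rwa [Function.update_of_ne hw.1] at this
        · intro hh w hw
          by_cases e : w = j
          · subst e; rw [hy w (Finset.mem_insert_self _ _)]; simp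
          · rw [Function.update_of_ne e]
            exact hh w (by simp [e, hw])
      simp only [e1, Finset.card_insert_of_notMem hj]
      split_ifs
      · simp [hadF, amp, pow_succ, mul_comm]
      · simp

end

end
end PS
end

section
set_option linter.unusedSectionVars false
open scoped ComplexOrder Matrix
/-! ### The averaged moments of the family of purifications -/
namespace PS
noncomputable section

/-- the sign character -/
def sg (z : ZMod 2) : ℂ := if z = 1 then -1 else 1

theorem sg_add (a b : ZMod 2) : sg (a + b) = sg a * sg b := by
  have h2 : (1 : ZMod 2) + 1 = 0 := by decide
  have h3 : (0 : ZMod 2) ≠ 1 := by decide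
  have key : ∀ a : ZMod 2, a = 0 ∨ a = 1 := by decide
  rcases key a with rfl | rfl <;> rcases key b with rfl | rfl <;> simp [sg, h2]

theorem sg_zero : sg 0 = 1 := by simp [sg]

theorem sg_sum {ι : Type} (s : Finset ι) (f : ι → ZMod 2) : sg (∑ i ∈ s, f i) = ∏ i ∈ s, sg (f i) := by
  classical
  induction s using Finset.induction_on with
  | empty => simp [sg_zero]
  | insert a s ha ih => rw [Finset.sum_insert ha, Finset.prod_insert ha, sg_add, ih]

theorem star_sg (z : ZMod 2) : star (sg z) = sg z := by
  unfold sg; split_ifs <;> simp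

theorem char_sum {P : Type} [Fintype P] [DecidableEq P] (d : P → ZMod 2) :
    ∑ c : P → Bool, sg (∑ p, bz (c p) * d p) = if d = 0 then (2 : ℂ) ^ Fintype.card P else 0 := by
  have key : ∀ a : ZMod 2, a = 0 ∨ a = 1 := by decide
  have h1 : ∀ z : ZMod 2, ∑ b : Bool, sg (bz b * z) = if z = 0 then 2 else 0 := by
    intro z
    rcases key z with rfl | rfl
    · simp [sg, bz]
    · simp [sg, bz]
  simp only [sg_sum]
  rw [← Fintype.prod_sum (fun p b => sg (bz b * d p))]
  simp only [h1]
  split_ifs with h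
  · subst h; simp
  · obtain ⟨p, hp⟩ := Function.ne_iff.1 h
    exact Finset.prod_eq_zero (Finset.mem_univ p) (if_neg hp)

/-- Averaging over a surjective homomorphism. -/
theorem hom_sum {G H : Type} [AddCommGroup G] [AddCommGroup H] [Fintype G] [Fintype H] (f : G →+ H)
    (hf : Function.Surjective f) (F : H → ℂ) :
    (Fintype.card H : ℂ) * ∑ g, F (f g) = (Fintype.card G : ℂ) * ∑ h, F h := by
  have h1 : ∀ h : H, ∑ g, F (f g) = ∑ g, F (f g + h) := by
    intro h
    obtain ⟨g0, rfl⟩ := hf h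
    rw [← Equiv.sum_comp (Equiv.addRight g0) (fun g => F (f g))]
    simp
  have h2 : ∑ h : H, ∑ g, F (f g) = ∑ h : H, ∑ g, F (f g + h) := Finset.sum_congr rfl fun h _ => h1 h
  rw [Finset.sum_const, Finset.card_univ, nsmul_eq_mul] at h2
  rw [h2, Finset.sum_comm]
  have h3 : ∀ g : G, ∑ h, F (f g + h) = ∑ h, F h := fun g => Equiv.sum_comp (Equiv.addLeft (f g)) F
  simp [h3]

section
variable {E S α : Type} [Fintype E] [DecidableEq E] [Fintype S] [DecidableEq S]

/-- the affine shift of the environment -/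
def shiftB (B : E × S → Bool) (y : E ⊕ S → Bool) : E → Bool :=
  fun i => zb (bz (y (Sum.inl i)) + ∑ j, bz (B (i, j)) * bz (y (Sum.inr j)))

/-- the exponent of the cubic phase -/
def phz {M : Type} [Fintype M] (c : M × M × M → Bool) (y : M → Bool) : ZMod 2 :=
  ∑ p : M × M × M, bz (c p) * (bz (y p.1) * bz (y p.2.1) * bz (y p.2.2))

/-- the family of purifications -/
def phi (ψ : α → (E → Bool) → ℂ) (c : (E ⊕ S) × (E ⊕ S) × (E ⊕ S) → Bool) (B : E × S → Bool)
    (b : α) (y : E ⊕ S → Bool) : ℂ :=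
  amp (Fintype.card S) * (sg (phz c y) * ψ b (shiftB B y))

/-- good tuples of labels -/
def Good {t : ℕ} (Y : Fin t → E ⊕ S → Bool) : Prop :=
  LinearIndependent (ZMod 2) (fun a => fun j : S => bz (Y a (Sum.inr j)))

theorem jennrich {M : Type} [Fintype M] {t : ℕ} (Y Y' : Fin t → M → ZMod 2)
    (hY : LinearIndependent (ZMod 2) Y)
    (h : ∀ i j k : M, ∑ a, Y a i * Y a j * Y a k = ∑ a, Y' a i * Y' a j * Y' a k) :
    ∃ π : Equiv.Perm (Fin t), ∀ a, Y' a = Y (π a) := by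
  classical
  have key : ∀ a : ZMod 2, a = 0 ∨ a = 1 := by decide
  have sq : ∀ a : ZMod 2, a * a = a := by decide
  -- dual functionals
  obtain ⟨L, hL⟩ := LinearMap.exists_leftInverse_of_injective (Fintype.linearCombination (ZMod 2) Y)
    (LinearMap.ker_eq_bot.2 (linearIndependent_iff_injective_fintypeLinearCombination.1 hY))
  have hL1 : ∀ a, L (Y a) = Pi.single a 1 := by
    intro a
    have := LinearMap.congr_fun hL (Pi.single a 1)
    simpa [Fintype.linearCombination_apply_single] using this
  -- contraction
  have hc : ∀ u v w : (M → ZMod 2) →ₗ[ZMod 2] ZMod 2,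
      ∑ a, u (Y a) * v (Y a) * w (Y a) = ∑ a, u (Y' a) * v (Y' a) * w (Y' a) := by
    intro u v w
    have ex : ∀ (u : (M → ZMod 2) →ₗ[ZMod 2] ZMod 2) (x : M → ZMod 2),
        u x = ∑ i, x i * u (Pi.single i 1) := by
      intro u x
      conv_lhs => rw [pi_eq_sum_univ' x]
      rw [map_sum]
      refine Finset.sum_congr rfl fun i _ => ?_
      rw [map_smul, smul_eq_mul]
    have e2 : ∀ Z : Fin t → M → ZMod 2, ∑ a, u (Z a) * v (Z a) * w (Z a) =
        ∑ i, ∑ j, ∑ k, (u (Pi.single i 1) * v (Pi.single j 1) * w (Pi.single k 1)) *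
          ∑ a, Z a i * Z a j * Z a k := by
      intro Z
      simp only [Finset.mul_sum]
      have e3 : ∀ a, u (Z a) * v (Z a) * w (Z a) = ∑ i, ∑ j, ∑ k,
          (u (Pi.single i 1) * v (Pi.single j 1) * w (Pi.single k 1)) * (Z a i * Z a j * Z a k) := by
        intro a
        rw [ex u (Z a), ex v (Z a), ex w (Z a), Finset.sum_mul_sum, Finset.sum_mul]
        refine Finset.sum_congr rfl fun i _ => ?_
        rw [Finset.sum_mul]
        refine Finset.sum_congr rfl fun j _ => ?_
        rw [Finset.mul_sum]
        refine Finset.sum_congr rfl fun k _ => ?_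
        ring
      rw [Finset.sum_congr rfl fun a _ => e3 a]
      rw [Finset.sum_comm]
      refine Finset.sum_congr rfl fun i _ => ?_
      rw [Finset.sum_comm]
      refine Finset.sum_congr rfl fun j _ => ?_
      rw [Finset.sum_comm]
    rw [e2, e2]
    simp only [h]
  let pr : Fin t → (M → ZMod 2) →ₗ[ZMod 2] ZMod 2 := fun a => (LinearMap.proj a).comp L
  have hpr : ∀ a b, pr a (Y b) = if a = b then 1 else 0 := by
    intro a b
    simp [pr, hL1, Pi.single_apply]
  let Q : Matrix (Fin t) (Fin t) (ZMod 2) := Matrix.of fun a c => pr a (Y' c)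
  have hQ3 : ∀ a b d, ∑ c, Q a c * Q b c * Q d c = if a = b ∧ b = d then 1 else 0 := by
    intro a b d
    have := hc (pr a) (pr b) (pr d)
    simp only [hpr] at this
    refine Eq.trans this.symm ?_
    by_cases h1 : a = b
    · subst h1
      by_cases h2 : a = d
      · subst h2; simp
      · simp [h2]
        
    · simp [h1]
      intro e1 e2; exact h1 (e2.trans e1.symm)
  have hQ2 : Q * Qᵀ = 1 := by
    ext a b
    rw [Matrix.mul_apply, Matrix.one_apply]
    have := hQ3 a a b
    simp only [sq, true_and] at this
    simpa [Matrix.transpose_apply] using this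
  have hQ2' : Qᵀ * Q = 1 := mul_eq_one_comm.1 hQ2
  have hcol : ∀ c c', ∑ a, Q a c * Q a c' = if c = c' then 1 else 0 := by
    intro c c'
    have := congrFun (congrFun hQ2' c) c'
    rwa [Matrix.mul_apply, Matrix.one_apply] at this
  have hdis : ∀ a b c, a ≠ b → Q a c * Q b c = 0 := by
    intro a b c' hab
    have e1 : ∑ d, Q d c' * ∑ c, Q a c * Q b c * Q d c = 0 :=
      Finset.sum_eq_zero fun d _ => by rw [hQ3, if_neg (fun hh => hab hh.1), mul_zero]
    have e2 : ∑ d, Q d c' * ∑ c, Q a c * Q b c * Q d c = ∑ c, Q a c * Q b c * ∑ d, Q d c' * Q d c := by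
      simp only [Finset.mul_sum]
      rw [Finset.sum_comm]
      refine Finset.sum_congr rfl fun _ _ => Finset.sum_congr rfl fun _ _ => by ring
    rw [e2] at e1
    simpa [hcol] using e1
  have hex : ∀ c, ∃ a, Q a c = 1 := by
    intro c
    by_contra hcon
    push Not at hcon
    have := hcol c c
    rw [if_pos rfl, Finset.sum_eq_zero] at this
    · exact absurd this (by decide)
    · intro a _
      rcases key (Q a c) with h0 | h0
      · rw [h0, zero_mul]
      · exact absurd h0 (hcon a)
  choose p hp using hex
  have hpu : ∀ a c, Q a c = if a = p c then 1 else 0 := by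
    intro a c
    split_ifs with e
    · rw [e, hp]
    · have := hdis a (p c) c e
      rwa [hp, mul_one] at this
  have hrow : ∀ a, ∃ c, p c = a := by
    intro a
    by_contra hcon
    push Not at hcon
    have h1 := congrFun (congrFun hQ2 a) a
    rw [Matrix.mul_apply, Matrix.one_apply, if_pos rfl, Finset.sum_eq_zero] at h1
    · exact absurd h1 (by decide)
    · intro c _
      rw [hpu, if_neg (fun hh => hcon c hh.symm), zero_mul]
  have hbij : Function.Bijective p := Finite.surjective_iff_bijective.1 hrow
  refine ⟨Equiv.ofBijective p hbij, fun c0 => ?_⟩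
  funext i
  have h1 := hc (pr (p c0)) (pr (p c0)) (LinearMap.proj i)
  have h2 : ∀ c, pr (p c0) (Y' c) = if p c0 = p c then 1 else 0 := fun c => hpu (p c0) c
  simp only [hpr, h2, sq, hbij.1.eq_iff] at h1
  simpa using h1.symm

theorem good_Y {t : ℕ} (Y : Fin t → E ⊕ S → Bool) (h : Good Y) :
    LinearIndependent (ZMod 2) (fun a => fun j => bz (Y a j)) := by
  have := LinearIndependent.of_comp
    (LinearMap.funLeft (ZMod 2) (ZMod 2) (Sum.inr : S → E ⊕ S)) (v := fun a => fun j => bz (Y a j)) h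
  exact this

theorem shift_sum {t : ℕ} (Y : Fin t → E ⊕ S → Bool) (h : Good Y) (F : (Fin t → E → Bool) → ℂ) :
    ((2 : ℂ) ^ Fintype.card E) ^ t * ∑ B : E × S → Bool, F (fun a => shiftB B (Y a)) =
      (2 : ℂ) ^ Fintype.card (E × S) * ∑ v, F v := by
  classical
  let r : Fin t → S → ZMod 2 := fun a j => bz (Y a (Sum.inr j))
  obtain ⟨L, hL⟩ := LinearMap.exists_leftInverse_of_injective (Fintype.linearCombination (ZMod 2) r)
    (LinearMap.ker_eq_bot.2 (linearIndependent_iff_injective_fintypeLinearCombination.1 h))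
  have hL1 : ∀ a, L (r a) = Pi.single a 1 := by
    intro a
    have := LinearMap.congr_fun hL (Pi.single a 1)
    simpa [Fintype.linearCombination_apply_single] using this
  have ex : ∀ (x : S → ZMod 2) a, L x a = ∑ i, x i * L (Pi.single i 1) a := by
    intro x a
    conv_lhs => rw [pi_eq_sum_univ' x]
    rw [map_sum, Finset.sum_apply]
    refine Finset.sum_congr rfl fun i _ => ?_
    rw [map_smul, Pi.smul_apply, smul_eq_mul]
  let f : (E × S → ZMod 2) →+ (Fin t → E → ZMod 2) :=
    { toFun := fun B a i => ∑ j, B (i, j) * r a j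
      map_zero' := by ext; simp
      map_add' := by intro B B'; ext a i; simp [add_mul, Finset.sum_add_distrib] }
  have hf : Function.Surjective f := by
    intro v
    refine ⟨fun ij => ∑ a, v a ij.1 * L (Pi.single ij.2 1) a, ?_⟩
    funext a i
    change ∑ j, (∑ a', v a' i * L (Pi.single j 1) a') * r a j = v a i
    simp only [Finset.sum_mul]
    rw [Finset.sum_comm]
    have : ∀ a', ∑ j, v a' i * L (Pi.single j 1) a' * r a j = v a' i * L (r a) a' := by
      intro a'
      rw [ex, Finset.mul_sum]
      exact Finset.sum_congr rfl fun _ _ => by ring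
    simp [this, hL1, Pi.single_apply]
  have h1 := hom_sum f hf (fun v => F (fun a i => zb (bz (Y a (Sum.inl i)) + v a i)))
  have h2 : ∑ B : E × S → Bool, F (fun a => shiftB B (Y a)) =
      ∑ B : E × S → ZMod 2, F (fun a i => zb (bz (Y a (Sum.inl i)) + f B a i)) := by
    rw [← (Equiv.arrowCongr (Equiv.refl (E × S)) bzE).sum_comp]
    rfl
  have h3 : ∑ v : Fin t → E → Bool, F v = ∑ v : Fin t → E → ZMod 2,
      F (fun a i => zb (bz (Y a (Sum.inl i)) + v a i)) := by
    have := Equiv.sum_comp (Equiv.addLeft (fun a i => bz (Y a (Sum.inl i))))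
      (fun v : Fin t → E → ZMod 2 => F (fun a i => zb (v a i)))
    refine Eq.trans ?_ this.symm
    rw [← (Equiv.arrowCongr (Equiv.refl (Fin t)) (Equiv.arrowCongr (Equiv.refl E) bzE)).sum_comp]
    refine Finset.sum_congr rfl fun v _ => ?_
    congr 1
    funext a i
    exact (zb_bz _).symm
  rw [h2, h3]
  simpa [pow_mul, mul_comm] using h1

variable (ψ : α → (E → Bool) → ℂ) (σ : α → α → ℂ)

theorem moment_perm (hσ : ∀ b b', σ b b' = ∑ v, ψ b v * star (ψ b' v)) {t : ℕ} (Y : Fin t → E ⊕ S → Bool) (h : Good Y) (b b' : Fin t → α)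
    (π : Equiv.Perm (Fin t)) :
    ∑ c : (E ⊕ S) × (E ⊕ S) × (E ⊕ S) → Bool, ∑ B : E × S → Bool,
      ∏ a, (phi ψ c B (b a) (Y a) * star (phi ψ c B (b' a) (Y (π a)))) =
    (2 : ℂ) ^ Fintype.card ((E ⊕ S) × (E ⊕ S) × (E ⊕ S)) * (2 : ℂ) ^ Fintype.card (E × S) *
      (((2 : ℂ) ^ Fintype.card (E ⊕ S)) ^ t)⁻¹ * ∏ a, σ (b a) (b' (π.symm a)) := by
  have hsgsq : ∀ z, sg z * sg z = 1 := by intro z; unfold sg; split_ifs <;> simp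
  have h1 : ∀ c B, ∏ a, (phi ψ c B (b a) (Y a) * star (phi ψ c B (b' a) (Y (π a)))) =
      (((2 : ℂ) ^ Fintype.card S) ^ t)⁻¹ *
        ∏ a, (ψ (b a) (shiftB B (Y a)) * star (ψ (b' (π.symm a)) (shiftB B (Y a)))) := by
    intro c B
    rw [Finset.prod_mul_distrib,
      ← (π.symm).prod_comp (fun a => star (phi ψ c B (b' a) (Y (π a)))), ← Finset.prod_mul_distrib]
    have : ∀ a, phi ψ c B (b a) (Y a) * star (phi ψ c B (b' (π.symm a)) (Y (π (π.symm a)))) =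
        ((2 : ℂ) ^ Fintype.card S)⁻¹ *
          (ψ (b a) (shiftB B (Y a)) * star (ψ (b' (π.symm a)) (shiftB B (Y a)))) := by
      intro a
      rw [Equiv.apply_symm_apply, ← amp_sq]
      simp only [phi, star_mul', star_sg]
      linear_combination (amp (Fintype.card S) * star (amp (Fintype.card S)) * 
        (ψ (b a) (shiftB B (Y a)) * star (ψ (b' (π.symm a)) (shiftB B (Y a))))) * hsgsq (phz c (Y a))
    simp only [this, Finset.prod_mul_distrib]
    simp
  simp only [h1, ← Finset.mul_sum]
  rw [Finset.sum_const, Finset.card_univ, nsmul_eq_mul]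
  have h2 := shift_sum Y h (fun v => ∏ a, (ψ (b a) (v a) * star (ψ (b' (π.symm a)) (v a))))
  rw [← Fintype.prod_sum (fun a v => ψ (b a) v * star (ψ (b' (π.symm a)) v))] at h2
  simp only [← hσ] at h2
  have hne : ((2 : ℂ) ^ Fintype.card E) ^ t ≠ 0 := by positivity
  have hne2 : ((2 : ℂ) ^ Fintype.card S) ^ t ≠ 0 := by positivity
  have h3 := eq_div_of_mul_eq hne ((mul_comm _ _).trans h2)
  rw [h3]
  simp only [Fintype.card_fun, Fintype.card_bool, Fintype.card_sum, pow_add, mul_pow]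
  push_cast
  field_simp

theorem moment_zero {t : ℕ} (Y Y' : Fin t → E ⊕ S → Bool) (h : Good Y) (b b' : Fin t → α)
    (hne : ∀ π : Equiv.Perm (Fin t), Y' ≠ Y ∘ π) :
    ∑ c : (E ⊕ S) × (E ⊕ S) × (E ⊕ S) → Bool, ∑ B : E × S → Bool,
      ∏ a, (phi ψ c B (b a) (Y a) * star (phi ψ c B (b' a) (Y' a))) = 0 := by
  rw [Finset.sum_comm]
  refine Finset.sum_eq_zero fun B _ => ?_
  let d : (E ⊕ S) × (E ⊕ S) × (E ⊕ S) → ZMod 2 := fun p =>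
    ∑ a, (bz (Y a p.1) * bz (Y a p.2.1) * bz (Y a p.2.2)) +
    ∑ a, (bz (Y' a p.1) * bz (Y' a p.2.1) * bz (Y' a p.2.2))
  have h1 : ∀ c, ∏ a, (phi ψ c B (b a) (Y a) * star (phi ψ c B (b' a) (Y' a))) =
      sg (∑ p, bz (c p) * d p) *
      ∏ a, (amp (Fintype.card S) * ψ (b a) (shiftB B (Y a)) *
        star (amp (Fintype.card S) * ψ (b' a) (shiftB B (Y' a)))) := by
    intro c
    have e1 : ∑ p, bz (c p) * d p = ∑ a, (phz c (Y a) + phz c (Y' a)) := by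
      simp only [d, phz, mul_add, Finset.mul_sum, Finset.sum_add_distrib]
      rw [Finset.sum_comm]
      congr 1
      rw [Finset.sum_comm]
    rw [e1, sg_sum, ← Finset.prod_mul_distrib]
    refine Finset.prod_congr rfl fun a _ => ?_
    simp only [phi, star_mul', star_sg, sg_add]
    ring
  simp only [h1, ← Finset.sum_mul]
  rw [char_sum, if_neg, zero_mul]
  intro hd
  have add0 : ∀ x y : ZMod 2, x + y = 0 → x = y := by decide
  obtain ⟨π, hπ⟩ := jennrich (fun a j => bz (Y a j)) (fun a j => bz (Y' a j)) (good_Y Y h)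
    (fun i j k => add0 _ _ (congrFun hd (i, j, k)))
  exact hne π (funext fun a => funext fun j => bz_inj (congrFun (hπ a) j))

theorem good_comp {t : ℕ} (Y : Fin t → E ⊕ S → Bool) (π : Equiv.Perm (Fin t)) (h : Good Y) :
    Good (Y ∘ π) := by
  exact LinearIndependent.comp h π π.injective

open Classical in
theorem bad_count (E S : Type) [Fintype E] [DecidableEq E] [Fintype S] [DecidableEq S] (t : ℕ) :
    (Finset.univ.filter fun Y : Fin t → E ⊕ S → Bool => ¬ Good Y).card * 2 ^ Fintype.card S ≤
      2 ^ t * (2 ^ Fintype.card (E ⊕ S)) ^ t := by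
  have key : ∀ a : ZMod 2, a = 0 ∨ a = 1 := by decide
  let bad : (Fin t → ZMod 2) → Finset (Fin t → E ⊕ S → Bool) := fun g =>
    Finset.univ.filter fun Y => g ≠ 0 ∧ ∑ a, g a • (fun j => bz (Y a (Sum.inr j))) = (0 : S → ZMod 2)
  have hsub : (Finset.univ.filter fun Y : Fin t → E ⊕ S → Bool => ¬ Good Y) ⊆
      Finset.univ.biUnion bad := by
    intro Y hY
    simp only [Finset.mem_filter, Finset.mem_univ, true_and] at hY
    unfold Good at hY
    rw [Fintype.not_linearIndependent_iff] at hY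
    obtain ⟨g, hg, i, hi⟩ := hY
    simp only [Finset.mem_biUnion, Finset.mem_univ, true_and, bad, Finset.mem_filter]
    exact ⟨g, fun h0 => hi (by rw [h0]; rfl), hg⟩
  have hb : ∀ g, (bad g).card * 2 ^ Fintype.card S ≤ (2 ^ Fintype.card (E ⊕ S)) ^ t := by
    intro g
    by_cases hg : g = 0
    · have : bad g = ∅ := by
        ext Y; simp [bad, hg]
      rw [this]; simp
    obtain ⟨a0, ha0⟩ := Function.ne_iff.1 hg
    have ha1 : g a0 = 1 := (key (g a0)).resolve_left ha0
    have : (bad g ×ˢ (Finset.univ : Finset (S → Bool))).card ≤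
        (Finset.univ : Finset (Fin t → E ⊕ S → Bool)).card := by
      refine Finset.card_le_card_of_injOn
        (fun q => Function.update q.1 a0 (Sum.elim (fun i => q.1 a0 (Sum.inl i))
          (fun j => zb (bz (q.1 a0 (Sum.inr j)) + bz (q.2 j))))) (fun _ _ => Finset.mem_coe.2 (Finset.mem_univ _)) ?_
      rintro ⟨Y, v⟩ hY ⟨Y', v'⟩ hY' heq
      simp only [Finset.coe_product, Set.mem_prod, Finset.mem_coe, bad, Finset.mem_filter,
        Finset.mem_univ, true_and] at hY hY' heq
      have hoff : ∀ a, a ≠ a0 → Y a = Y' a := by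
        intro a ha
        have := congrFun heq a
        simpa [Function.update_of_ne ha] using this
      have hon := congrFun heq a0
      simp only [Function.update_self] at hon
      have hl : ∀ i, Y a0 (Sum.inl i) = Y' a0 (Sum.inl i) := fun i => congrFun hon (Sum.inl i)
      have hr : ∀ j, bz (Y a0 (Sum.inr j)) + bz (v j) = bz (Y' a0 (Sum.inr j)) + bz (v' j) := by
        intro j
        have := congrFun hon (Sum.inr j)
        simp only [Sum.elim_inr] at this
        rw [← bz_zb (bz (Y a0 (Sum.inr j)) + bz (v j)), this, bz_zb]
      have hr2 : ∀ j, bz (Y a0 (Sum.inr j)) = bz (Y' a0 (Sum.inr j)) := by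
        intro j
        have e1 := congrFun hY.1.2 j
        have e2 := congrFun hY'.1.2 j
        simp only [Finset.sum_apply, Pi.smul_apply, smul_eq_mul, Pi.zero_apply] at e1 e2
        rw [← Finset.add_sum_erase _ _ (Finset.mem_univ a0)] at e1 e2
        rw [ha1, one_mul] at e1 e2
        have e3 : ∑ x ∈ Finset.univ.erase a0, g x * bz (Y x (Sum.inr j)) =
            ∑ x ∈ Finset.univ.erase a0, g x * bz (Y' x (Sum.inr j)) :=
          Finset.sum_congr rfl fun a ha => by rw [hoff a (Finset.ne_of_mem_erase ha)]
        rw [e3] at e1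
        exact add_right_cancel (e1.trans e2.symm)
      have hYY : Y = Y' := by
        funext a
        by_cases ha : a = a0
        · subst ha
          funext j
          cases j with
          | inl i => exact hl i
          | inr j => exact bz_inj (hr2 j)
        · exact hoff a ha
      have hvv : v = v' := by
        funext j
        have := hr j
        rw [hr2 j] at this
        exact bz_inj (add_left_cancel this)
      rw [hYY, hvv]
    rw [Finset.card_product] at this
    simpa using this
  calc _ ≤ (Finset.univ.biUnion bad).card * 2 ^ Fintype.card S :=
        Nat.mul_le_mul_right _ (Finset.card_le_card hsub)
    _ ≤ (∑ g, (bad g).card) * 2 ^ Fintype.card S := Nat.mul_le_mul_right _ Finset.card_biUnion_le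
    _ = ∑ g, (bad g).card * 2 ^ Fintype.card S := by rw [Finset.sum_mul]
    _ ≤ ∑ g : Fin t → ZMod 2, (2 ^ Fintype.card (E ⊕ S)) ^ t := Finset.sum_le_sum fun g _ => hb g
    _ = _ := by simp

end

end
end PS
end

section
set_option linter.unusedSectionVars false
open scoped ComplexOrder Matrix
/-! ### A reversible sorting network -/
namespace PS
noncomputable section

/-- comparison of the first `k` bits, most significant bit last -/
def cmp {m : ℕ} (y z : Fin m → Bool) : ℕ → Bool
  | 0 => false
  | (k + 1) => if h : k < m then (if y ⟨k, h⟩ ≠ z ⟨k, h⟩ then y ⟨k, h⟩ else cmp y z k) else cmp y z k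

/-- binary value of the first `k` bits -/
def bval {m : ℕ} (y : Fin m → Bool) : ℕ → ℕ
  | 0 => 0
  | (k + 1) => if h : k < m then (if y ⟨k, h⟩ then 2 ^ k else 0) + bval y k else bval y k

theorem bval_lt {m : ℕ} (y : Fin m → Bool) (k : ℕ) : bval y k < 2 ^ k := by
  induction k with
  | zero => simp [bval]
  | succ k ih =>
    rw [bval, pow_succ]
    split_ifs <;> omega

theorem cmp_iff {m : ℕ} (y z : Fin m → Bool) (k : ℕ) : cmp y z k = true ↔ bval z k < bval y k := by
  induction k with
  | zero => simp [cmp, bval]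
  | succ k ih =>
    have h1 := bval_lt y k
    have h2 := bval_lt z k
    rw [cmp, bval, bval]
    split_ifs with h h3 h4 h5 h5 <;> simp_all
    · omega
    · omega

theorem bval_inj {m : ℕ} (y z : Fin m → Bool) (h : bval y m = bval z m) : y = z := by
  have key : ∀ k, bval y k = bval z k → ∀ q (hq : q < m), q < k → y ⟨q, hq⟩ = z ⟨q, hq⟩ := by
    intro k
    induction k with
    | zero => intro _ q _ h; omega
    | succ k ih =>
      intro hk q hq hqk
      have h1 := bval_lt y k
      have h2 := bval_lt z k
      rw [bval, bval] at hk
      by_cases hkm : k < m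
      · simp only [hkm, dif_pos] at hk
        have h3 : y ⟨k, hkm⟩ = z ⟨k, hkm⟩ ∧ bval y k = bval z k := by
          cases e1 : y ⟨k, hkm⟩ <;> cases e2 : z ⟨k, hkm⟩ <;> simp [e1, e2] at hk ⊢ <;> omega
        rcases Nat.lt_succ_iff_lt_or_eq.1 hqk with h4 | h4
        · exact ih h3.2 q hq h4
        · subst h4; exact h3.1
      · simp only [hkm, dif_neg, not_false_eq_true] at hk
        exact ih hk q hq (by omega)
  funext q
  exact key m h q q.2 q.2

section
variable (t n m : ℕ)

/-- the wires outside of the `t` blocks -/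
abbrev RW := (Fin t × Fin m) ⊕ (((Fin t × Fin t) × Fin (m + 1)) ⊕ Fin 2)
/-- all wires of the simulator -/
abbrev SW := (Fin t × (Fin n ⊕ Fin m)) ⊕ RW t m
end

section
variable {t n m : ℕ}

/-- contents of the wires -/
def pack (A : Fin t → Fin n → Bool) (Y C : Fin t → Fin m → Bool)
    (R : Fin t × Fin t → Fin (m + 1) → Bool) (J : Fin 2 → Bool) : SW t n m → Bool :=
  Sum.elim (fun q => Sum.elim (A q.1) (Y q.1) q.2)
    (Sum.elim (fun q => C q.1 q.2) (Sum.elim (fun q => R q.1 q.2) J))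

theorem exists_pack (x : SW t n m → Bool) : ∃ A Y C R J, x = pack A Y C R J := by
  refine ⟨fun a i => x (Sum.inl (a, Sum.inl i)), fun a i => x (Sum.inl (a, Sum.inr i)),
    fun a i => x (Sum.inr (Sum.inl (a, i))), fun p i => x (Sum.inr (Sum.inr (Sum.inl (p, i)))),
    fun i => x (Sum.inr (Sum.inr (Sum.inr i))), ?_⟩
  funext w
  rcases w with ⟨a, (i | i)⟩ | ⟨a, i⟩ | ⟨p, i⟩ | i <;> rfl

theorem pack_inj {A A' : Fin t → Fin n → Bool} {Y C Y' C' : Fin t → Fin m → Bool} {R J R' J'}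
    (h : pack A Y C R J = pack A' Y' C' R' J') : A = A' ∧ Y = Y' ∧ C = C' ∧ R = R' ∧ J = J' := by
  refine ⟨?_, ?_, ?_, ?_, ?_⟩
  · funext a i; exact congrFun h (Sum.inl (a, Sum.inl i))
  · funext a i; exact congrFun h (Sum.inl (a, Sum.inr i))
  · funext a i; exact congrFun h (Sum.inr (Sum.inl (a, i)))
  · funext a i; exact congrFun h (Sum.inr (Sum.inr (Sum.inl (a, i))))
  · funext i; exact congrFun h (Sum.inr (Sum.inr (Sum.inr i)))

/-- label wire -/
abbrev lab (a : Fin t) (q : Fin m) : SW t n m := Sum.inl (a, Sum.inr q)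
/-- work wire -/
abbrev wrk (p : Fin t × Fin t) (q : Fin (m + 1)) : SW t n m := Sum.inr (Sum.inr (Sum.inl (p, q)))

/-- one comparison gate -/
def cgate (p : Fin t × Fin t) (q : Fin m) : Equiv.Perm (SW t n m → Bool) :=
  xorP {wrk p q.succ}
    (fun x w => if w = wrk p q.succ then
      bz (if x (lab p.1 q) ≠ x (lab p.2 q) then x (lab p.1 q) else x (wrk p q.castSucc)) else 0)
    (fun x w hw => if_neg (fun hh : w = wrk p q.succ => hw hh))
    (fun x y h => by
      funext w
      rw [h (lab p.1 q) (by simp), h (lab p.2 q) (by simp),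
        h (wrk p q.castSucc) (by simp [Fin.ext_iff])])

theorem cgate_UC (p : Fin t × Fin t) (q : Fin m) : UC (pm (cgate (n := n) p q)) KC := by
  refine xorP_single_UC _ _ _ _ (wrk p q.succ) {lab p.1 q, lab p.2 q, wrk p q.castSucc} ?_ ?_ ?_ ?_ ?_
  · intro x w hw; exact if_neg hw
  · simp [Fin.ext_iff]
  · intro x y h
    simp only [if_pos]
    rw [h (lab p.1 q) (by simp), h (lab p.2 q) (by simp), h (wrk p q.castSucc) (by simp)]
  · exact Finset.card_pos.2 ⟨_, Finset.mem_insert_self _ _⟩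
  · exact Finset.card_le_three.trans (by norm_num)

/-- work row after `k` comparison gates -/
def crow (y z : Fin m → Bool) (k : ℕ) : Fin (m + 1) → Bool :=
  fun u => if (u : ℕ) ≤ k then cmp y z u else false

theorem crow_zero (y z : Fin m → Bool) : crow y z 0 = fun _ => false := by
  funext u
  unfold crow
  split_ifs with h
  · have : (u : ℕ) = 0 := by omega
    rw [this]; rfl
  · rfl

theorem cgate_pack (A : Fin t → Fin n → Bool) (Y C : Fin t → Fin m → Bool) (R J) (p : Fin t × Fin t) (q : Fin m) :
    cgate p q (pack A Y C (Function.update R p (crow (Y p.1) (Y p.2) q)) J) =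
      pack A Y C (Function.update R p (crow (Y p.1) (Y p.2) (q + 1))) J := by
  funext w
  rw [cgate, xorP_apply]
  by_cases hw : w = wrk p q.succ
  · rw [if_pos hw, hw]
    simp only [pack, Sum.elim_inl, Sum.elim_inr, Function.update_self, crow]
    simp [cmp, bz_zb]
    rw [show bz false = 0 from rfl, zero_add, zb_bz]
  · rw [if_neg hw, add_zero, zb_bz]
    rcases w with ⟨a, (i | i)⟩ | ⟨a, i⟩ | ⟨p', i⟩ | i <;> try rfl
    simp only [pack, Sum.elim_inl, Sum.elim_inr]
    by_cases hp : p' = p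
    · subst hp
      simp only [Function.update_self, crow]
      have : (i : ℕ) ≠ q + 1 := fun hh => hw (by
        have : i = q.succ := Fin.ext hh
        rw [this])
      have h2 : ((i : ℕ) ≤ q) ↔ ((i : ℕ) ≤ q + 1) := by omega
      simp only [h2]
    · rw [Function.update_of_ne hp, Function.update_of_ne hp]

/-- chain of comparison gates -/
def chain (p : Fin t × Fin t) : ℕ → Equiv.Perm (SW t n m → Bool)
  | 0 => 1
  | (k + 1) => if h : k < m then cgate p ⟨k, h⟩ * chain p k else chain p k

theorem chain_UC (p : Fin t × Fin t) (k : ℕ) : UC (pm (chain (n := n) (m := m) p k)) (k * KC) := by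
  induction k with
  | zero => rw [chain, pm_one]; simpa using (UC.one : UC (1 : Mx (SW t n m)) 0)
  | succ k ih =>
    rw [chain]
    split_ifs with h
    · rw [← pm_mul]
      refine UC.mono (UC.mul (cgate_UC _ _) ih) (by ring_nf; omega)
    · exact UC.mono ih (by ring_nf; omega)

theorem chain_pack (A : Fin t → Fin n → Bool) (Y C : Fin t → Fin m → Bool) (R J) (p : Fin t × Fin t)
    (hR : R p = fun _ => false) (k : ℕ) (hk : k ≤ m) :
    chain p k (pack A Y C R J) =
      pack A Y C (Function.update R p (crow (Y p.1) (Y p.2) k)) J := by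
  induction k with
  | zero =>
    rw [chain, crow_zero, ← hR, Function.update_eq_self]; rfl
  | succ k ih =>
    rw [chain, dif_pos (show k < m by omega), Equiv.Perm.mul_apply, ih (by omega)]
    exact cgate_pack A Y C R J p ⟨k, by omega⟩

/-- controlled swap of the wires `U` of two blocks -/
def bswap (p : Fin t × Fin t) (U : Finset (Fin n ⊕ Fin m)) : Equiv.Perm (SW t n m → Bool) where
  toFun x := Sum.elim (fun w => if w.2 ∈ U ∧ x (wrk p (Fin.last m)) = true then
    x (Sum.inl (Equiv.swap p.1 p.2 w.1, w.2)) else x (Sum.inl w)) (fun w => x (Sum.inr w))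
  invFun x := Sum.elim (fun w => if w.2 ∈ U ∧ x (wrk p (Fin.last m)) = true then
    x (Sum.inl (Equiv.swap p.1 p.2 w.1, w.2)) else x (Sum.inl w)) (fun w => x (Sum.inr w))
  left_inv x := by
    funext w
    rcases w with ⟨a, u⟩ | w
    · simp only [Sum.elim_inl, Sum.elim_inr, Equiv.swap_apply_self]
      split_ifs <;> rfl
    · rfl
  right_inv x := by
    funext w
    rcases w with ⟨a, u⟩ | w
    · simp only [Sum.elim_inl, Sum.elim_inr, Equiv.swap_apply_self]
      split_ifs <;> rfl
    · rfl

theorem bswap_UC (p : Fin t × Fin t) (U : Finset (Fin n ⊕ Fin m)) :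
    UC (pm (bswap p U)) (U.card * KC) := by
  induction U using Finset.induction_on with
  | empty =>
    have : bswap p (∅ : Finset (Fin n ⊕ Fin m)) = 1 := by
      ext x w
      rcases w with ⟨a, u⟩ | w <;> simp [bswap]
    rw [this, pm_one]
    simpa using (UC.one : UC (1 : Mx (SW t n m)) 0)
  | insert u U hu ih =>
    have : bswap p (insert u U) = cswap (wrk p (Fin.last m)) (Sum.inl (p.1, u)) (Sum.inl (p.2, u))
        (by simp) (by simp) * bswap p U := by
      refine Equiv.ext fun x => funext fun w => ?_
      rw [Equiv.Perm.mul_apply, cswap_apply]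
      have hc : bswap p U x (wrk p (Fin.last m)) = x (wrk p (Fin.last m)) := rfl
      rw [hc]
      by_cases hx : x (wrk p (Fin.last m)) = true
      · rw [if_pos hx]
        rcases w with ⟨a, v⟩ | w
        · simp only [bswap, Equiv.coe_fn_mk, hx, Sum.elim_inl, and_true, Function.comp_apply]
          by_cases hv : v = u
          · subst hv
            have : Equiv.swap (Sum.inl (p.1, v) : SW t n m) (Sum.inl (p.2, v)) (Sum.inl (a, v)) =
                Sum.inl (Equiv.swap p.1 p.2 a, v) := by
              simp only [Equiv.swap_apply_def, Sum.inl.injEq, Prod.mk.injEq, and_true]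
              split_ifs <;> rfl
            rw [this]
            simp [hu]
          · have : Equiv.swap (Sum.inl (p.1, u) : SW t n m) (Sum.inl (p.2, u)) (Sum.inl (a, v)) =
                Sum.inl (a, v) := by
              apply Equiv.swap_apply_of_ne_of_ne <;> simp [hv]
            rw [this]
            simp [hv]
        · have : Equiv.swap (Sum.inl (p.1, u) : SW t n m) (Sum.inl (p.2, u)) (Sum.inr w) =
                Sum.inr w := by
              apply Equiv.swap_apply_of_ne_of_ne <;> simp
          simp only [bswap, Equiv.coe_fn_mk, Sum.elim_inr, Function.comp_apply, this]
      · rw [if_neg hx]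
        rcases w with ⟨a, v⟩ | w
        · simp [bswap, hx]
        · rfl
    rw [this, ← pm_mul, Finset.card_insert_of_notMem hu]
    exact UC.mono (UC.mul (cswap_UC _ _ _ _ _) ih) (by ring_nf; omega)

/-- the swap performed by a comparator -/
def csw (p : Fin t × Fin t) (Y : Fin t → Fin m → Bool) : Equiv.Perm (Fin t) :=
  if p.1 < p.2 ∧ cmp (Y p.1) (Y p.2) m = true then Equiv.swap p.1 p.2 else 1

/-- the work rows after a comparator -/
def rup (p : Fin t × Fin t) (Y : Fin t → Fin m → Bool) (R : Fin t × Fin t → Fin (m + 1) → Bool) :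
    Fin t × Fin t → Fin (m + 1) → Bool :=
  if p.1 < p.2 then Function.update R p (crow (Y p.1) (Y p.2) m) else R

/-- a comparator -/
def cstep (U : Finset (Fin n ⊕ Fin m)) (p : Fin t × Fin t) : Equiv.Perm (SW t n m → Bool) :=
  if p.1 < p.2 then bswap p U * chain p m else 1

theorem cstep_UC (U : Finset (Fin n ⊕ Fin m)) (p : Fin t × Fin t) :
    UC (pm (cstep U p)) ((U.card + m) * KC) := by
  unfold cstep
  split_ifs
  · rw [← pm_mul, add_mul]
    exact UC.mul (bswap_UC p U) (chain_UC p m)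
  · rw [pm_one]; exact UC.mono UC.one (by omega)

/-- only labels -/
def Ulab : Finset (Fin n ⊕ Fin m) := Finset.univ.filter fun u => u.isRight = true

theorem cstep_lab (A : Fin t → Fin n → Bool) (Y C : Fin t → Fin m → Bool) (R J) (p : Fin t × Fin t)
    (hR : R p = fun _ => false) :
    cstep Ulab p (pack A Y C R J) = pack A (Y ∘ csw p Y) C (rup p Y R) J := by
  unfold cstep csw rup
  by_cases hp : p.1 < p.2
  · simp only [hp, if_true, true_and, Equiv.Perm.mul_apply]
    rw [chain_pack A Y C R J p hR m le_rfl]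
    have hl : pack A Y C (Function.update R p (crow (Y p.1) (Y p.2) m)) J (wrk p (Fin.last m)) =
        cmp (Y p.1) (Y p.2) m := by
      simp [pack, crow]
    funext w
    rcases w with ⟨a, (i | i)⟩ | w
    · simp [bswap, Ulab, pack]
    · simp only [bswap, Equiv.coe_fn_mk, Sum.elim_inl, hl]
      split_ifs <;> simp_all [pack, Ulab]
    · rfl
  · simp [hp]

theorem cstep_all (A : Fin t → Fin n → Bool) (Y C : Fin t → Fin m → Bool) (R J) (p : Fin t × Fin t)
    (hR : R p = fun _ => false) :
    cstep Finset.univ p (pack A Y C R J) = pack (A ∘ csw p Y) (Y ∘ csw p Y) C (rup p Y R) J := by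
  unfold cstep csw rup
  by_cases hp : p.1 < p.2
  · simp only [hp, if_true, true_and, Equiv.Perm.mul_apply]
    rw [chain_pack A Y C R J p hR m le_rfl]
    have hl : pack A Y C (Function.update R p (crow (Y p.1) (Y p.2) m)) J (wrk p (Fin.last m)) =
        cmp (Y p.1) (Y p.2) m := by
      simp [pack, crow]
    funext w
    rcases w with ⟨a, (i | i)⟩ | w
    · simp only [bswap, Equiv.coe_fn_mk, Sum.elim_inl, hl]
      split_ifs <;> simp_all [pack]
    · simp only [bswap, Equiv.coe_fn_mk, Sum.elim_inl, hl]
      split_ifs <;> simp_all [pack]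
    · rfl
  · simp [hp]

/-- the sorting network -/
def net (U : Finset (Fin n ⊕ Fin m)) : ℕ → Equiv.Perm (SW t n m → Bool)
  | 0 => 1
  | (s + 1) => if h : s < t * t then cstep U (finProdFinEquiv.symm ⟨s, h⟩) * net U s else net U s

/-- the permutation of the blocks performed by the network -/
def npi (Y : Fin t → Fin m → Bool) : ℕ → Equiv.Perm (Fin t)
  | 0 => 1
  | (s + 1) => if h : s < t * t then npi Y s * csw (finProdFinEquiv.symm ⟨s, h⟩) (Y ∘ npi Y s)
      else npi Y s

/-- the work rows after the network -/
def nrow (Y : Fin t → Fin m → Bool) : ℕ → Fin t × Fin t → Fin (m + 1) → Bool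
  | 0 => fun _ _ => false
  | (s + 1) => if h : s < t * t then rup (finProdFinEquiv.symm ⟨s, h⟩) (Y ∘ npi Y s) (nrow Y s)
      else nrow Y s

theorem net_UC (U : Finset (Fin n ⊕ Fin m)) (s : ℕ) :
    UC (pm (net (t := t) U s)) (s * ((U.card + m) * KC)) := by
  induction s with
  | zero => rw [net, pm_one]; simpa using (UC.one : UC (1 : Mx (SW t n m)) 0)
  | succ s ih =>
    rw [net]
    split_ifs with h
    · rw [← pm_mul]
      refine UC.mono (UC.mul (cstep_UC _ _) ih) (by ring_nf; omega)
    · exact UC.mono ih (by ring_nf; omega)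

theorem nrow_zero (Y : Fin t → Fin m → Bool) (s : ℕ) (p : Fin t × Fin t)
    (hp : s ≤ (finProdFinEquiv p : ℕ)) : nrow Y s p = fun _ => false := by
  induction s with
  | zero => rfl
  | succ s ih =>
    rw [nrow]
    split_ifs with h
    · unfold rup
      split_ifs
      · rw [Function.update_of_ne, ih (by omega)]
        rintro rfl
        rw [Equiv.apply_symm_apply] at hp
        exact absurd hp (by simp)
      · exact ih (by omega)
    · exact ih (by omega)

theorem net_lab (A : Fin t → Fin n → Bool) (Y C : Fin t → Fin m → Bool) (J) (s : ℕ) :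
    net Ulab s (pack A Y C (fun _ _ => false) J) = pack A (Y ∘ npi Y s) C (nrow Y s) J := by
  induction s with
  | zero => rfl
  | succ s ih =>
    rw [net, npi, nrow]
    split_ifs with h
    · rw [Equiv.Perm.mul_apply, ih, cstep_lab _ _ _ _ _ _ (nrow_zero _ _ _ (by rw [Equiv.apply_symm_apply]))]
      rfl
    · exact ih

theorem net_all (A : Fin t → Fin n → Bool) (Y C : Fin t → Fin m → Bool) (J) (s : ℕ) :
    net Finset.univ s (pack A Y C (fun _ _ => false) J) =
      pack (A ∘ npi Y s) (Y ∘ npi Y s) C (nrow Y s) J := by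
  induction s with
  | zero => rfl
  | succ s ih =>
    rw [net, npi, nrow]
    split_ifs with h
    · rw [Equiv.Perm.mul_apply, ih, cstep_all _ _ _ _ _ _ (nrow_zero _ _ _ (by rw [Equiv.apply_symm_apply]))]
      rfl
    · exact ih

theorem npi_sorted (Y : Fin t → Fin m → Bool) (s : ℕ) (hs : s ≤ t * t) :
    ∀ i j : Fin t, i < j → (finProdFinEquiv (i, j) : ℕ) < s →
      bval ((Y ∘ npi Y s) i) m ≤ bval ((Y ∘ npi Y s) j) m := by
  induction s with
  | zero => intro i j _ h; omega
  | succ s ih =>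
    have ih := ih (by omega)
    intro i' j' hij' henc'
    have hst : s < t * t := by omega
    obtain ⟨⟨i, j⟩, hp⟩ : ∃ p : Fin t × Fin t, p = finProdFinEquiv.symm ⟨s, hst⟩ := ⟨_, rfl⟩
    have henc : (finProdFinEquiv (i, j) : ℕ) = s := by rw [hp, Equiv.apply_symm_apply]
    have e1 : Y ∘ npi Y (s + 1) = (Y ∘ npi Y s) ∘ csw (i, j) (Y ∘ npi Y s) := by
      rw [npi, dif_pos hst, ← hp]; rfl
    rw [e1]
    generalize Y ∘ npi Y s = Z at ih ⊢
    simp only [finProdFinEquiv_apply_val] at henc henc' ih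
    have hi := i.2; have hj := j.2; have hi' := i'.2; have hj' := j'.2
    have lt1 : i' < i → ∀ k : Fin t, i' < k → bval (Z i') m ≤ bval (Z k) m := by
      intro h1 k hk
      refine ih i' k hk ?_
      have h2 : (i' : ℕ) + 1 ≤ i := h1
      have h3 := Nat.mul_le_mul_left t h2
      have := k.2
      rw [mul_add, mul_one] at h3
      omega
    have le2 : i' ≤ i := by
      by_contra hcon
      have h2 : (i : ℕ) + 1 ≤ i' := by
        have := Fin.lt_def.1 (not_le.1 hcon); omega
      have h3 := Nat.mul_le_mul_left t h2
      rw [mul_add, mul_one] at h3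
      omega
    have hcmp := cmp_iff (Z i) (Z j) m
    unfold csw
    simp only
    rcases lt_or_eq_of_le le2 with hlt | heq
    · have h3 := lt1 hlt
      split_ifs with hc
      · have e2 : Equiv.swap i j i' = i' :=
          Equiv.swap_apply_of_ne_of_ne (ne_of_lt hlt) (ne_of_lt (hlt.trans hc.1))
        rw [Function.comp_apply, Function.comp_apply, e2]
        apply h3
        rw [Equiv.swap_apply_def]
        split_ifs
        · exact hlt.trans hc.1
        · exact hlt
        · exact hij'
      · exact h3 j' hij'
    · subst heq
      have hle : (j' : ℕ) ≤ j := by omega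
      have hij : i' < j := lt_of_lt_of_le hij' hle
      simp only [hij, true_and]
      rcases Nat.lt_or_eq_of_le hle with h4 | h4
      · have h5 := ih i' j' hij' (by omega)
        split_ifs with hc
        · have e2 : Equiv.swap i' j j' = j' :=
            Equiv.swap_apply_of_ne_of_ne (ne_of_gt hij') (Fin.ne_of_lt h4)
          rw [Function.comp_apply, Function.comp_apply, e2, Equiv.swap_apply_left]
          have := hcmp.1 hc
          omega
        · exact h5
      · have : j' = j := Fin.ext h4
        subst this
        split_ifs with hc
        · rw [Function.comp_apply, Function.comp_apply, Equiv.swap_apply_left, Equiv.swap_apply_right]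
          exact (hcmp.1 hc).le
        · rw [hcmp] at hc
          simpa using hc

/-- the sorting permutation -/
def spi (Y : Fin t → Fin m → Bool) : Equiv.Perm (Fin t) := npi Y (t * t)

theorem spi_mono (Y : Fin t → Fin m → Bool) : Monotone (fun a => bval ((Y ∘ spi Y) a) m) := by
  intro i j hij
  rcases eq_or_lt_of_le hij with h | h
  · rw [h]
  · exact npi_sorted Y (t * t) le_rfl i j h (finProdFinEquiv (i, j)).2

theorem spi_comp (Y : Fin t → Fin m → Bool) (π : Equiv.Perm (Fin t)) :
    (Y ∘ π) ∘ spi (Y ∘ π) = Y ∘ spi Y := by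
  have h := Tuple.unique_monotone (f := fun a => bval (Y a) m) (σ := π * spi (Y ∘ π)) (τ := spi Y)
    (spi_mono (Y ∘ π)) (spi_mono Y)
  funext a
  exact bval_inj _ _ (congrFun h a)

/-- copying the labels -/
def copyP : Equiv.Perm (SW t n m → Bool) :=
  xorP (Set.range fun q : Fin t × Fin m => (Sum.inr (Sum.inl q) : SW t n m))
    (fun x => Sum.elim (fun _ => 0) (Sum.elim (fun q => bz (x (lab q.1 q.2))) (fun _ => 0)))
    (fun x w hw => by
      rcases w with w | q | w
      · rfl
      · exact absurd ⟨q, rfl⟩ hw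
      · rfl)
    (fun x y h => by
      funext w
      rcases w with w | q | w
      · rfl
      · simp only [Sum.elim_inr, Sum.elim_inl]
        rw [h (lab q.1 q.2) (by simp)]
      · rfl)

theorem copyP_UC : UC (pm (copyP (t := t) (n := n) (m := m))) ((t * m) * KC) := by
  have := xorP_sum_UC (Finset.univ : Finset (Fin t × Fin m))
    (Set.range fun q : Fin t × Fin m => (Sum.inr (Sum.inl q) : SW t n m))
    (fun q x w => if w = Sum.inr (Sum.inl q) then bz (x (lab q.1 q.2)) else 0)
    (fun q x w hw => if_neg fun h => hw ⟨q, h.symm⟩)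
    (fun q x y h => by
      funext w
      rw [h (lab q.1 q.2) (by simp)]) KC
    (fun q _ => by
      refine xorP_single_UC _ _ _ _ (Sum.inr (Sum.inl q)) {lab q.1 q.2} ?_ ?_ ?_ ?_ ?_
      · intro x w hw; exact if_neg hw
      · simp
      · intro x y h
        simp only [if_pos]
        rw [h (lab q.1 q.2) (by simp)]
      · simp
      · simp)
    (fun x => Sum.elim (fun _ => 0) (Sum.elim (fun q => bz (x (lab q.1 q.2))) (fun _ => 0)))
    (fun x w hw => by
      rcases w with w | q | w
      · rfl
      · exact absurd ⟨q, rfl⟩ hw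
      · rfl)
    (fun x y h => by
      funext w
      rcases w with w | q | w
      · rfl
      · simp only [Sum.elim_inr, Sum.elim_inl]
        rw [h (lab q.1 q.2) (by simp)]
      · rfl)
    (fun x w => by
      rcases w with w | q | w
      · simp
      · simp [Finset.sum_ite_eq]
      · simp)
  simpa [copyP] using this

theorem copyP_pack (A : Fin t → Fin n → Bool) (Y R J) :
    copyP (pack A Y (fun _ _ => false) R J) = pack (m := m) A Y Y R J := by
  funext w
  rw [copyP, xorP_apply]
  rcases w with ⟨a, (i | i)⟩ | ⟨a, i⟩ | ⟨p, i⟩ | i <;> simp [pack, zb_bz]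
  all_goals simp [bz, zb]

/-- the permutation part of the simulator -/
def simP : Equiv.Perm (SW t n m → Bool) :=
  (net Finset.univ (t * t))⁻¹ * (copyP * net Ulab (t * t))

theorem simP_pack (A : Fin t → Fin n → Bool) (Y J) :
    simP (pack A Y (fun _ _ => false) (fun _ _ => false) J) =
      pack (m := m) (A ∘ (spi Y).symm) Y (Y ∘ spi Y) (fun _ _ => false) J := by
  rw [simP, Equiv.Perm.mul_apply, Equiv.Perm.mul_apply, net_lab, copyP_pack, Equiv.Perm.inv_eq_iff_eq,
    net_all]
  congr 1
  funext a
  simp [spi]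

theorem simP_UC : UC (pm (simP (t := t) (n := n) (m := m)))
    (t * t * ((n + m + m) * KC) + (t * m * KC + t * t * ((n + m + m) * KC))) := by
  rw [simP, ← pm_mul, ← pm_mul]
  refine UC.mul ?_ (UC.mul copyP_UC ?_)
  · have := UC.inv (net_UC (t := t) (Finset.univ : Finset (Fin n ⊕ Fin m)) (t * t))
    rw [pm_conjTranspose] at this
    refine UC.mono this ?_
    simp
  · refine UC.mono (net_UC _ _) ?_
    have : (Ulab : Finset (Fin n ⊕ Fin m)).card ≤ n + m := by
      refine (Finset.card_le_univ _).trans ?_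
      simp
    gcongr
end

end
end PS
end

section
set_option linter.unusedSectionVars false
open scoped ComplexOrder Matrix
/-! ### The simulator -/
set_option synthInstance.maxHeartbeats 400000
set_option synthInstance.maxSize 2000
namespace PS
noncomputable section

section
variable {t n m : ℕ}

/-- payload of the blocks -/
def xA (x : BString (t * (n + m))) : Fin t → Fin n → Bool :=
  fun a i => x (finProdFinEquiv (a, Fin.castAdd m i))
/-- labels of the blocks -/
def xY (x : BString (t * (n + m))) : Fin t → Fin m → Bool :=
  fun a i => x (finProdFinEquiv (a, Fin.natAdd n i))

variable (t n m) in
/-- input wires -/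
def sg1 : Fin (t * n) ⊕ ((Fin t × Fin m) ⊕ RW t m) ≃ SW t n m :=
  (Equiv.sumCongr finProdFinEquiv.symm (Equiv.refl _)).trans ((Equiv.sumAssoc _ _ _).symm.trans
    (Equiv.sumCongr (Equiv.prodSumDistrib _ _ _).symm (Equiv.refl _)))
variable (t n m) in
/-- output wires -/
def sg2 : Fin (t * (n + m)) ⊕ RW t m ≃ SW t n m :=
  Equiv.sumCongr ((finProdFinEquiv.symm).trans
    (Equiv.prodCongr (Equiv.refl _) finSumFinEquiv.symm)) (Equiv.refl _)

theorem sg1_elim (p : BString (t * n)) :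
    (Sum.elim p (fun _ => false)) ∘ (sg1 t n m).symm =
      pack (fun a i => p (finProdFinEquiv (a, i))) (fun _ _ => false) (fun _ _ => false)
        (fun _ _ => false) (fun _ => false) := by
  funext w
  rcases w with ⟨a, (i | i)⟩ | ⟨a, i⟩ | ⟨p, i⟩ | i <;> rfl

theorem sg2_elim (x : BString (t * (n + m))) (u : RW t m → Bool) :
    (Sum.elim x u) ∘ (sg2 t n m).symm =
      pack (xA x) (xY x) (fun a i => u (Sum.inl (a, i))) (fun p i => u (Sum.inr (Sum.inl (p, i))))
        (fun i => u (Sum.inr (Sum.inr i))) := by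
  funext w
  rcases w with ⟨a, (i | i)⟩ | ⟨a, i⟩ | ⟨p, i⟩ | i <;> rfl

variable (t n m) in
/-- label wires -/
def TL : Finset (SW t n m) := Finset.univ.image fun q : Fin t × Fin m => lab q.1 q.2

theorem TL_card : (TL t n m).card = t * m := by
  rw [TL, Finset.card_image_of_injective]
  · simp
  · rintro ⟨a, b⟩ ⟨c, d⟩ h
    simpa using h

theorem SW_card : 2 ≤ Fintype.card (SW t n m) := by
  simp only [Fintype.card_sum, Fintype.card_fin]; omega

variable (t n m) in
/-- superposition of labels -/
def simH : Mx (SW t n m) := (plus_UC SW_card (TL t n m)).choose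

variable (t n m) in
/-- the simulator unitary -/
def simV : Mx (SW t n m) := pm (simP (t := t) (n := n) (m := m)) * simH t n m

theorem simV_apply (A : Fin t → Fin n → Bool) (Y C : Fin t → Fin m → Bool) (R J) (b) [Decidable (C = Y ∘ spi Y ∧ R = (fun _ _ => false) ∧ J = (fun _ => false) ∧ b = A ∘ spi Y)] :
    simV t n m (pack A Y C R J) (pack b (fun _ _ => false) (fun _ _ => false)
        (fun _ _ => false) (fun _ => false)) =
      if C = Y ∘ spi Y ∧ R = (fun _ _ => false) ∧ J = (fun _ => false) ∧ b = A ∘ spi Y then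
        amp (t * m) else 0 := by
  rw [simV, pm_mul_apply]
  have h := (plus_UC SW_card (TL t n m)).choose_spec.2 (simP.symm (pack A Y C R J))
    (pack b (fun _ _ => false) (fun _ _ => false) (fun _ _ => false) (fun _ => false)) (by
      intro w hw
      simp only [TL, Finset.mem_image] at hw
      obtain ⟨q, _, rfl⟩ := hw
      rfl)
  refine h.trans ?_
  rw [TL_card]
  refine if_congr ?_ rfl rfl
  constructor
  · intro h
    obtain ⟨A0, Y0, C0, R0, J0, hz⟩ := exists_pack (simP.symm (pack A Y C R J))
    rw [hz] at h
    have hA : A0 = b := by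
      funext a i; exact h (Sum.inl (a, Sum.inl i)) (by simp [TL])
    have hC : C0 = fun _ _ => false := by
      funext a i; exact h (Sum.inr (Sum.inl (a, i))) (by simp [TL])
    have hR : R0 = fun _ _ => false := by
      funext a i; exact h (Sum.inr (Sum.inr (Sum.inl (a, i)))) (by simp [TL])
    have hJ : J0 = fun _ => false := by
      funext i; exact h (Sum.inr (Sum.inr (Sum.inr i))) (by simp [TL])
    subst hA hC hR hJ
    rw [Equiv.symm_apply_eq, simP_pack] at hz
    obtain ⟨h1, h2, h3, h4, h5⟩ := pack_inj hz
    subst h2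
    refine ⟨h3, h4, h5, ?_⟩
    rw [h1]
    funext a
    simp
  · rintro ⟨rfl, rfl, rfl, rfl⟩
    have : simP.symm (pack A Y (Y ∘ spi Y) (fun _ _ => false) (fun _ => false)) =
        pack (A ∘ spi Y) Y (fun _ _ => false) (fun _ _ => false) (fun _ => false) := by
      rw [Equiv.symm_apply_eq, simP_pack]
      congr 1
      funext a
      simp
    rw [this]
    intro w hw
    rcases w with ⟨a, (i | i)⟩ | ⟨a, i⟩ | ⟨p, i⟩ | i <;> try rfl
    exact absurd (Finset.mem_image.2 ⟨(a, i), Finset.mem_univ _, rfl⟩) hw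

variable (t n m) in
/-- the simulator -/
def Sim : QOp (t * n) → QOp (t * (n + m)) := dil (simV t n m) (sg1 t n m) (sg2 t n m)

variable (t n m) in
theorem Sim_gates : GB (Sim t n m)
    (3 * ((t * t * ((n + m + m) * KC) + (t * m * KC + t * t * ((n + m + m) * KC))) + t * m) +
      (t * m + (t * m + (t * t * (m + 1) + 2))) + (t * m + (t * t * (m + 1) + 2)) + 1) := by
  have h := (plus_UC SW_card (TL t n m)).choose_spec.1
  replace h := UC.mono h TL_card.le
  have := dil_gates (UC.mul (simP_UC (t := t) (n := n) (m := m)) h) (sg1 t n m) (sg2 t n m)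
  refine GB.mono this ?_
  simp

theorem Sim_apply (ρ : QOp (t * n)) (x y : BString (t * (n + m))) :
    Sim t n m ρ x y = if xY x ∘ spi (xY x) = xY y ∘ spi (xY y) then
      ((2 : ℂ) ^ (t * m))⁻¹ * ρ (bflat (xA x ∘ spi (xY x))) (bflat (xA y ∘ spi (xY y))) else 0 := by
  have hV : ∀ (x : BString (t * (n + m))) (u : RW t m → Bool) (p : BString (t * n)),
      simV t n m (Sum.elim x u ∘ (sg2 t n m).symm) (Sum.elim p (fun _ => false) ∘ (sg1 t n m).symm) =
      if u = Sum.elim (fun q => (xY x ∘ spi (xY x)) q.1 q.2) (fun _ => false) then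
        (if p = bflat (xA x ∘ spi (xY x)) then amp (t * m) else 0) else 0 := by
    intro x u p
    rw [sg1_elim, sg2_elim]
    classical
    rw [simV_apply, ← ite_and]
    refine if_congr ?_ rfl rfl
    constructor
    · rintro ⟨h1, h2, h3, h4⟩
      constructor
      · funext w
        rcases w with ⟨a, i⟩ | ⟨p, i⟩ | i
        · exact congrFun (congrFun h1 a) i
        · exact congrFun (congrFun h2 p) i
        · exact congrFun h3 i
      · funext j
        obtain ⟨⟨a, i⟩, rfl⟩ := finProdFinEquiv.surjective j
        refine (congrFun (congrFun h4 a) i).trans ?_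
        simp only [bflat, Equiv.symm_apply_apply]
    · rintro ⟨rfl, rfl⟩
      refine ⟨rfl, rfl, rfl, ?_⟩
      funext a i
      simp only [bflat, Equiv.symm_apply_apply]
  simp only [Sim, dil, Matrix.of_apply]
  simp only [hV]
  have hue : (fun q : Fin t × Fin m => (xY x ∘ spi (xY x)) q.1 q.2) = (fun q => (xY y ∘ spi (xY y)) q.1 q.2) ↔
      xY x ∘ spi (xY x) = xY y ∘ spi (xY y) := by
    constructor
    · intro h
      funext a i
      exact congrFun h (a, i)
    · intro h; rw [h]
  rw [Finset.sum_eq_single_of_mem (Sum.elim (fun q => (xY x ∘ spi (xY x)) q.1 q.2) (fun _ => false)) (Finset.mem_univ _)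
    (fun u _ hu => by simp only [if_neg hu, zero_mul, mul_zero, star_zero, Finset.sum_const_zero])]
  rw [← amp_sq]
  by_cases hxy : xY x ∘ spi (xY x) = xY y ∘ spi (xY y)
  · rw [if_pos hxy]
    simp only [if_true, hxy]
    rw [Finset.sum_eq_single_of_mem (bflat (xA x ∘ spi (xY x))) (Finset.mem_univ _)
        (fun u _ hu => by simp only [if_neg hu, zero_mul, mul_zero, star_zero, Finset.sum_const_zero]),
      Finset.sum_eq_single_of_mem (bflat (xA y ∘ spi (xY y))) (Finset.mem_univ _)
        (fun u _ hu => by simp only [if_neg hu, zero_mul, mul_zero, star_zero, Finset.sum_const_zero])]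
    simp only [if_true]
    ring
  · rw [if_neg hxy]
    have : ¬ (Sum.elim (fun q => (xY x ∘ spi (xY x)) q.1 q.2) (fun _ => false) : RW t m → Bool) =
        Sum.elim (fun q => (xY y ∘ spi (xY y)) q.1 q.2) (fun _ => false) := by
      intro h
      exact hxy (hue.1 (funext fun q => congrFun h (Sum.inl q)))
    simp only [if_neg this]
    simp
end

end
end PS
end

section
set_option linter.unusedSectionVars false
open scoped ComplexOrder Matrix
/-! ### The sampler -/
set_option synthInstance.maxHeartbeats 400000
set_option synthInstance.maxSize 2000
namespace PS
noncomputable section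

section
variable {W α : Type} [Fintype W] [DecidableEq W] [Fintype α] [DecidableEq α]

/-- Xor the values `val a` into the wires `tt a`. -/
def xsum (T : Set W) (tt : α → W) (val : α → (W → Bool) → ZMod 2) (h1 : ∀ a, tt a ∈ T)
    (h2 : ∀ a x y, (∀ w, w ∉ T → x w = y w) → val a x = val a y) : Equiv.Perm (W → Bool) :=
  xorP T (fun x w => ∑ a, if w = tt a then val a x else 0)
    (fun x w hw => Finset.sum_eq_zero fun a _ => if_neg (by rintro rfl; exact hw (h1 a)))
    (fun x y h => funext fun w => Finset.sum_congr rfl fun a _ => by rw [h2 a x y h])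

theorem xsum_apply (T : Set W) (tt : α → W) (val : α → (W → Bool) → ZMod 2) (h1) (h2) (x) (w) :
    xsum T tt val h1 h2 x w = zb (bz (x w) + ∑ a, if w = tt a then val a x else 0) := rfl

theorem xsum_symm (T : Set W) (tt : α → W) (val : α → (W → Bool) → ZMod 2) (h1) (h2) :
    (xsum T tt val h1 h2).symm = xsum T tt val h1 h2 := rfl

theorem xsum_UC (T : Set W) (tt : α → W) (val : α → (W → Bool) → ZMod 2) (h1) (h2)
    (S : α → Finset W) (hS : ∀ a x y, (∀ w ∈ S a, x w = y w) → val a x = val a y)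
    (ht : ∀ a, tt a ∉ S a) (hc1 : ∀ a, 1 ≤ (S a).card) (hc5 : ∀ a, (S a).card ≤ 5) :
    UC (pm (xsum T tt val h1 h2)) (Fintype.card α * KC) := by
  refine xorP_sum_UC Finset.univ T (fun a x w => if w = tt a then val a x else 0) 
    (fun a x w hw => if_neg (by rintro rfl; exact hw (h1 a)))
    (fun a x y h => funext fun w => by rw [h2 a x y h]) KC (fun a _ => ?_) _ _ _ (fun _ _ => rfl)
  refine xorP_single_UC _ _ _ _ (tt a) (S a) (fun x w hw => if_neg hw) (ht a) ?_ (hc1 a) (hc5 a)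
  intro x y h
  simp only [if_true]
  exact hS a x y h
end

section
variable (n : ℕ) (E S : Type)
/-- key wires -/
abbrev KT := ((E ⊕ S) × (E ⊕ S) × (E ⊕ S)) ⊕ (E × S)
/-- all wires of the sampler -/
abbrev WT := ((Fin n ⊕ E) ⊕ S) ⊕ (KT E S ⊕ KT E S)
variable {n E S}

/-- a state of the sampler -/
def wpack (a : Fin n → Bool) (v : E → Bool) (r : S → Bool) (k k' : KT E S → Bool) : WT n E S → Bool :=
  Sum.elim (Sum.elim (Sum.elim a v) r) (Sum.elim k k')

theorem wpack_ext {z : WT n E S → Bool} {a v r k k'} (h1 : ∀ i, z (.inl (.inl (.inl i))) = a i)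
    (h2 : ∀ i, z (.inl (.inl (.inr i))) = v i) (h3 : ∀ i, z (.inl (.inr i)) = r i)
    (h4 : ∀ i, z (.inr (.inl i)) = k i) (h5 : ∀ i, z (.inr (.inr i)) = k' i) :
    z = wpack a v r k k' := by
  funext w
  rcases w with ((i | i) | i) | (i | i)
  · exact h1 i
  · exact h2 i
  · exact h3 i
  · exact h4 i
  · exact h5 i

variable [Fintype E] [DecidableEq E] [Fintype S] [DecidableEq S]

/-- label of a state -/
def ylab (x : WT n E S → Bool) : E ⊕ S → Bool :=
  Sum.elim (fun i => x (.inl (.inl (.inr i)))) (fun j => x (.inl (.inr j)))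

/-- wire of a label bit -/
def ywire : E ⊕ S → WT n E S := Sum.elim (fun i => .inl (.inl (.inr i))) (fun j => .inl (.inr j))

variable (n E S) in
/-- copying the key -/
def gcopy : Equiv.Perm (WT n E S → Bool) :=
  xsum (α := KT E S) (Set.range fun q => Sum.inr (Sum.inr q)) (fun q => Sum.inr (Sum.inr q))
    (fun q x => bz (x (Sum.inr (Sum.inl q)))) (fun q => Set.mem_range_self q)
    (fun q x y h => by rw [h _ (by simp)])

theorem gcopy_UC : UC (pm (gcopy n E S)) (Fintype.card (KT E S) * KC) :=
  xsum_UC _ _ _ _ _ (fun q => {Sum.inr (Sum.inl q)})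
    (fun q x y h => by rw [h _ (by simp)]) (by simp) (by simp) (by simp)

variable (n E S) in
/-- shifting the label -/
def gshift : Equiv.Perm (WT n E S → Bool) :=
  xsum (α := E × S) (Set.range fun q => Sum.inl (Sum.inl (Sum.inr q))) (fun q => Sum.inl (Sum.inl (Sum.inr q.1)))
    (fun q x => bz (x (Sum.inr (Sum.inl (Sum.inr q)))) * bz (x (Sum.inl (Sum.inr q.2))))
    (fun q => Set.mem_range_self q.1)
    (fun q x y h => by rw [h _ (by simp), h _ (by simp)])

theorem gshift_UC : UC (pm (gshift n E S)) (Fintype.card (E × S) * KC) :=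
  xsum_UC _ _ _ _ _ (fun q => {Sum.inr (Sum.inl (Sum.inr q)), Sum.inl (Sum.inr q.2)})
    (fun q x y h => by rw [h _ (by simp), h _ (by simp)]) (by simp) (by intro a; simp)
    (fun a => Finset.card_le_two.trans (by norm_num))

theorem gcopy_apply (x : WT n E S → Bool) (w : WT n E S) : gcopy n E S x w =
    zb (bz (x w) + ∑ q : KT E S, if w = Sum.inr (Sum.inr q) then bz (x (Sum.inr (Sum.inl q))) else 0) := rfl

theorem gcopy_symm : (gcopy n E S).symm = gcopy n E S := rfl
theorem gshift_symm : (gshift n E S).symm = gshift n E S := rfl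

theorem gshift_apply (x : WT n E S → Bool) (w : WT n E S) : gshift n E S x w =
    zb (bz (x w) + ∑ q : E × S, if w = Sum.inl (Sum.inl (Sum.inr q.1)) then
      bz (x (Sum.inr (Sum.inl (Sum.inr q)))) * bz (x (Sum.inl (Sum.inr q.2))) else 0) := rfl

theorem gcopy_pack (a : Fin n → Bool) (v : E → Bool) (r : S → Bool) (k k' : KT E S → Bool) :
    gcopy n E S (wpack a v r k k') = wpack a v r k (fun q => zb (bz (k' q) + bz (k q))) := by
  refine wpack_ext ?_ ?_ ?_ ?_ ?_ <;> intro i <;> rw [gcopy_apply] <;>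
    simp [wpack, zb_bz]

theorem gshift_pack (a : Fin n → Bool) (v : E → Bool) (r : S → Bool) (k k' : KT E S → Bool) :
    gshift n E S (wpack a v r k k') =
      wpack a (shiftB (fun q => k (Sum.inr q)) (Sum.elim v r)) r k k' := by
  refine wpack_ext ?_ ?_ ?_ ?_ ?_ <;> intro i <;> rw [gshift_apply]
  · simp [wpack, zb_bz]
  · simp only [shiftB, wpack, Sum.elim_inl, Sum.elim_inr, Fintype.sum_prod_type]
    congr 2
    rw [Finset.sum_eq_single_of_mem i (Finset.mem_univ _)]
    · simp
    · intro b _ hb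
      simp [hb.symm]
  · simp [wpack, zb_bz]
  · simp [wpack, zb_bz]
  · simp [wpack, zb_bz]

variable (n E S) in
/-- the phase gate -/
def gphase : Mx (WT n E S) := Matrix.diagonal fun x =>
  ∏ p : (E ⊕ S) × (E ⊕ S) × (E ⊕ S), sg (bz (x (Sum.inr (Sum.inl (Sum.inl p)))) *
    (bz (x (ywire p.1)) * bz (x (ywire p.2.1)) * bz (x (ywire p.2.2))))

theorem sg_norm (z : ZMod 2) : ‖sg z‖ = 1 := by
  simp only [sg]; split_ifs <;> simp

theorem ywire_ne (a : E ⊕ S) (p : KT E S) : (ywire a : WT n E S) ≠ Sum.inr (Sum.inl p) := by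
  cases a <;> simp [ywire]

theorem gphase_UC : UC (gphase n E S) (Fintype.card ((E ⊕ S) × (E ⊕ S) × (E ⊕ S)) * KC) := by
  refine UC_diag_prod Finset.univ _ KC fun p _ => ?_
  refine IsLocal.UC (S := {Sum.inr (Sum.inl (Sum.inl p)), ywire p.1, ywire p.2.1, ywire p.2.2})
    (diag_local ?_) ?_ ?_ (diag_unitary fun x => sg_norm _)
  · intro x y h
    rw [h _ (by simp), h (ywire p.1) (by simp), h (ywire p.2.1) (by simp), h (ywire p.2.2) (by simp)]
  · rw [← Finset.card_pair (ywire_ne (n := n) p.1 (Sum.inl p))]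
    refine Finset.card_le_card ?_
    intro w hw
    simp only [Finset.mem_insert, Finset.mem_singleton] at hw ⊢
    tauto
  · exact Finset.card_le_four.trans (by norm_num)

theorem gphase_mul (M : Mx (WT n E S)) (a : Fin n → Bool) (v : E → Bool) (r : S → Bool)
    (k k' : KT E S → Bool) (z) :
    (gphase n E S * M) (wpack a v r k k') z =
      sg (phz (fun p => k (Sum.inl p)) (Sum.elim v r)) * M (wpack a v r k k') z := by
  rw [gphase, Matrix.diagonal_mul, phz, sg_sum]
  congr 1
  refine Finset.prod_congr rfl fun p _ => ?_
  have : ∀ q : E ⊕ S, wpack a v r k k' (ywire q) = Sum.elim v r q := by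
    rintro (q | q) <;> rfl
  rw [this, this, this]
  rfl

variable (n E S) in
/-- superposed wires -/
def TH : Finset (WT n E S) :=
  Finset.univ.image (Sum.elim (fun j => Sum.inl (Sum.inr j)) (fun q => Sum.inr (Sum.inl q)) : S ⊕ KT E S → WT n E S)

theorem TH_card : (TH n E S).card = Fintype.card S + Fintype.card (KT E S) := by
  rw [TH, Finset.card_image_of_injective, Finset.card_univ, Fintype.card_sum]
  rintro (i | i) (j | j) h <;> simp at h ⊢ <;> exact h

theorem embed_apply (V0 : Mx (Fin n ⊕ E)) (a : Fin n → Bool) (v : E → Bool) :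
    emb (Function.Embedding.inl.trans Function.Embedding.inl : (Fin n ⊕ E) ↪ WT n E S) V0
      (wpack a v (fun _ => false) (fun _ => false) (fun _ => false)) (fun _ => false) =
    V0 (Sum.elim a v) (fun _ => false) := by
  simp only [emb, Matrix.of_apply]
  rw [if_pos]
  · rfl
  · intro w hw
    rcases w with ((i | i) | i) | (i | i)
    · exact absurd ⟨Sum.inl i, rfl⟩ hw
    · exact absurd ⟨Sum.inr i, rfl⟩ hw
    · rfl
    · rfl
    · rfl

theorem H_emb (V0 : Mx (Fin n ⊕ E)) (H : Mx (WT n E S))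
    (hH : ∀ x y, (∀ w ∈ TH n E S, y w = false) →
      H x y = if (∀ w, w ∉ TH n E S → x w = y w) then amp (TH n E S).card else 0)
    (a : Fin n → Bool) (v : E → Bool) (r : S → Bool) (k k' : KT E S → Bool) :
    (H * emb (Function.Embedding.inl.trans Function.Embedding.inl : (Fin n ⊕ E) ↪ WT n E S) V0)
      (wpack a v r k k') (fun _ => false) =
    if k' = (fun _ => false) then amp (TH n E S).card * V0 (Sum.elim a v) (fun _ => false) else 0 := by
  classical
  rw [Matrix.mul_apply, Finset.sum_eq_single_of_mem (wpack a v (fun _ => false) (fun _ => false) (fun _ => false)) (Finset.mem_univ _)]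
  · rw [embed_apply, hH, ite_mul, zero_mul]
    · refine if_congr ?_ rfl rfl
      constructor
      · intro h
        funext q
        exact h (Sum.inr (Sum.inr q)) (by simp [TH])
      · rintro rfl w hw
        rcases w with ((i | i) | i) | (i | i)
        · rfl
        · rfl
        · exact absurd (Finset.mem_image.2 ⟨Sum.inl i, Finset.mem_univ _, rfl⟩) hw
        · exact absurd (Finset.mem_image.2 ⟨Sum.inr i, Finset.mem_univ _, rfl⟩) hw
        · rfl
    · intro w hw
      obtain ⟨(q | q), _, rfl⟩ := Finset.mem_image.1 hw <;> rfl
  · intro z _ hz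
    by_contra hne
    have h1 := left_ne_zero_of_mul hne
    have h2 := right_ne_zero_of_mul hne
    have h3 : ∀ w ∉ Set.range (Function.Embedding.inl.trans Function.Embedding.inl : (Fin n ⊕ E) ↪ WT n E S), z w = false := by
      by_contra h
      simp only [emb, Matrix.of_apply] at h2
      rw [if_neg h] at h2
      exact h2 rfl
    rw [hH] at h1
    · have h4 : ∀ w, w ∉ TH n E S → wpack a v r k k' w = z w := by
        by_contra h
        rw [if_neg h] at h1
        exact h1 rfl
      refine hz (wpack_ext ?_ ?_ ?_ ?_ ?_) <;> intro i
      · exact (h4 _ (by simp [TH])).symm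
      · exact (h4 _ (by simp [TH])).symm
      · exact h3 _ (by simp)
      · exact h3 _ (by simp)
      · exact h3 _ (by simp)
    · intro w hw
      refine h3 w ?_
      obtain ⟨(q | q), _, rfl⟩ := Finset.mem_image.1 hw <;> simp

theorem amp_add (a b : ℕ) : amp (a + b) = amp a * amp b := pow_add _ _ _

/-- The sampling unitary. -/
theorem sampler_unitary (hS : 2 ≤ Fintype.card S) (V0 : Mx (Fin n ⊕ E)) (c : ℕ) (hV : UC V0 c) :
    ∃ V : Mx (WT n E S), UC V (c + 3 * (Fintype.card S + Fintype.card (KT E S)) * (KC + 1)) ∧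
      ∀ a y k k', V (wpack a (fun i => y (Sum.inl i)) (fun i => y (Sum.inr i)) k k') (fun _ => false) =
        if k' = k then amp (Fintype.card (KT E S)) *
          phi (S := S) (fun a v => V0 (Sum.elim a v) (fun _ => false)) (fun p => k (Sum.inl p)) (fun p => k (Sum.inr p)) a y
        else 0 := by
  obtain ⟨H, hH1, hH2⟩ := plus_UC (W := WT n E S) (by simp only [Fintype.card_sum] at *; omega) (TH n E S)
  refine ⟨gphase n E S * (pm (gshift n E S) * (pm (gcopy n E S) * (H * emb (Function.Embedding.inl.trans Function.Embedding.inl : (Fin n ⊕ E) ↪ WT n E S) V0))), ?_, ?_⟩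
  · have := UC.mul gphase_UC (UC.mul gshift_UC (UC.mul gcopy_UC (UC.mul hH1
      (UC.emb hV (Function.Embedding.inl.trans Function.Embedding.inl : (Fin n ⊕ E) ↪ WT n E S)))))
    refine UC.mono this ?_
    rw [TH_card]
    have h1 : Fintype.card (KT E S) = Fintype.card ((E ⊕ S) × (E ⊕ S) × (E ⊕ S)) + Fintype.card (E × S) := Fintype.card_sum
    generalize Fintype.card ((E ⊕ S) × (E ⊕ S) × (E ⊕ S)) = A at *
    generalize Fintype.card (E × S) = B at *
    rw [h1]
    generalize Fintype.card S = C at *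
    nlinarith [Nat.zero_le (A * KC), Nat.zero_le (B * KC), Nat.zero_le (C * KC)]
  · intro a y k k'
    rw [gphase_mul, pm_mul_apply, gshift_symm, gshift_pack, pm_mul_apply, gcopy_symm, gcopy_pack, H_emb V0 H hH2, TH_card, amp_add]
    have hy : Sum.elim (fun i => y (Sum.inl i)) (fun i => y (Sum.inr i)) = y := by
      funext i; cases i <;> rfl
    rw [hy]
    have : (fun q => zb (bz (k' q) + bz (k q))) = (fun _ => false) ↔ k' = k := by
      constructor
      · intro h
        funext q
        have := congrFun h q
        revert this
        cases k' q <;> cases k q <;> decide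
      · rintro rfl
        funext q
        rw [z_add_self]; rfl
    by_cases h : k' = k
    · rw [if_pos (this.2 h), if_pos h, phi]
      ring
    · rw [if_neg (fun h' => h (this.1 h')), if_neg h, mul_zero]
end
end
end PS
end

section
set_option linter.unusedSectionVars false
open scoped ComplexOrder Matrix
/-! ### The sampling channel -/
set_option synthInstance.maxHeartbeats 400000
set_option synthInstance.maxSize 2000
namespace PS
noncomputable section

section
variable {n m κ : ℕ} {E S : Type} [Fintype E] [DecidableEq E] [Fintype S] [DecidableEq S]

/-- the purifications -/
def phiF (eK : Fin κ ≃ KT E S) (eM : Fin m ≃ E ⊕ S) (ψ : BString n → (E → Bool) → ℂ) (k : BString κ)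
    (z : BString (n + m)) : ℂ :=
  phi (S := S) ψ (fun p => k (eK.symm (Sum.inl p))) (fun p => k (eK.symm (Sum.inr p))) (bsplit n m z).1
    (fun i => (bsplit n m z).2 (eM.symm i))

variable (n E S) in
/-- rearranging wires -/
def wE : (KT E S ⊕ (Fin n ⊕ (E ⊕ S))) ⊕ KT E S ≃ WT n E S where
  toFun
    | .inl (.inl q) => .inr (.inl q)
    | .inl (.inr (.inl i)) => .inl (.inl (.inl i))
    | .inl (.inr (.inr (.inl i))) => .inl (.inl (.inr i))
    | .inl (.inr (.inr (.inr i))) => .inl (.inr i)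
    | .inr q => .inr (.inr q)
  invFun
    | .inr (.inl q) => .inl (.inl q)
    | .inl (.inl (.inl i)) => .inl (.inr (.inl i))
    | .inl (.inl (.inr i)) => .inl (.inr (.inr (.inl i)))
    | .inl (.inr i) => .inl (.inr (.inr (.inr i)))
    | .inr (.inr q) => .inr q
  left_inv := by rintro ((q | i | i | i) | q) <;> rfl
  right_inv := by rintro (((q | i) | i) | q | q) <;> rfl

/-- output wires -/
def wg2 (eK : Fin κ ≃ KT E S) (eM : Fin m ≃ E ⊕ S) : Fin (κ + (n + m)) ⊕ KT E S ≃ WT n E S :=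
  (Equiv.sumCongr (finSumFinEquiv.symm.trans (Equiv.sumCongr eK (finSumFinEquiv.symm.trans
    (Equiv.sumCongr (Equiv.refl _) eM)))) (Equiv.refl _)).trans (wE n E S)

theorem wg2_elim (eK : Fin κ ≃ KT E S) (eM : Fin m ≃ E ⊕ S) (k : BString κ) (a : BString n) (y : BString m) (u) :
    Sum.elim (bappend k (bappend a y)) u ∘ (wg2 eK eM).symm =
      wpack a (fun i => y (eM.symm (Sum.inl i))) (fun i => y (eM.symm (Sum.inr i))) (fun q => k (eK.symm q)) u := by
  refine wpack_ext ?_ ?_ ?_ ?_ ?_ <;> intro i <;> simp [wg2, wE, bappend_castAdd, bappend_natAdd]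

theorem phiF_bappend (eK : Fin κ ≃ KT E S) (eM : Fin m ≃ E ⊕ S) (ψ : BString n → (E → Bool) → ℂ) (k : BString κ)
    (a : BString n) (y : BString m) : phiF eK eM ψ k (bappend a y) =
      phi (S := S) ψ (fun p => k (eK.symm (Sum.inl p))) (fun p => k (eK.symm (Sum.inr p))) a (fun i => y (eM.symm i)) := by
  rw [phiF, bsplit_bappend]

theorem sampler (hS : 2 ≤ Fintype.card S) (V0 : Mx (Fin n ⊕ E)) (c : ℕ) (hV : UC V0 c)
    (eK : Fin κ ≃ KT E S) (eM : Fin m ≃ E ⊕ S) :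
    GB (fun M : QOp 0 => M bnil bnil • (((2 : ℂ) ^ κ)⁻¹ • ∑ k : BString κ,
      tensorOp (basisOp k) (vecState (phiF eK eM (fun a v => V0 (Sum.elim a v) (fun _ => false)) k))))
      (3 * (c + 3 * (Fintype.card S + Fintype.card (KT E S)) * (KC + 1)) + (n + Fintype.card E + Fintype.card S
        + (Fintype.card (KT E S) + Fintype.card (KT E S))) + Fintype.card (KT E S) + 1) := by
  obtain ⟨V, hV1, hV2⟩ := sampler_unitary (S := S) hS V0 c hV
  have hd := dil_gates hV1 (Equiv.emptySum (Fin 0) (WT n E S)) (wg2 (n := n) eK eM)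
  have hc : Fintype.card (WT n E S) = n + Fintype.card E + Fintype.card S
        + (Fintype.card (KT E S) + Fintype.card (KT E S)) := by
    rw [Fintype.card_sum, Fintype.card_sum, Fintype.card_sum, Fintype.card_sum, Fintype.card_fin]
  rw [hc] at hd
  convert hd using 1
  funext M
  ext x y
  obtain ⟨k, x', rfl⟩ := exists_bappend x
  obtain ⟨a, w, rfl⟩ := exists_bappend x'
  obtain ⟨k', y', rfl⟩ := exists_bappend y
  obtain ⟨a', w', rfl⟩ := exists_bappend y'
  have hz : ∀ p : BString 0, Sum.elim p (fun _ => false) ∘ (Equiv.emptySum (Fin 0) (WT n E S)).symm = fun _ => false := by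
    intro p; funext w; rfl
  have hp : ∀ p : BString 0, p = bnil := fun p => Subsingleton.elim _ _
  simp only [dil, Matrix.of_apply, hz, wg2_elim]
  have hV3 : ∀ a (w : BString m) (k : BString κ) u, V (wpack a (fun i => w (eM.symm (Sum.inl i))) (fun i => w (eM.symm (Sum.inr i)))
      (fun q => k (eK.symm q)) u) (fun _ => false) = if u = (fun q => k (eK.symm q)) then
        amp κ * phiF eK eM (fun a v => V0 (Sum.elim a v) (fun _ => false)) k (bappend a w) else 0 := by
    intro a w k u
    have := hV2 a (fun i => w (eM.symm i)) (fun q => k (eK.symm q)) u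
    rw [this, phiF_bappend, ← Fintype.card_congr eK, Fintype.card_fin]
  simp only [hV3]
  rw [Finset.sum_eq_single_of_mem (fun q => k (eK.symm q)) (Finset.mem_univ _)
    (fun u _ hu => by simp only [if_neg hu, zero_mul, Finset.sum_const_zero])]
  have hM : ∀ p q : BString 0, M p q = M bnil bnil := fun p q => congrArg₂ M (hp p) (hp q)
  simp only [Finset.univ_unique, Finset.sum_singleton, if_true]
  refine Eq.trans ?_ (congrArg₂ (· * ·) (congrArg _ (hM _ _).symm) rfl)
  simp only [Matrix.smul_apply, Matrix.sum_apply, smul_eq_mul, tensorOp_apply, basisOp, vecState, Matrix.of_apply]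
  rw [Finset.sum_eq_single_of_mem k (Finset.mem_univ _)
    (fun u _ hu => by rw [if_neg (fun h => hu h.1.symm), zero_mul])]
  by_cases h : k' = k
  · subst h
    simp only [if_true, and_self, star_mul]
    rw [← amp_sq]
    ring
  · have h2 : ¬ (fun q => k (eK.symm q)) = (fun q => k' (eK.symm q)) := by
      intro h3
      apply h
      funext q
      have := congrFun h3 (eK q)
      simpa using this.symm
    rw [if_neg h2, if_neg (fun h' => h h'.2)]
    simp

/-! Normalisation and partial trace. -/

theorem shiftB_sum (B : E × S → Bool) (f : (E → Bool) → ℂ) :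
    ∑ y : E ⊕ S → Bool, f (shiftB B y) = (2 : ℂ) ^ Fintype.card S * ∑ v, f v := by
  rw [← Equiv.sum_comp (Equiv.sumArrowEquivProdArrow E S Bool).symm, Fintype.sum_prod_type, Finset.sum_comm]
  have : ∀ r : S → Bool, ∑ v : E → Bool, f (shiftB B ((Equiv.sumArrowEquivProdArrow E S Bool).symm (v, r))) = ∑ v, f v := by
    intro r
    let g : (E → Bool) → (E → Bool) := fun v => shiftB B ((Equiv.sumArrowEquivProdArrow E S Bool).symm (v, r))
    have hg : Function.Involutive g := by
      intro v
      funext i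
      simp only [g, shiftB, Equiv.sumArrowEquivProdArrow_symm_apply_inl, Equiv.sumArrowEquivProdArrow_symm_apply_inr, bz_zb,
        add_assoc, z_add_self, add_zero, zb_bz]
    exact Equiv.sum_comp hg.toPerm f
  rw [Finset.sum_congr rfl fun r _ => this r, Finset.sum_const, nsmul_eq_mul, Finset.card_univ, Fintype.card_fun]
  simp

theorem sg_mul_self (z : ZMod 2) : sg z * star (sg z) = 1 := by
  rw [star_sg, ← sg_add, z_add_self, sg_zero]

theorem phiF_ptrace (eK : Fin κ ≃ KT E S) (eM : Fin m ≃ E ⊕ S) (ψ : BString n → (E → Bool) → ℂ) (k : BString κ) (a b : BString n) :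
    ptraceR (vecState (phiF eK eM ψ k)) a b = ∑ v, ψ a v * star (ψ b v) := by
  rw [ptraceR_apply]
  simp only [vecState, Matrix.of_apply, phiF_bappend, phi]
  have h : ∀ y : BString m,
     (amp (Fintype.card S) * (sg (phz (fun p => k (eK.symm (Sum.inl p))) (fun i => y (eM.symm i))) *
          ψ a (shiftB (fun p => k (eK.symm (Sum.inr p))) (fun i => y (eM.symm i))))) *
     star (amp (Fintype.card S) * (sg (phz (fun p => k (eK.symm (Sum.inl p))) (fun i => y (eM.symm i))) *
          ψ b (shiftB (fun p => k (eK.symm (Sum.inr p))) (fun i => y (eM.symm i))))) =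
     ((2 : ℂ) ^ Fintype.card S)⁻¹ * (fun v => ψ a v * star (ψ b v)) (shiftB (fun p => k (eK.symm (Sum.inr p))) (fun i => y (eM.symm i))) := by
    intro y
    rw [← amp_sq]
    have h1 := sg_mul_self (phz (fun p => k (eK.symm (Sum.inl p))) (fun i => y (eM.symm i)))
    simp only [star_mul]
    linear_combination (amp (Fintype.card S) * star (amp (Fintype.card S)) * ψ a (shiftB (fun p => k (eK.symm (Sum.inr p))) (fun i => y (eM.symm i))) * star (ψ b (shiftB (fun p => k (eK.symm (Sum.inr p))) (fun i => y (eM.symm i))))) * h1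
  rw [Finset.sum_congr rfl fun y _ => h y, ← Finset.mul_sum]
  have := Equiv.sum_comp (Equiv.arrowCongr eM (Equiv.refl Bool)) (fun y => (fun v => ψ a v * star (ψ b v)) (shiftB (fun p => k (eK.symm (Sum.inr p))) y))
  have h2 : ∀ y : BString m, (Equiv.arrowCongr eM (Equiv.refl Bool)) y = (fun i => y (eM.symm i)) := fun y => rfl
  simp only [h2] at this
  rw [this, shiftB_sum _ (fun v => ψ a v * star (ψ b v)), ← mul_assoc, inv_mul_cancel₀ (by positivity), one_mul]

theorem ptraceR_trace {a b : ℕ} (M : QOp (a + b)) : (ptraceR M).trace = M.trace := by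
  simp only [Matrix.trace, Matrix.diag_apply, ptraceR_apply]
  rw [sum_bappend]
end
end
end PS
end

section
set_option linter.unusedSectionVars false
open scoped ComplexOrder Matrix
/-! ### Comparison of the two states -/
set_option synthInstance.maxHeartbeats 400000
set_option synthInstance.maxSize 2000
namespace PS
noncomputable section

theorem sum_prod_mul {α β : Type} [Fintype α] [Fintype β] (F : α → ℂ) (H : β → ℂ) :
    ∑ p : α × β, F p.1 * H p.2 = (∑ a, F a) * ∑ b, H b := by
  rw [Fintype.sum_mul_sum, Fintype.sum_prod_type]

/-- the blocks of a string -/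
def blk {t n : ℕ} (x : BString (t * n)) (a : Fin t) : BString n := fun i => x (finProdFinEquiv (a, i))

/-- blocks -/
def blkE (t n : ℕ) : BString (t * n) ≃ (Fin t → BString n) where
  toFun := blk
  invFun := bflat
  left_inv x := by
    funext j
    obtain ⟨⟨a, i⟩, rfl⟩ := finProdFinEquiv.surjective j
    simp only [bflat, blk, Equiv.symm_apply_apply]
  right_inv f := by
    funext a i
    simp only [bflat, blk, Equiv.symm_apply_apply]

theorem blk_bflat {t n : ℕ} (f : Fin t → BString n) : blk (bflat f) = f := (blkE t n).right_inv f

theorem tensorOp_apply2 {a b : ℕ} (M : QOp a) (N : QOp b) (x y : BString (a + b)) :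
    tensorOp M N x y = M (fun i => x (Fin.castAdd b i)) (fun i => y (Fin.castAdd b i)) *
      N (fun i => x (Fin.natAdd a i)) (fun i => y (Fin.natAdd a i)) := by
  obtain ⟨x1, x2, rfl⟩ := exists_bappend x
  obtain ⟨y1, y2, rfl⟩ := exists_bappend y
  rw [tensorOp_apply]
  simp only [bappend_castAdd, bappend_natAdd]

theorem itTensor_apply {n : ℕ} (t : ℕ) (ρ : QOp n) (x y : BString (t * n)) :
    itTensor t ρ x y = ∏ a, ρ (blk x a) (blk y a) := by
  induction t with
  | zero => 
    rw [Finset.univ_eq_empty, Finset.prod_empty]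
    rfl
  | succ t ih =>
    have h : n + t * n = (t + 1) * n := by ring
    have h0 : itTensor (t + 1) ρ x y = tensorOp ρ (itTensor t ρ) (fun i => x (Fin.cast h i)) (fun i => y (Fin.cast h i)) := rfl
    rw [h0, tensorOp_apply2, ih, Fin.prod_univ_succ]
    have h1 : ∀ i : Fin n, Fin.cast h (Fin.castAdd (t * n) i) = finProdFinEquiv ((0 : Fin (t + 1)), i) := by
      intro i
      apply Fin.ext
      simp [finProdFinEquiv_apply_val]
    have h2 : ∀ (a : Fin t) (i : Fin n), Fin.cast h (Fin.natAdd n (finProdFinEquiv (a, i))) = finProdFinEquiv (a.succ, i) := by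
      intro a i
      apply Fin.ext
      simp [finProdFinEquiv_apply_val]
      ring
    simp only [h1]
    refine congrArg₂ (· * ·) rfl (Finset.prod_congr rfl fun a _ => ?_)
    have e : ∀ z : BString ((t + 1) * n), blk (fun i => z (Fin.cast h (Fin.natAdd n i))) a = blk z a.succ := by
      intro z
      funext i
      exact congrArg z (h2 a i)
    rw [e, e]

theorem itTensor_trace {n : ℕ} (t : ℕ) (ρ : QOp n) : (itTensor t ρ).trace = ρ.trace ^ t := by
  simp only [Matrix.trace, Matrix.diag_apply, itTensor_apply]
  rw [Fintype.sum_pow, ← Equiv.sum_comp (blkE t n)]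
  rfl

theorem itTensor_psd {n : ℕ} {V : Type} [Fintype V] [DecidableEq V] (t : ℕ) (ρ : QOp n) (ψ : BString n → V → ℂ)
    (h : ∀ a b, ρ a b = ∑ v, ψ a v * star (ψ b v)) : (itTensor t ρ).PosSemidef := by
  have : itTensor t ρ = ∑ f : Fin t → V, vecState (fun x => ∏ a, ψ (blk x a) (f a)) := by
    ext x y
    rw [itTensor_apply, Matrix.sum_apply]
    simp only [h, vecState, Matrix.of_apply]
    rw [Fintype.prod_sum]
    refine Finset.sum_congr rfl fun f _ => ?_
    rw [Finset.prod_mul_distrib, star_prod]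
  rw [this]
  exact Matrix.posSemidef_sum _ fun f _ => vecState_psd _

/-- The abstract distinguishing bound. -/
theorem dist_bound {N : ℕ} (ρ1 ρ2 : QOp N) (h1 : ρ1.PosSemidef) (h2 : ρ2.PosSemidef) (G : BString N → Prop)
    [DecidablePred G]
    (hG : ∀ x y, G x ∨ G y → ρ1 x y = ρ2 x y) (htr : ρ1.trace = ρ2.trace) (δ : ℝ)
    (hδ : (∑ x, if G x then 0 else ρ1 x x).re ≤ δ) {k : ℕ} (A : QOp N → QOp 1) (hA : Gates A k) (s : BString 1) :
    |diagProb (A ρ1) s - diagProb (A ρ2) s| ≤ δ := by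
  have kr := Gates.kr hA
  let P : QOp N := Matrix.diagonal fun x => if G x then 0 else 1
  have hP : Pᴴ = P := by
    rw [Matrix.diagonal_conjTranspose]
    congr 1
    funext x
    simp only [Pi.star_apply]
    split_ifs <;> simp
  have hB : ∀ (ρ : QOp N) x y, (P * ρ * P) x y = if G x ∨ G y then 0 else ρ x y := by
    intro ρ x y
    rw [Matrix.mul_diagonal, Matrix.diagonal_mul]
    by_cases hx : G x <;> by_cases hy : G y <;> simp [hx, hy]
  have hpsd : ∀ ρ : QOp N, ρ.PosSemidef → (P * ρ * P).PosSemidef := by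
    intro ρ h
    have := h.conjTranspose_mul_mul_same P
    rwa [hP] at this
  have hsub : ρ1 - ρ2 = P * ρ1 * P - P * ρ2 * P := by
    ext x y
    rw [Matrix.sub_apply, Matrix.sub_apply, hB, hB]
    by_cases h : G x ∨ G y
    · rw [hG x y h]; simp
    · simp [h]
  have hdiff : A ρ1 - A ρ2 = A (P * ρ1 * P) - A (P * ρ2 * P) := by
    have h := kr.linear
    rw [← h.map_sub, ← h.map_sub, hsub]
  have hbd : ∀ B : QOp N, B.PosSemidef → 0 ≤ diagProb (A B) s ∧ diagProb (A B) s ≤ B.trace.re := by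
    intro B hB
    have h3 := kr.pos B hB
    have h4 : ∀ x, 0 ≤ (A B x x).re := fun x => (Complex.le_def.1 (h3.diag_nonneg (i := x))).1
    refine ⟨h4 s, ?_⟩
    rw [← kr.tp B, Matrix.trace, Complex.re_sum]
    exact Finset.single_le_sum (f := fun x => (A B x x).re) (fun x _ => h4 x) (Finset.mem_univ s)
  have htB : ∀ ρ : QOp N, (P * ρ * P).trace = ∑ x, if G x then 0 else ρ x x := by
    intro ρ
    simp only [Matrix.trace, Matrix.diag_apply, hB, or_self]
  have htB2 : (∑ x, if G x then 0 else ρ2 x x) = ∑ x, if G x then 0 else ρ1 x x := by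
    have e : ∀ ρ : QOp N, (∑ x, if G x then 0 else ρ x x) = ρ.trace - ∑ x, if G x then ρ x x else 0 := by
      intro ρ
      rw [Matrix.trace, ← Finset.sum_sub_distrib]
      refine Finset.sum_congr rfl fun x _ => ?_
      split_ifs <;> simp
    rw [e, e, htr]
    congr 1
    refine Finset.sum_congr rfl fun x _ => ?_
    split_ifs with h
    · exact (hG x x (Or.inl h)).symm
    · rfl
  have b1 := hbd _ (hpsd _ h1)
  have b2 := hbd _ (hpsd _ h2)
  rw [htB] at b1 b2
  rw [htB2] at b2
  have : diagProb (A ρ1) s - diagProb (A ρ2) s = diagProb (A (P * ρ1 * P)) s - diagProb (A (P * ρ2 * P)) s := by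
    simp only [diagProb]
    rw [← Complex.sub_re, ← Complex.sub_re, ← Matrix.sub_apply, ← Matrix.sub_apply, hdiff]
  rw [this, abs_le]
  constructor <;> linarith [b1.1, b1.2, b2.1, b2.2]

section
variable {t n m : ℕ}

theorem blk_eq (x : BString (t * (n + m))) (a : Fin t) : blk x a = bappend (xA x a) (xY x a) := by
  rw [← bappend_bsplit (blk x a)]
  congr 1

/-- payload and labels -/
def ayE (t n m : ℕ) : BString (t * (n + m)) ≃ (Fin t → BString n) × (Fin t → BString m) where
  toFun x := (xA x, xY x)
  invFun p := bflat fun a => bappend (p.1 a) (p.2 a)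
  left_inv x := by
    have : (fun a => bappend (xA x a) (xY x a)) = blk x := funext fun a => (blk_eq x a).symm
    simp only [this]
    exact (blkE _ _).left_inv x
  right_inv p := by
    have h : ∀ a, blk (bflat fun a => bappend (p.1 a) (p.2 a)) a = bappend (p.1 a) (p.2 a) := fun a => by
      rw [blk_bflat]
    have h2 := fun a => (blk_eq _ a).symm.trans (h a)
    ext a i
    · exact congrFun (bappend_inj.1 (h2 a)).1 i
    · exact congrFun (bappend_inj.1 (h2 a)).2 i

theorem Sim_itTensor (σ : QOp n) (x y : BString (t * (n + m))) :
    Sim t n m (itTensor t σ) x y = if xY x ∘ spi (xY x) = xY y ∘ spi (xY y) then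
      ((2 : ℂ) ^ (t * m))⁻¹ * ∏ a, σ (xA x (spi (xY x) a)) (xA y (spi (xY y) a)) else 0 := by
  rw [Sim_apply]
  refine if_congr Iff.rfl ?_ rfl
  rw [itTensor_apply, blk_bflat, blk_bflat]
  rfl
end

section
variable {t n m κ : ℕ} {E S : Type} [Fintype E] [DecidableEq E] [Fintype S] [DecidableEq S]
  (eK : Fin κ ≃ KT E S) (eM : Fin m ≃ E ⊕ S) (ψ : BString n → (E → Bool) → ℂ)

/-- the averaged state -/
def avg (t : ℕ) : QOp (t * (n + m)) :=
  ((2 : ℂ) ^ κ)⁻¹ • ∑ k : BString κ, itTensor t (vecState (phiF eK eM ψ k))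

/-- relabelled labels -/
def lb (x : BString (t * (n + m))) : Fin t → E ⊕ S → Bool := fun a i => xY x a (eM.symm i)

theorem key_sum (f : ((E ⊕ S) × (E ⊕ S) × (E ⊕ S) → Bool) → (E × S → Bool) → ℂ) :
    ∑ k : BString κ, f (fun p => k (eK.symm (Sum.inl p))) (fun p => k (eK.symm (Sum.inr p))) = ∑ c, ∑ B, f c B := by
  rw [← Fintype.sum_prod_type']
  have := Equiv.sum_comp ((Equiv.arrowCongr eK (Equiv.refl Bool)).trans (Equiv.sumArrowEquivProdArrow _ _ Bool))
    (fun q : (((E ⊕ S) × (E ⊕ S) × (E ⊕ S) → Bool) × (E × S → Bool)) => f q.1 q.2)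
  rw [← this]
  rfl

theorem avg_apply (x y : BString (t * (n + m))) : avg eK eM ψ t x y =
    ((2 : ℂ) ^ κ)⁻¹ * ∑ c, ∑ B, ∏ a, phi (S := S) ψ c B (xA x a) (lb eM x a) * star (phi (S := S) ψ c B (xA y a) (lb eM y a)) := by
  rw [avg, Matrix.smul_apply, Matrix.sum_apply, smul_eq_mul, ← key_sum eK]
  congr 1
  refine Finset.sum_congr rfl fun k _ => ?_
  rw [itTensor_apply]
  refine Finset.prod_congr rfl fun a _ => ?_
  simp only [vecState, Matrix.of_apply, blk_eq, phiF_bappend]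
  rfl

theorem avg_psd : (avg eK eM ψ t).PosSemidef := by
  refine Matrix.PosSemidef.smul (Matrix.posSemidef_sum _ fun k _ => ?_) (by
    rw [show ((2 : ℂ) ^ κ)⁻¹ = (((2 : ℝ) ^ κ)⁻¹ : ℝ) by push_cast; rfl]
    exact_mod_cast (by positivity))
  exact itTensor_psd (V := Unit) t _ (fun x _ => phiF eK eM ψ k x) (fun a b => by simp [vecState])

variable (σ : QOp n)

theorem vec_trace (hσ : ∀ b b', σ b b' = ∑ v, ψ b v * star (ψ b' v)) (htr : σ.trace = 1) (k : BString κ) : (vecState (phiF eK eM ψ k)).trace = 1 := by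
  rw [← ptraceR_trace, ← htr]
  simp only [Matrix.trace, Matrix.diag_apply, phiF_ptrace, hσ]

theorem avg_trace (hσ : ∀ b b', σ b b' = ∑ v, ψ b v * star (ψ b' v)) (htr : σ.trace = 1) : (avg eK eM ψ t).trace = 1 := by
  rw [avg, Matrix.trace_smul, Matrix.trace_sum]
  simp only [itTensor_trace, vec_trace eK eM ψ σ hσ htr, one_pow, Finset.sum_const, Finset.card_univ,
    Fintype.card_fun, Fintype.card_bool, Fintype.card_fin, smul_eq_mul, nsmul_eq_mul, mul_one]
  push_cast
  exact inv_mul_cancel₀ (by positivity)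

theorem Sim_eq_avg_left (hσ : ∀ b b', σ b b' = ∑ v, ψ b v * star (ψ b' v)) (x y : BString (t * (n + m))) (hx : Good (lb eM x)) :
    Sim t n m (itTensor t σ) x y = avg eK eM ψ t x y := by
  rw [Sim_itTensor, avg_apply]
  by_cases h : xY x ∘ spi (xY x) = xY y ∘ spi (xY y)
  · rw [if_pos h]
    let π : Equiv.Perm (Fin t) := (spi (xY y)).symm.trans (spi (xY x))
    have hy : ∀ a, lb eM y a = lb eM x (π a) := by
      intro a
      funext i
      have := congrFun (congrFun h ((spi (xY y)).symm a)) (eM.symm i)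
      simp only [Function.comp_apply, Equiv.apply_symm_apply] at this
      exact this.symm
    simp only [hy]
    rw [moment_perm ψ σ hσ (lb eM x) hx (xA x) (xA y) π]
    have hk : κ = Fintype.card ((E ⊕ S) × (E ⊕ S) × (E ⊕ S)) + Fintype.card (E × S) := by
      rw [← Fintype.card_sum, ← Fintype.card_congr eK, Fintype.card_fin]
    have hm : Fintype.card (E ⊕ S) = m := by
      rw [← Fintype.card_congr eM, Fintype.card_fin]
    have hprod : ∏ a, σ (xA x (spi (xY x) a)) (xA y (spi (xY y) a)) = ∏ a, σ (xA x a) (xA y (π.symm a)) := by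
      rw [← Equiv.prod_comp (spi (xY x)) (fun a => σ (xA x a) (xA y (π.symm a)))]
      refine Finset.prod_congr rfl fun a _ => ?_
      congr 2
      rw [Equiv.eq_symm_apply]
      simp [π]
    rw [hprod, hm, ← pow_add, ← hk, ← pow_mul, mul_comm m t, ← mul_assoc, ← mul_assoc,
      inv_mul_cancel₀ (by positivity), one_mul]
  · rw [if_neg h, moment_zero ψ (lb eM x) (lb eM y) hx, mul_zero]
    intro π hπ
    apply h
    have : xY y = xY x ∘ π := by
      funext a i
      have := congrFun (congrFun hπ a) (eM i)
      simpa [lb] using this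
    rw [this, spi_comp]

theorem Sim_psd (hσ : ∀ b b', σ b b' = ∑ v, ψ b v * star (ψ b' v)) : (Sim t n m (itTensor t σ)).PosSemidef := by
  obtain ⟨k, _, hk⟩ := Sim_gates t n m
  exact (Gates.kr hk).pos _ (itTensor_psd t σ ψ hσ)

theorem Sim_eq_avg (hσ : ∀ b b', σ b b' = ∑ v, ψ b v * star (ψ b' v)) (x y : BString (t * (n + m))) (hx : Good (lb eM x) ∨ Good (lb eM y)) :
    Sim t n m (itTensor t σ) x y = avg eK eM ψ t x y := by
  rcases hx with hx | hx
  · exact Sim_eq_avg_left eK eM ψ σ hσ x y hx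
  · rw [← (Sim_psd (t := t) (m := m) ψ σ hσ).isHermitian.apply, ← (avg_psd (t := t) eK eM ψ).isHermitian.apply,
      Sim_eq_avg_left eK eM ψ σ hσ y x hx]

open Classical in
theorem bad_mass (hσ : ∀ b b', σ b b' = ∑ v, ψ b v * star (ψ b' v)) (htr : σ.trace = 1) :
    (∑ x : BString (t * (n + m)), if Good (lb eM x) then 0 else Sim t n m (itTensor t σ) x x).re ≤
      2 ^ t / 2 ^ Fintype.card S := by
  obtain ⟨g, hg⟩ : ∃ g : BString n → ℂ, ∀ b, g b = σ b b := ⟨fun b => σ b b, fun _ => rfl⟩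
  have hd : ∀ x : BString (t * (n + m)), (if Good (lb eM x) then 0 else Sim t n m (itTensor t σ) x x) =
      (fun p : (Fin t → BString n) × (Fin t → BString m) =>
        (∏ a, g (p.1 a)) * (if Good (fun a i => p.2 a (eM.symm i)) then 0 else ((2 : ℂ) ^ (t * m))⁻¹)) (ayE t n m x) := by
    intro x
    change _ = (∏ a, g (xA x a)) * (if Good (lb eM x) then 0 else ((2 : ℂ) ^ (t * m))⁻¹)
    simp only [Sim_itTensor, if_pos, hg]
    rw [Equiv.prod_comp (spi (xY x)) (fun a => σ (xA x a) (xA x a))]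
    split_ifs <;> ring
  rw [(Finset.sum_congr rfl fun x _ => hd x).trans (Equiv.sum_comp (ayE t n m) (fun p : (Fin t → BString n) × (Fin t → BString m) =>
        (∏ a, g (p.1 a)) * (if Good (fun a i => p.2 a (eM.symm i)) then 0 else ((2 : ℂ) ^ (t * m))⁻¹))),
    sum_prod_mul (fun A : Fin t → BString n => ∏ a, g (A a))
      (fun Y : Fin t → BString m => if Good (fun a i => Y a (eM.symm i)) then 0 else ((2 : ℂ) ^ (t * m))⁻¹)]
  have h1 : ∑ A : Fin t → BString n, ∏ a, g (A a) = 1 := by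
    rw [← Fintype.sum_pow g]
    have : ∑ b, g b = 1 := (Finset.sum_congr rfl fun b _ => hg b).trans htr
    rw [this, one_pow]
  rw [h1, one_mul]
  have h2 := Equiv.sum_comp (Equiv.arrowCongr (Equiv.refl (Fin t)) (Equiv.arrowCongr eM (Equiv.refl Bool)))
    (fun Y : Fin t → E ⊕ S → Bool => if Good Y then 0 else ((2 : ℂ) ^ (t * m))⁻¹)
  have h3 : ∑ Y : Fin t → BString m, (if Good (fun a i => Y a (eM.symm i)) then 0 else ((2 : ℂ) ^ (t * m))⁻¹) =
      ∑ Y : Fin t → E ⊕ S → Bool, if Good Y then 0 else ((2 : ℂ) ^ (t * m))⁻¹ := by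
    rw [← h2]; rfl
  rw [h3]
  have hm : Fintype.card (E ⊕ S) = m := by
    rw [← Fintype.card_congr eM, Fintype.card_fin]
  have h4 : ∑ Y : Fin t → E ⊕ S → Bool, (if Good Y then 0 else ((2 : ℂ) ^ (t * m))⁻¹) =
      (((Finset.univ.filter fun Y : Fin t → E ⊕ S → Bool => ¬ Good Y).card : ℝ) * ((2 : ℝ) ^ (t * m))⁻¹ : ℝ) := by
    rw [Finset.card_filter]
    push_cast
    rw [Finset.sum_mul]
    refine Finset.sum_congr rfl fun Y _ => ?_
    by_cases h : Good Y <;> simp [h]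
  rw [h4, Complex.ofReal_re]
  have h5 := bad_count E S t
  rw [hm, ← pow_mul, mul_comm m t] at h5
  have h6 : ((Finset.univ.filter fun Y : Fin t → E ⊕ S → Bool => ¬ Good Y).card : ℝ) * 2 ^ Fintype.card S ≤ 2 ^ t * 2 ^ (t * m) := by
    exact_mod_cast h5
  rw [le_div_iff₀ (by positivity), mul_right_comm, ← div_eq_mul_inv, div_le_iff₀ (by positivity)]
  exact h6

theorem main_bound (hσ : ∀ b b', σ b b' = ∑ v, ψ b v * star (ψ b' v)) (htr : σ.trace = 1) {k : ℕ} (A : QOp (t * (n + m)) → QOp 1) (hA : Gates A k) (s : BString 1) :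
    |diagProb (A (Sim t n m (itTensor t σ))) s - diagProb (A (avg eK eM ψ t)) s| ≤ 2 ^ t / 2 ^ Fintype.card S := by
  classical
  refine dist_bound _ _ (Sim_psd ψ σ hσ) (avg_psd eK eM ψ) (fun x => Good (lb eM x))
    (Sim_eq_avg eK eM ψ σ hσ) ?_ _ ?_ A hA s
  · obtain ⟨k, _, hk⟩ := Sim_gates t n m
    rw [(Gates.kr hk).tp, itTensor_trace, htr, one_pow, avg_trace eK eM ψ σ hσ htr]
  · have := bad_mass (t := t) eM ψ σ hσ htr
    convert this
end
end
end PS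
end

section
set_option linter.unusedSectionVars false
open scoped ComplexOrder Matrix
/-! ### Assembly -/
set_option synthInstance.maxHeartbeats 400000
set_option synthInstance.maxSize 2000
namespace PS
noncomputable section

/-- cost of sampling -/
def sampCost (c e n s : ℕ) : ℕ :=
  3 * (c + 3 * (s + ((e + s) * ((e + s) * (e + s)) + e * s)) * (KC + 1)) + (n + e + s
    + (((e + s) * ((e + s) * (e + s)) + e * s) + ((e + s) * ((e + s) * (e + s)) + e * s)))
    + ((e + s) * ((e + s) * (e + s)) + e * s) + 1

theorem sampCost_mono {c e n s c' e' n' s' : ℕ} (hc : c ≤ c') (he : e ≤ e') (hn : n ≤ n') (hs : s ≤ s') :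
    sampCost c e n s ≤ sampCost c' e' n' s' := by
  unfold sampCost
  gcongr

theorem per_l (tc l n : ℕ) (σ : QOp n) (htr : σ.trace = 1) (c e : ℕ) (hp : Pur σ c e) :
    ∃ (m κ : ℕ) (φ : BString κ → BString (n + m) → ℂ), (∀ k, (vecState (φ k)).trace = 1) ∧
      GB (fun M : QOp 0 => M bnil bnil • (((2 : ℂ) ^ κ)⁻¹ • ∑ k : BString κ,
        tensorOp (basisOp k) (vecState (φ k)))) (sampCost c e n (tc + l + 2)) ∧
      (∀ (k : ℕ) (A : QOp (tc * (n + m)) → QOp 1), Gates A k → ∀ s,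
        |diagProb (A (Sim tc n m (itTensor tc σ))) s -
          diagProb (A (((2 : ℂ) ^ κ)⁻¹ • ∑ k : BString κ, itTensor tc (vecState (φ k)))) s| ≤ (1 / 2) ^ l) ∧
      ((2 : ℂ) ^ κ)⁻¹ • ∑ k : BString κ, ptraceR (vecState (φ k)) = σ := by
  obtain ⟨E, _, _, V0, hE, hV, hσ⟩ := hp
  let S := Fin (tc + l + 2)
  let ψ : BString n → (E → Bool) → ℂ := fun a v => V0 (Sum.elim a v) (fun _ => false)
  let eK := (Fintype.equivFin (KT E S)).symm
  let eM := (Fintype.equivFin (E ⊕ S)).symm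
  refine ⟨_, _, phiF eK eM ψ, vec_trace eK eM ψ σ hσ htr, ?_, ?_, ?_⟩
  · refine GB.mono (sampler (S := S) (by simp [S]) V0 c hV eK eM) ?_
    have h : Fintype.card (KT E S) = (Fintype.card E + (tc + l + 2)) * ((Fintype.card E + (tc + l + 2)) *
        (Fintype.card E + (tc + l + 2))) + Fintype.card E * (tc + l + 2) := by
      simp [S, KT]
    have h2 : Fintype.card S = tc + l + 2 := by simp [S]
    rw [h, h2]
    exact sampCost_mono le_rfl hE le_rfl le_rfl
  · intro k A hA s
    refine (main_bound (t := tc) eK eM ψ σ hσ htr A hA s).trans ?_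
    rw [Fintype.card_fin, pow_add, pow_add, one_div, inv_pow, mul_assoc, div_mul_eq_div_div, div_self (by positivity), one_div]
    gcongr
    norm_num
  · have : ∀ k, ptraceR (vecState (phiF eK eM ψ k)) = σ := by
      intro k
      ext a b
      rw [phiF_ptrace, hσ]
    simp only [this, Finset.sum_const, Finset.card_univ, Fintype.card_fun, Fintype.card_bool, Fintype.card_fin]
    rw [← Nat.cast_smul_eq_nsmul ℂ, smul_smul]
    push_cast
    rw [inv_mul_cancel₀ (by positivity), one_smul]

theorem negl_half : Negligible (fun l => (1 / 2 : ℝ) ^ l) := by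
  intro c
  have h := tendsto_pow_const_mul_const_pow_of_lt_one c (r := (1 / 2 : ℝ)) (by norm_num) (by norm_num)
  have h2 := (h.eventually (gt_mem_nhds (show (0 : ℝ) < 1 by norm_num))).and (Filter.eventually_ge_atTop 1)
  obtain ⟨N, hN⟩ := Filter.eventually_atTop.1 h2
  refine ⟨N, fun n hn => ?_⟩
  obtain ⟨h3, h4⟩ := hN n hn
  have hpos : (0 : ℝ) < (n : ℝ) ^ c := by
    have : (0 : ℝ) < n := by exact_mod_cast h4
    positivity
  rw [abs_of_nonneg (by positivity), le_div_iff₀ hpos, mul_comm]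
  exact h3.le

theorem negl_zero : Negligible (fun _ => 0) := by
  intro c
  exact ⟨0, fun n _ => by simp only [abs_zero]; positivity⟩

/-- the bound for the simulator -/
def simPoly : Polynomial ℕ :=
  3 * ((.X * .X * ((.X + .X + .X) * .C KC) + (.X * .X * .C KC + .X * .X * ((.X + .X + .X) * .C KC))) + .X * .X) +
      (.X * .X + (.X * .X + (.X * .X * (.X + 1) + 2))) + (.X * .X + (.X * .X * (.X + 1) + 2)) + 1

theorem Sim_poly (t n m : ℕ) : ∃ k ≤ simPoly.eval (t + n + m), Gates (Sim t n m) k := by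
  refine GB.mono (Sim_gates t n m) ?_
  simp only [simPoly, Polynomial.eval_add, Polynomial.eval_mul, Polynomial.eval_X, Polynomial.eval_C,
    Polynomial.eval_one, Polynomial.eval_ofNat]
  have ht : t ≤ t + n + m := by omega
  have hn : n ≤ t + n + m := by omega
  have hm : m ≤ t + n + m := by omega
  generalize t + n + m = N at *
  gcongr

/-- the bound for the sampler -/
def sampPoly (p t : Polynomial ℕ) : Polynomial ℕ :=
  3 * (.C KC * p + 3 * ((t + .X + 2) + ((4 * p + (t + .X + 2)) * ((4 * p + (t + .X + 2)) * (4 * p + (t + .X + 2))) + 4 * p * (t + .X + 2))) * (.C KC + 1)) + (p + 4 * p + (t + .X + 2)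
    + (((4 * p + (t + .X + 2)) * ((4 * p + (t + .X + 2)) * (4 * p + (t + .X + 2))) + 4 * p * (t + .X + 2)) + ((4 * p + (t + .X + 2)) * ((4 * p + (t + .X + 2)) * (4 * p + (t + .X + 2))) + 4 * p * (t + .X + 2))))
    + ((4 * p + (t + .X + 2)) * ((4 * p + (t + .X + 2)) * (4 * p + (t + .X + 2))) + 4 * p * (t + .X + 2)) + 1

theorem sampPoly_eval (p t : Polynomial ℕ) (l : ℕ) :
    (sampPoly p t).eval l = sampCost (KC * p.eval l) (4 * p.eval l) (p.eval l) (t.eval l + l + 2) := by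
  simp only [sampPoly, sampCost, Polynomial.eval_add, Polynomial.eval_mul, Polynomial.eval_X, Polynomial.eval_C,
    Polynomial.eval_one, Polynomial.eval_ofNat]

theorem pur_of_gates {n k : ℕ} {σ : QOp n} (h : Gates (fun M : QOp 0 => M bnil bnil • σ) k) :
    Pur σ (KC * k) (4 * k) := by
  have := Gates.pur h Pur.unit
  simpa [unitOp] using this

theorem all (t : Polynomial ℕ) :
    ∃ Sim : ∀ tc n m : ℕ, QOp (tc * n) → QOp (tc * (n + m)),
      (∀ tc n m, IsChannel (Sim tc n m)) ∧
      (∃ p : Polynomial ℕ, ∀ tc n m, ∃ k ≤ p.eval (tc + n + m), Gates (Sim tc n m) k) ∧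
      (∀ (n : ℕ → ℕ) (σ : ∀ l, QOp (n l)),
        (∀ l, IsDensity (σ l)) →
        PolyGates (fun _ => 0) n (fun l M => M bnil bnil • σ l) →
        ∃ (m κ : ℕ → ℕ) (φ : ∀ l, BString (κ l) → BString (n l + m l) → ℂ),
          (∀ l k, (vecState (φ l k)).trace = 1) ∧
          PolyGates (fun _ => 0) (fun l => κ l + (n l + m l))
            (fun l M => M bnil bnil •
              (((2 : ℂ) ^ κ l)⁻¹ • ∑ k : BString (κ l),
                tensorOp (basisOp k) (vecState (φ l k)))) ∧
          CompIndist (fun l => t.eval l * (n l + m l))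
            (fun l => Sim (t.eval l) (n l) (m l) (itTensor (t.eval l) (σ l)))
            (fun l => ((2 : ℂ) ^ κ l)⁻¹ • ∑ k : BString (κ l),
              itTensor (t.eval l) (vecState (φ l k))) ∧
          CompIndist n σ
            (fun l => ((2 : ℂ) ^ κ l)⁻¹ • ∑ k : BString (κ l),
              ptraceR (vecState (φ l k)))) := by
  refine ⟨Sim, fun t n m => ?_, ⟨simPoly, Sim_poly⟩, ?_⟩
  · obtain ⟨k, _, hk⟩ := Sim_poly t n m
    exact Gates.isChannel hk
  · rintro n σ hσ ⟨p, hp⟩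
    choose k hk hg using hp
    have hl := fun l => per_l (t.eval l) l (n l) (σ l) (hσ l).2 _ _ (pur_of_gates (hg l))
    choose m κ φ h1 h2 h3 h4 using hl
    refine ⟨m, κ, φ, h1, ⟨sampPoly p t, fun l => ?_⟩, ?_, ?_⟩
    · refine GB.mono (h2 l) ?_
      rw [sampPoly_eval]
      have : n l ≤ 0 + k l := Gates.width (hg l)
      have := hk l
      exact sampCost_mono (Nat.mul_le_mul_left _ (hk l)) (by omega) (by omega) le_rfl
    · rintro A ⟨q, hq⟩
      refine ⟨_, negl_half, fun l => ?_⟩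
      obtain ⟨k', _, hA⟩ := hq l
      exact h3 l k' (A l) hA _
    · rintro A _
      refine ⟨_, negl_zero, fun l => ?_⟩
      simp only [h4, sub_self, abs_zero, le_refl]
end
end PS
end

/- ================================================================
   STATEMENT 9.  If PRUs exist, there is an (efficient) quantum
   channel `Sim_t` such that every efficiently samplable mixed state
   `σ` has a family of efficiently samplable purifications `|φ_k⟩`
   with  (1) `Sim_t(σ^{⊗t}) ≈ E_k[|φ_k⟩⟨φ_k|^{⊗t}]`  and
   (2) `σ ≈ E_k[Tr_B |φ_k⟩⟨φ_k|]`.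
   ================================================================ -/

theorem purification_simulation_from_PRU
    (hPRU : Nonempty PRU) (t : Polynomial ℕ) :
    ∃ Sim : ∀ tc n m : ℕ, QOp (tc * n) → QOp (tc * (n + m)),
      (∀ tc n m, IsChannel (Sim tc n m)) ∧
      (∃ p : Polynomial ℕ, ∀ tc n m, ∃ k ≤ p.eval (tc + n + m), Gates (Sim tc n m) k) ∧
      (∀ (n : ℕ → ℕ) (σ : ∀ l, QOp (n l)),
        (∀ l, IsDensity (σ l)) →
        PolyGates (fun _ => 0) n (fun l M => M bnil bnil • σ l) →
        ∃ (m κ : ℕ → ℕ) (φ : ∀ l, BString (κ l) → BString (n l + m l) → ℂ),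
          (∀ l k, (vecState (φ l k)).trace = 1) ∧
          -- the ensemble {k, |φ_k⟩} is efficiently samplable
          PolyGates (fun _ => 0) (fun l => κ l + (n l + m l))
            (fun l M => M bnil bnil •
              (((2 : ℂ) ^ κ l)⁻¹ • ∑ k : BString (κ l),
                tensorOp (basisOp k) (vecState (φ l k)))) ∧
          -- (1)  Sim_t (σ^{⊗t})  ≈  E_k [ |φ_k⟩⟨φ_k|^{⊗t} ]
          CompIndist (fun l => t.eval l * (n l + m l))
            (fun l => Sim (t.eval l) (n l) (m l) (itTensor (t.eval l) (σ l)))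
            (fun l => ((2 : ℂ) ^ κ l)⁻¹ • ∑ k : BString (κ l),
              itTensor (t.eval l) (vecState (φ l k))) ∧
          -- (2)  σ  ≈  E_k [ Tr_B |φ_k⟩⟨φ_k| ]
          CompIndist n σ
            (fun l => ((2 : ℂ) ^ κ l)⁻¹ • ∑ k : BString (κ l),
              ptraceR (vecState (φ l k)))) := by
  exact PS.all t
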